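/- Suppose the structure on ℝ is d-minimal. Let M ⊆ ℝⁿ be a D^p submanifold, let {D_i}_{1≤i≤k} be a finite family of D^{p−1} vector fields on M, and let ε : M → ℝ be a positive definable continuous function. Then there exists a positive definable C^p function f : M → ℝ such that |D_{α₁}⋯D_{α_m} f| < ε on M for every sequence α = (α₁,…,α_m) of integers in {1,…,k} of length m ≤ p. -/

import Mathlib

open FirstOrder Set Filter Topology
open scoped Classical

noncomputable section

namespace DMinPaper

variable (L : FirstOrder.Language) [L.Structure ℝ]

/-- A subset of `ℝ^α` is definable (with parameters from `ℝ`) in the structure `L`. -/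
def IsDef {α : Type} (s : Set (α → ℝ)) : Prop :=
  (Set.univ : Set ℝ).Definable L s

/-- Definability of an `ℝ`-valued function on a subset `M ⊆ ℝ^α`, via its graph. -/
def IsDefFunOn {α : Type} (M : Set (α → ℝ)) (f : (α → ℝ) → ℝ) : Prop :=
  IsDef L {z : (α ⊕ Unit) → ℝ |
    (fun i => z (Sum.inl i)) ∈ M ∧ z (Sum.inr ()) = f (fun i => z (Sum.inl i))}

/-- Definability of a map `M → ℝ^β` on a subset `M ⊆ ℝ^α`, via its graph. -/
def IsDefMapOn {α β : Type} (M : Set (α → ℝ)) (f : (α → ℝ) → (β → ℝ)) : Prop :=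
  IsDef L {z : (α ⊕ β) → ℝ |
    (fun i => z (Sum.inl i)) ∈ M ∧ (fun j => z (Sum.inr j)) = f (fun i => z (Sum.inl i))}

/-- Definability of an `ℝ`-valued function on a subset of a product `ℝ^α × ℝ^β`. -/
def IsDefFun2On {α β : Type} (S : Set ((α → ℝ) × (β → ℝ)))
    (f : (α → ℝ) × (β → ℝ) → ℝ) : Prop :=
  IsDef L {z : ((α ⊕ β) ⊕ Unit) → ℝ |
    ((fun i => z (Sum.inl (Sum.inl i)), fun j => z (Sum.inl (Sum.inr j))) ∈ S) ∧
    z (Sum.inr ()) = f (fun i => z (Sum.inl (Sum.inl i)), fun j => z (Sum.inl (Sum.inr j)))}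

/-- Definability of a map into `ℝ^γ` on a subset of a product `ℝ^α × ℝ^β`. -/
def IsDefMap2On {α β γ : Type} (S : Set ((α → ℝ) × (β → ℝ)))
    (f : (α → ℝ) × (β → ℝ) → (γ → ℝ)) : Prop :=
  IsDef L {z : ((α ⊕ β) ⊕ γ) → ℝ |
    ((fun i => z (Sum.inl (Sum.inl i)), fun j => z (Sum.inl (Sum.inr j))) ∈ S) ∧
    (fun l => z (Sum.inr l)) = f (fun i => z (Sum.inl (Sum.inl i)), fun j => z (Sum.inl (Sum.inr j)))}

/-- Definability of a function `ℝ → ℝ`, via its graph. -/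
def IsDefFunR (f : ℝ → ℝ) : Prop :=
  IsDef L {z : Fin 2 → ℝ | z 1 = f (z 0)}

/-- The structure expands the ordered field of real numbers: the order, addition and
multiplication are definable. -/
def ExpandsOrderedField : Prop :=
  IsDef L {x : Fin 2 → ℝ | x 0 < x 1} ∧
  IsDef L {x : Fin 3 → ℝ | x 2 = x 0 + x 1} ∧
  IsDef L {x : Fin 3 → ℝ | x 2 = x 0 * x 1}

/-- A discrete subset of `ℝ`. -/
def IsDiscreteSet (D : Set ℝ) : Prop :=
  ∀ x ∈ D, ∃ U : Set ℝ, IsOpen U ∧ U ∩ D = {x}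

/-- d-minimality: the structure expands the ordered field of reals, and in every definable
family of subsets of `ℝ` each fiber is the union of an open set and `N` discrete sets, where
`N` does not depend on the parameter. -/
def DMinimal : Prop :=
  ExpandsOrderedField L ∧
  ∀ (k : ℕ) (S : Set ((Fin k ⊕ Unit) → ℝ)), IsDef L S →
    ∃ N : ℕ, ∀ a : Fin k → ℝ,
      ∃ (U : Set ℝ) (D : Fin N → Set ℝ),
        IsOpen U ∧ (∀ i, IsDiscreteSet (D i)) ∧
        {t : ℝ | Sum.elim a (fun _ => t) ∈ S} = U ∪ ⋃ i, D i

variable {E F : Type} [NormedAddCommGroup E] [NormedSpace ℝ E]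
  [NormedAddCommGroup F] [NormedSpace ℝ F]

/-- `f` is of class `C^p` on `M` (as a function on the submanifold `M`): near each point of `M`
it coincides on `M` with a `C^p` function defined on an ambient open set. -/
def CpOn (p : ℕ) (f : E → F) (M : Set E) : Prop :=
  ∀ x ∈ M, ∃ (U : Set E) (g : E → F),
    IsOpen U ∧ x ∈ U ∧ ContDiffOn ℝ p g U ∧ Set.EqOn f g (M ∩ U)

/-- The tangent vectors to `M` at `x`: velocities of differentiable curves through `x`
staying in `M`. -/
def TangentVecs (M : Set E) (x : E) : Set E :=
  {v | ∃ γ : ℝ → E, γ 0 = x ∧ (∀ᶠ t in 𝓝 (0:ℝ), γ t ∈ M) ∧ HasDerivAt γ v 0}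

/-- The differential of `f : M → N` at `x` is surjective onto the tangent space of `N`
at `f x`. -/
def SubmersionAtOn (f : E → F) (M : Set E) (N : Set F) (x : E) : Prop :=
  ∀ w ∈ TangentVecs N (f x), ∃ (γ : ℝ → E) (v : E),
    γ 0 = x ∧ (∀ᶠ t in 𝓝 (0:ℝ), γ t ∈ M) ∧ HasDerivAt γ v 0 ∧
    HasDerivAt (fun t => f (γ t)) w 0

/-- `x` is a critical point of `f : M → ℝ`: the differential of `f` at `x` vanishes on all
tangent vectors of `M` at `x`. -/
def IsCritPtOn (f : E → ℝ) (M : Set E) (x : E) : Prop :=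
  x ∈ M ∧ ∀ (γ : ℝ → E) (v : E), γ 0 = x → (∀ᶠ t in 𝓝 (0:ℝ), γ t ∈ M) →
    HasDerivAt γ v 0 → HasDerivAt (fun t => f (γ t)) 0 0

/-- `x` is a nondegenerate critical point of `f : M → ℝ` on the `d`-dimensional submanifold
`M`: in a local `C²` parametrization `ψ` of `M` at `x`, the Hessian of `f ∘ ψ` is a
nondegenerate bilinear form. -/
def IsNondegCritPtOn (f : E → ℝ) (M : Set E) (d : ℕ) (x : E) : Prop :=
  IsCritPtOn f M x ∧
  ∃ (W : Set (Fin d → ℝ)) (ψ : (Fin d → ℝ) → E) (w0 : Fin d → ℝ),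
    IsOpen W ∧ w0 ∈ W ∧ ContDiffOn ℝ 2 ψ W ∧ ψ w0 = x ∧ Set.MapsTo ψ W M ∧
    Function.Injective (fun u => fderiv ℝ ψ w0 u) ∧
    ∀ v : Fin d → ℝ, v ≠ 0 → ∃ w : Fin d → ℝ,
      iteratedFDeriv ℝ 2 (fun z => f (ψ z)) w0 ![v, w] ≠ 0

/-- `f` is a Morse function on the `d`-dimensional submanifold `M`: all critical points are
nondegenerate and distinct critical points have distinct critical values. -/
def IsMorseOn (f : E → ℝ) (M : Set E) (d : ℕ) : Prop :=
  (∀ x, IsCritPtOn f M x → IsNondegCritPtOn f M d x) ∧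
  ∀ x y, IsCritPtOn f M x → IsCritPtOn f M y → x ≠ y → f x ≠ f y

/-- `M ⊆ ℝⁿ` is a definable `C^p` submanifold of dimension `d`: `M` is definable and every
point of `M` has a definable `C^p` chart of `ℝⁿ` flattening `M` onto `ℝ^d × {0}`. -/
def IsDpSubmanifold (p : ℕ) {n : ℕ} (d : ℕ) (M : Set (Fin n → ℝ)) : Prop :=
  IsDef L M ∧ d ≤ n ∧
  ∀ x ∈ M, ∃ (U V : Set (Fin n → ℝ)) (φ ψ : (Fin n → ℝ) → (Fin n → ℝ)),
    IsOpen U ∧ x ∈ U ∧ IsOpen V ∧ (0 : Fin n → ℝ) ∈ V ∧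
    IsDef L U ∧ IsDef L V ∧ IsDefMapOn L U φ ∧ IsDefMapOn L V ψ ∧
    ContDiffOn ℝ p φ U ∧ ContDiffOn ℝ p ψ V ∧
    Set.MapsTo φ U V ∧ Set.MapsTo ψ V U ∧
    (∀ y ∈ U, ψ (φ y) = y) ∧ (∀ y ∈ V, φ (ψ y) = y) ∧
    φ x = 0 ∧ φ '' (M ∩ U) = V ∩ {y | ∀ i : Fin n, d ≤ (i : ℕ) → y i = 0}

/-- The definable set `X ⊆ ℝⁿ` has dimension at least `d`: some projection of `X` onto `d`
of the coordinates has nonempty interior. -/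
def hasDimGE {n : ℕ} (X : Set (Fin n → ℝ)) (d : ℕ) : Prop :=
  ∃ ι : Fin d → Fin n, StrictMono ι ∧ (interior ((fun x => fun i => x (ι i)) '' X)).Nonempty

/-- The dimension of `X ⊆ ℝⁿ`: the largest `d` such that some coordinate projection of `X`
onto `ℝ^d` has nonempty interior; `⊥` (i.e. `-∞`) for the empty set. -/
noncomputable def dimDef {n : ℕ} (X : Set (Fin n → ℝ)) : WithBot ℕ :=
  if X.Nonempty then ((sSup {d : ℕ | hasDimGE X d} : ℕ) : WithBot ℕ) else ⊥

/-- The coordinate projection `ℝⁿ → ℝ^d` determined by `ι`. -/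
def projc {n d : ℕ} (ι : Fin d → Fin n) (x : Fin n → ℝ) : Fin d → ℝ := fun i => x (ι i)

/-- An open box in `ℝⁿ`: a product of `n` nonempty open intervals. -/
def IsOpenBox {n : ℕ} (U : Set (Fin n → ℝ)) : Prop :=
  ∃ a b : Fin n → ℝ, (∀ i, a i < b i) ∧ U = Set.univ.pi fun i => Set.Ioo (a i) (b i)

/-- `M` is locally, at `x`, the image of a definable `C^p` section `τ` of the coordinate
projection `projc ι`. -/
def MultiGraphPtAt (p : ℕ) {n d : ℕ} (ι : Fin d → Fin n) (M : Set (Fin n → ℝ))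
    (x : Fin n → ℝ) : Prop :=
  ∃ U : Set (Fin n → ℝ), IsOpenBox U ∧ x ∈ U ∧
    ∃ τ : (Fin d → ℝ) → (Fin n → ℝ),
      IsDefMapOn L (projc ι '' U) τ ∧ ContDiffOn ℝ p τ (projc ι '' U) ∧
      M ∩ U = τ '' (projc ι '' U) ∧ ∀ z ∈ projc ι '' U, projc ι (τ z) = z

/-- A `D^p` multi-valued graph with respect to the coordinate projection `projc ι`. -/
def IsMultiGraph (p : ℕ) {n d : ℕ} (ι : Fin d → Fin n) (M : Set (Fin n → ℝ)) : Prop :=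
  IsDpSubmanifold L p d M ∧ ∀ x ∈ M, MultiGraphPtAt L p ι M x

/-- The gradient vector `(∂g/∂x₁, …, ∂g/∂x_d)` of `g : ℝ^d → ℝ` at `z`. -/
noncomputable def gradVec {d : ℕ} (g : (Fin d → ℝ) → ℝ) (z : Fin d → ℝ) : Fin d → ℝ :=
  fun i => fderiv ℝ g z (Pi.single i 1)

/-- The Hessian matrix `(∂²g/∂x_i∂x_j)` of `g : ℝ^d → ℝ` at `z`. -/
noncomputable def hessMat {d : ℕ} (g : (Fin d → ℝ) → ℝ) (z : Fin d → ℝ) :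
    Matrix (Fin d) (Fin d) ℝ :=
  Matrix.of fun i j => fderiv ℝ (fun w => fderiv ℝ g w (Pi.single j 1)) z (Pi.single i 1)

/-- The derivative of `f : M → ℝ` at `x` along the vector field `D`: the common value of
`d_x g (D x)` over all local `C¹` extensions `g` of `f` (and `0` if there is no such common
value). -/
noncomputable def vderiv (M : Set E) (D : E → E) (f : E → ℝ) (x : E) : ℝ :=
  if h : ∃ w : ℝ, ∀ (U : Set E) (g : E → ℝ), IsOpen U → x ∈ U → ContDiffOn ℝ 1 g U →
      Set.EqOn f g (M ∩ U) → fderiv ℝ g x (D x) = w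
  then h.choose else 0

/-- Iterated derivative `D_{α₁} ⋯ D_{α_m} f` of `f : M → ℝ` along a finite family of vector
fields, indexed by a list `α`. -/
noncomputable def vderivIter {k : ℕ} (M : Set E) (D : Fin k → E → E) :
    List (Fin k) → (E → ℝ) → E → ℝ
  | [], f => f
  | i :: l, f => vderiv M (D i) (vderivIter M D l f)

set_option synthInstance.maxSize 100000

section Toolkit

/-- A type identified with a finite power of `ℝ`. -/
class Ctx (Γ : Type) where
  ι : Type
  fin : Finite ι
  e : Γ ≃ (ι → ℝ)

instance ctxReal : Ctx ℝ := ⟨Unit, inferInstance, (Equiv.funUnique Unit ℝ).symm⟩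
instance ctxPi {ι : Type} [h : Finite ι] : Ctx (ι → ℝ) := ⟨ι, h, Equiv.refl _⟩
instance ctxProd {Γ Δ : Type} [a : Ctx Γ] [b : Ctx Δ] : Ctx (Γ × Δ) :=
  ⟨a.ι ⊕ b.ι, by have := a.fin; have := b.fin; infer_instance,
    (Equiv.prodCongr a.e b.e).trans (Equiv.sumArrowEquivProdArrow _ _ _).symm⟩

/-- definable predicate -/
class Def {Γ : Type} [Ctx Γ] (P : Γ → Prop) : Prop where
  out : IsDef L {v : Ctx.ι Γ → ℝ | P (Ctx.e.symm v)}

/-- definable function -/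
class DefF {Γ Δ : Type} [Ctx Γ] [Ctx Δ] (f : Γ → Δ) : Prop where
  out : Def L (fun q : Γ × Δ => f q.1 = q.2)

/-- ordered field structure definable -/
class OF : Prop where
  out : ExpandsOrderedField L

variable {L}
variable {Γ Δ Ε : Type} [Ctx Γ] [Ctx Δ] [Ctx Ε]

theorem def_congr {P Q : Γ → Prop} (h : Def L P) (e : ∀ x, P x ↔ Q x) : Def L Q := by
  have : P = Q := funext fun x => propext (e x)
  exact this ▸ h

instance Def.and {P Q : Γ → Prop} [hP : Def L P] [hQ : Def L Q] : Def L (fun x => P x ∧ Q x) :=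
  ⟨hP.out.inter hQ.out⟩
instance Def.or {P Q : Γ → Prop} [hP : Def L P] [hQ : Def L Q] : Def L (fun x => P x ∨ Q x) :=
  ⟨hP.out.union hQ.out⟩
instance Def.not {P : Γ → Prop} [hP : Def L P] : Def L (fun x => ¬ P x) :=
  ⟨hP.out.compl⟩
instance Def.imp {P Q : Γ → Prop} [hP : Def L P] [hQ : Def L Q] : Def L (fun x => P x → Q x) :=
  def_congr (P := fun x => ¬ P x ∨ Q x) inferInstance (fun x => by tauto)
instance Def.iff {P Q : Γ → Prop} [hP : Def L P] [hQ : Def L Q] : Def L (fun x => P x ↔ Q x) :=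
  def_congr (P := fun x => (P x → Q x) ∧ (Q x → P x)) inferInstance (fun x => by tauto)
instance Def.const {c : Prop} : Def L (fun _ : Γ => c) := by
  by_cases h : c
  · simp only [h]; exact ⟨definable_univ⟩
  · simp only [h]; exact ⟨definable_empty⟩

/-- coordinate maps -/
def IsCoord (f : Γ → Δ) : Prop :=
  ∃ σ : Ctx.ι Δ → Ctx.ι Γ, ∀ x j, Ctx.e (f x) j = Ctx.e x (σ j)

theorem Def.coord {P : Δ → Prop} (hP : Def L P) {f : Γ → Δ} (hf : IsCoord f) :
    Def L (fun x => P (f x)) := by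
  obtain ⟨σ, h⟩ := hf
  have := hP.out.preimage_comp σ
  refine ⟨?_⟩
  unfold IsDef
  convert this using 1
  ext v
  simp only [mem_ofPred_eq, mem_preimage]
  have : f (Ctx.e.symm v) = Ctx.e.symm (v ∘ σ) := by
    apply Ctx.e.injective
    ext j; rw [h]; simp
  rw [this]

theorem isCoord_id : IsCoord (fun x : Γ => x) := ⟨id, fun _ _ => rfl⟩
theorem isCoord_fst : IsCoord (fun x : Γ × Δ => x.1) := ⟨Sum.inl, fun _ _ => rfl⟩
theorem isCoord_snd : IsCoord (fun x : Γ × Δ => x.2) := ⟨Sum.inr, fun _ _ => rfl⟩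
theorem isCoord_eval {ι : Type} [Finite ι] (i : ι) : IsCoord (fun x : ι → ℝ => x i) :=
  ⟨fun _ => i, fun _ _ => rfl⟩
theorem IsCoord.comp {f : Δ → Ε} {g : Γ → Δ} (hf : IsCoord f) (hg : IsCoord g) :
    IsCoord (fun x => f (g x)) := by
  obtain ⟨σ, h⟩ := hf; obtain ⟨τ, k⟩ := hg
  exact ⟨τ ∘ σ, fun x j => by rw [h, k]; rfl⟩
theorem IsCoord.prod {f : Γ → Δ} {g : Γ → Ε} (hf : IsCoord f) (hg : IsCoord g) :
    IsCoord (fun x => (f x, g x)) := by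
  obtain ⟨σ, h⟩ := hf; obtain ⟨τ, k⟩ := hg
  refine ⟨Sum.elim σ τ, fun x j => ?_⟩
  rcases j with j | j
  · exact h x j
  · exact k x j
theorem IsCoord.fst {f : Γ → Δ × Ε} (hf : IsCoord f) : IsCoord (fun x => (f x).1) :=
  isCoord_fst.comp hf
theorem IsCoord.snd {f : Γ → Δ × Ε} (hf : IsCoord f) : IsCoord (fun x => (f x).2) :=
  isCoord_snd.comp hf

instance Def.exists {P : Γ → Δ → Prop} [h : Def L (fun q : Γ × Δ => P q.1 q.2)] :
    Def L (fun x => ∃ y, P x y) := by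
  have : Finite (Ctx.ι Γ) := Ctx.fin
  have : Finite (Ctx.ι (Γ × Δ)) := Ctx.fin
  have h2 := h.out.image_comp (α := Ctx.ι Γ) Sum.inl
  refine ⟨?_⟩
  unfold IsDef
  convert h2 using 1
  ext v
  simp only [mem_ofPred_eq, mem_image]
  constructor
  · rintro ⟨y, hy⟩
    refine ⟨Ctx.e (Ctx.e.symm v, y), by simpa using hy, ?_⟩
    ext i
    change Ctx.e (Ctx.e.symm v) i = _
    simp
  · rintro ⟨w, hw, rfl⟩
    exact ⟨_, hw⟩

instance Def.forall {P : Γ → Δ → Prop} [h : Def L (fun q : Γ × Δ => P q.1 q.2)] :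
    Def L (fun x => ∀ y, P x y) :=
  def_congr (P := fun x => ¬ ∃ y, ¬ P x y) inferInstance (fun x => by simp)

instance Def.forallFin {κ : Type*} [Finite κ] {P : Γ → κ → Prop} [h : ∀ i, Def L (fun q : Γ => P q i)] :
    Def L (fun x => ∀ y, P x y) := by
  refine ⟨?_⟩
  have := definable_iInter_of_finite (fun i => (h i).out)
  unfold IsDef
  convert this using 1
  ext; simp

instance Def.existsFin {κ : Type*} [Finite κ] {P : Γ → κ → Prop} [h : ∀ i, Def L (fun q : Γ => P q i)] :
    Def L (fun x => ∃ y, P x y) := 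
  def_congr (P := fun x => ¬ ∀ y, ¬ P x y) inferInstance (fun x => by simp)

theorem isDef_eq {α : Type} (a b : α) : IsDef L {v : α → ℝ | v a = v b} := by
  have := (Set.Definable.diagonal (L := L) (M := ℝ) univ).preimage_comp ![a, b]
  unfold IsDef
  convert this using 1
  ext v; simp

theorem def_eq : Def L (fun q : Γ × Γ => q.1 = q.2) := by
  have : Finite (Ctx.ι Γ) := Ctx.fin
  refine ⟨?_⟩
  have := definable_iInter_of_finite
    (fun i : Ctx.ι Γ => isDef_eq (L := L) (α := Ctx.ι (Γ × Γ)) (Sum.inl i) (Sum.inr i))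
  unfold IsDef
  convert this using 1
  ext v
  simp only [mem_ofPred_eq, mem_iInter]
  rw [← Ctx.e.injective.eq_iff, funext_iff]
  have h1 : ∀ i, Ctx.e ((Ctx.e.symm v : Γ × Γ).1) i = v (Sum.inl i) := by
    intro i
    change Ctx.e (Ctx.e.symm v : Γ × Γ) (Sum.inl i) = _
    simp
  have h2 : ∀ i, Ctx.e ((Ctx.e.symm v : Γ × Γ).2) i = v (Sum.inr i) := by
    intro i
    change Ctx.e (Ctx.e.symm v : Γ × Γ) (Sum.inr i) = _
    simp
  simp [h1, h2]

theorem defF_of_coord {f : Γ → Δ} (hf : IsCoord f) : DefF L f :=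
  ⟨(def_eq (L := L) (Γ := Δ)).coord (f := fun q : Γ × Δ => (f q.1, q.2))
    ((hf.comp isCoord_fst).prod isCoord_snd)⟩

theorem Def.comp {P : Δ → Prop} (hP : Def L P) {f : Γ → Δ} (hf : DefF L f) :
    Def L (fun x => P (f x)) := by
  have := hf.out
  have : Def L (fun q : Γ × Δ => P q.2) := hP.coord isCoord_snd
  exact def_congr (P := fun x => ∃ y, f x = y ∧ P y) inferInstance (fun x => by simp)

theorem DefF.comp {g : Δ → Ε} (hg : DefF L g) {f : Γ → Δ} (hf : DefF L f) :
    DefF L (fun x => g (f x)) := by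
  have h1 : Def L (fun q : (Γ × Ε) × Δ => f q.1.1 = q.2) :=
    hf.out.coord (f := fun q : (Γ × Ε) × Δ => (q.1.1, q.2)) (isCoord_fst.fst.prod isCoord_snd)
  have h2 : Def L (fun q : (Γ × Ε) × Δ => g q.2 = q.1.2) :=
    hg.out.coord (f := fun q : (Γ × Ε) × Δ => (q.2, q.1.2)) (isCoord_snd.prod isCoord_fst.snd)
  exact ⟨def_congr (P := fun x : Γ × Ε => ∃ y, f x.1 = y ∧ g y = x.2) inferInstance
    (fun x => by simp)⟩

instance DefF.id : DefF L (fun x : Γ => x) := defF_of_coord isCoord_id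
instance DefF.fst {f : Γ → Δ × Ε} [h : DefF L f] : DefF L (fun x => (f x).1) :=
  (defF_of_coord isCoord_fst).comp h
instance DefF.snd {f : Γ → Δ × Ε} [h : DefF L f] : DefF L (fun x => (f x).2) :=
  (defF_of_coord isCoord_snd).comp h
instance DefF.eval {ι : Type} [Finite ι] {f : Γ → ι → ℝ} [h : DefF L f] {i : ι} :
    DefF L (fun x => f x i) :=
  (defF_of_coord (isCoord_eval i)).comp h

instance DefF.prod {f : Γ → Δ} {g : Γ → Ε} [hf : DefF L f] [hg : DefF L g] :
    DefF L (fun x => (f x, g x)) := by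
  have h1 : Def L (fun q : Γ × (Δ × Ε) => f q.1 = q.2.1) :=
    hf.out.coord (f := fun q : Γ × (Δ × Ε) => (q.1, q.2.1)) (isCoord_fst.prod isCoord_snd.fst)
  have h2 : Def L (fun q : Γ × (Δ × Ε) => g q.1 = q.2.2) :=
    hg.out.coord (f := fun q : Γ × (Δ × Ε) => (q.1, q.2.2)) (isCoord_fst.prod isCoord_snd.snd)
  exact ⟨def_congr (P := fun q : Γ × (Δ × Ε) => f q.1 = q.2.1 ∧ g q.1 = q.2.2) inferInstance
    (fun x => by simp [Prod.ext_iff])⟩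

instance DefF.pi {ι : Type} [Finite ι] {f : Γ → ι → ℝ} [h : ∀ i, DefF L (fun x => f x i)] :
    DefF L (fun x => (fun i => f x i)) := by
  have h1 : ∀ i, Def L (fun q : Γ × (ι → ℝ) => f q.1 i = q.2 i) := fun i =>
    (h i).out.coord (f := fun q : Γ × (ι → ℝ) => (q.1, q.2 i))
      (isCoord_fst.prod ((isCoord_eval i).comp isCoord_snd))
  exact ⟨def_congr (P := fun q : Γ × (ι → ℝ) => ∀ i, f q.1 i = q.2 i) inferInstance
    (fun x => by simp [funext_iff])⟩

instance Def.eq {f g : Γ → Δ} [hf : DefF L f] [hg : DefF L g] : Def L (fun x => f x = g x) :=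
  def_eq.comp (f := fun x => (f x, g x)) inferInstance

instance DefF.const {c : Δ} : DefF L (fun _ : Γ => c) := by
  have : Finite (Ctx.ι Δ) := Ctx.fin
  refine ⟨⟨?_⟩⟩
  have := definable_iInter_of_finite (fun i : Ctx.ι Δ =>
    ((Set.Definable.singleton (L := L) (M := ℝ) (Ctx.e c i)).mono (subset_univ _)).preimage_comp
      (fun _ : Fin 1 => (Sum.inr i : Ctx.ι (Γ × Δ))))
  unfold IsDef
  refine (congrArg (fun s => Set.Definable univ L s) ?_).mp this
  ext v
  have h2 : ∀ i, Ctx.e ((Ctx.e.symm v : Γ × Δ).2) i = v (Sum.inr i) := by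
    intro i
    change Ctx.e (Ctx.e.symm v : Γ × Δ) (Sum.inr i) = _
    simp
  rw [mem_iInter]
  change (∀ i, v (Sum.inr i) = Ctx.e c i) ↔ c = (Ctx.e.symm v : Γ × Δ).2
  rw [← (Ctx.e (Γ := Δ)).injective.eq_iff, funext_iff]
  simp only [h2]
  exact ⟨fun h i => (h i).symm, fun h i => (h i).symm⟩

theorem DefF.ofGraph {f : Γ → Δ} (h : Def L (fun q : Γ × Δ => f q.1 = q.2)) : DefF L f := ⟨h⟩

variable [hOF : OF L]

instance Def.lt {f g : Γ → ℝ} [hf : DefF L f] [hg : DefF L g] : Def L (fun x => f x < g x) := by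
  have : Def L (fun q : ℝ × ℝ => q.1 < q.2) := by
    refine ⟨?_⟩
    exact hOF.out.1.preimage_comp (![Sum.inl (), Sum.inr ()] : Fin 2 → Ctx.ι (ℝ × ℝ))
  exact this.comp (f := fun x => (f x, g x)) inferInstance
instance Def.le {f g : Γ → ℝ} [hf : DefF L f] [hg : DefF L g] : Def L (fun x => f x ≤ g x) :=
  def_congr (P := fun x => ¬ (g x < f x)) inferInstance (fun x => by simp)
instance Def.gt {f g : Γ → ℝ} [hf : DefF L f] [hg : DefF L g] : Def L (fun x => f x > g x) :=
  Def.lt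
instance Def.ge {f g : Γ → ℝ} [hf : DefF L f] [hg : DefF L g] : Def L (fun x => f x ≥ g x) :=
  Def.le
instance Def.ne {f g : Γ → Δ} [hf : DefF L f] [hg : DefF L g] : Def L (fun x => f x ≠ g x) :=
  Def.not

instance DefF.add {f g : Γ → ℝ} [hf : DefF L f] [hg : DefF L g] : DefF L (fun x => f x + g x) := by
  have : DefF L (fun q : ℝ × ℝ => q.1 + q.2) := by
    refine ⟨⟨?_⟩⟩
    have := hOF.out.2.1.preimage_comp
      (![Sum.inl (Sum.inl ()), Sum.inl (Sum.inr ()), Sum.inr ()] : Fin 3 → Ctx.ι ((ℝ × ℝ) × ℝ))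
    unfold IsDef
    convert this using 1
    ext v
    exact eq_comm
  exact this.comp (f := fun x => (f x, g x)) inferInstance
instance DefF.mul {f g : Γ → ℝ} [hf : DefF L f] [hg : DefF L g] : DefF L (fun x => f x * g x) := by
  have : DefF L (fun q : ℝ × ℝ => q.1 * q.2) := by
    refine ⟨⟨?_⟩⟩
    have := hOF.out.2.2.preimage_comp
      (![Sum.inl (Sum.inl ()), Sum.inl (Sum.inr ()), Sum.inr ()] : Fin 3 → Ctx.ι ((ℝ × ℝ) × ℝ))
    unfold IsDef
    convert this using 1
    ext v
    exact eq_comm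
  exact this.comp (f := fun x => (f x, g x)) inferInstance

instance DefF.neg {f : Γ → ℝ} [hf : DefF L f] : DefF L (fun x => - f x) := by
  have : DefF L (fun x => (-1 : ℝ) * f x) := inferInstance
  simpa using this
instance DefF.sub {f g : Γ → ℝ} [hf : DefF L f] [hg : DefF L g] : DefF L (fun x => f x - g x) := by
  have : DefF L (fun x => f x + - g x) := inferInstance
  simpa [sub_eq_add_neg] using this
instance DefF.pow {f : Γ → ℝ} [hf : DefF L f] {k : ℕ} : DefF L (fun x => f x ^ k) := by
  induction k with
  | zero => simp only [pow_zero]; infer_instance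
  | succ k ih => simp only [pow_succ]; infer_instance
instance DefF.inv {f : Γ → ℝ} [hf : DefF L f] : DefF L (fun x => (f x)⁻¹) := by
  have : DefF L (fun x : ℝ => x⁻¹) := by
    refine ⟨def_congr (P := fun q : ℝ × ℝ => (q.1 = 0 ∧ q.2 = 0) ∨ q.1 * q.2 = 1) inferInstance ?_⟩
    rintro ⟨x, y⟩
    by_cases hx : x = 0
    · simp [hx, eq_comm]
    · simp [hx]
      constructor
      · intro h; exact inv_eq_of_mul_eq_one_right h
      · intro h; rw [← h]; exact mul_inv_cancel₀ hx
  exact this.comp hf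
instance DefF.div {f g : Γ → ℝ} [hf : DefF L f] [hg : DefF L g] : DefF L (fun x => f x / g x) := by
  simp only [div_eq_mul_inv]; infer_instance
instance DefF.ite {P : Γ → Prop} {d : ∀ x, Decidable (P x)} {f g : Γ → Δ} [hP : Def L P]
    [hf : DefF L f] [hg : DefF L g] :
    DefF L (fun x => @ite _ (P x) (d x) (f x) (g x)) := by
  have hP' : Def L (fun q : Γ × Δ => P q.1) := hP.coord isCoord_fst
  have := hf.out
  have := hg.out
  refine ⟨def_congr (P := fun q : Γ × Δ => (P q.1 ∧ f q.1 = q.2) ∨ (¬ P q.1 ∧ g q.1 = q.2))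
    inferInstance ?_⟩
  intro q
  by_cases h : P q.1 <;> simp [h]
instance DefF.max {f g : Γ → ℝ} [hf : DefF L f] [hg : DefF L g] :
    DefF L (fun x => Max.max (f x) (g x)) := by
  simp only [max_def]; infer_instance
instance DefF.min {f g : Γ → ℝ} [hf : DefF L f] [hg : DefF L g] :
    DefF L (fun x => Min.min (f x) (g x)) := by
  simp only [min_def]; infer_instance
instance DefF.abs {f : Γ → ℝ} [hf : DefF L f] : DefF L (fun x => |f x|) := by
  have : DefF L (fun x => Max.max (f x) (- f x)) := inferInstance
  exact this
instance DefF.sum {κ : Type*} [Fintype κ] {f : Γ → κ → ℝ} [h : ∀ i, DefF L (fun x => f x i)] :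
    DefF L (fun x => ∑ i, f x i) := by
  classical
  have : ∀ s : Finset κ, DefF L (fun x => ∑ i ∈ s, f x i) := by
    intro s
    induction s using Finset.induction_on with
    | empty => simp only [Finset.sum_empty]; infer_instance
    | insert a s ha ih => simp only [Finset.sum_insert ha]; infer_instance
  exact this _

/-- a definable function on a definable set extends by zero -/
theorem sSup_graph (A : Set ℝ) (y : ℝ) : sSup A = y ↔
    (((∃ x, x ∈ A) ∧ (∃ b, ∀ x, x ∈ A → x ≤ b)) ∧ (∀ x, x ∈ A → x ≤ y) ∧
      ∀ b, (∀ x, x ∈ A → x ≤ b) → y ≤ b) ∨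
    (¬ ((∃ x, x ∈ A) ∧ (∃ b, ∀ x, x ∈ A → x ≤ b)) ∧ y = 0) := by
  by_cases h : (∃ x, x ∈ A) ∧ (∃ b, ∀ x, x ∈ A → x ≤ b)
  · have h' := Real.isLUB_sSup h.1 h.2
    simp only [h, not_true, false_and, or_false, true_and]
    constructor
    · rintro rfl
      exact ⟨h'.1, fun b hb => h'.2 hb⟩
    · rintro ⟨h1, h2⟩
      exact h'.unique ⟨h1, fun b hb => h2 b hb⟩
  · simp only [h, not_false_iff, false_and, false_or, true_and]
    have : sSup A = 0 := by
      rcases A.eq_empty_or_nonempty with rfl | hne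
      · simp
      · exact Real.sSup_of_not_bddAbove (fun hb => h ⟨hne, hb⟩)
    rw [this, eq_comm]

end Toolkit


section Toolkit
variable {L}
variable {Γ Δ Ε : Type} [Ctx Γ] [Ctx Δ] [Ctx Ε]
variable [hOF : OF L]
theorem DefF.sSup {A : Γ → ℝ → Prop} (h : Def L (fun q : Γ × ℝ => A q.1 q.2)) :
    DefF L (fun x => sSup {y | A x y}) := by
  have h' : ∀ {Δ : Type} [Ctx Δ] (f : Δ → Γ) (g : Δ → ℝ) [DefF L f] [DefF L g],
    Def L (fun x => A (f x) (g x)) := fun f g _ _ => h.comp (f := fun x => (f x, g x)) inferInstance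
  refine ⟨?_⟩
  simp only [sSup_graph, mem_ofPred_eq]
  infer_instance
theorem DefF.sInf {A : Γ → ℝ → Prop} (h : Def L (fun q : Γ × ℝ => A q.1 q.2)) :
    DefF L (fun x => sInf {y | A x y}) := by
  have h' : Def L (fun q : Γ × ℝ => A q.1 (- q.2)) :=
    h.comp (f := fun q : Γ × ℝ => (q.1, -q.2)) inferInstance
  have := DefF.sSup (A := fun x y => A x (-y)) h'
  have h2 : DefF L (fun x => - SupSet.sSup {y | A x (-y)}) := inferInstance
  simpa [Real.sInf_def] using h2

end Toolkit


section Toolkit2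
variable {L}
variable {Γ Δ Ε : Type} [Ctx Γ] [Ctx Δ] [Ctx Ε]

theorem DefF.use {t : Γ → Δ} (h : DefF L t) :
    ∀ (Δ' : Type) [Ctx Δ'] (f : Δ' → Γ) [DefF L f], DefF L (fun x => t (f x)) :=
  fun _ _ _ hf => h.comp hf
theorem Def.use {A : Γ → Prop} (h : Def L A) :
    ∀ (Δ' : Type) [Ctx Δ'] (f : Δ' → Γ) [DefF L f], Def L (fun x => A (f x)) :=
  fun _ _ _ hf => h.comp hf
theorem Def.useS {A : Set Γ} (h : Def L (fun x => x ∈ A)) :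
    ∀ (Δ' : Type) [Ctx Δ'] (f : Δ' → Γ) [DefF L f], Def L (fun x => f x ∈ A) :=
  fun _ _ _ hf => h.comp hf
theorem Def.use2 {A : Γ → Δ → Prop} (h : Def L (fun q : Γ × Δ => A q.1 q.2)) :
    ∀ (Δ' : Type) [Ctx Δ'] (f : Δ' → Γ) (g : Δ' → Δ) [DefF L f] [DefF L g],
      Def L (fun x => A (f x) (g x)) :=
  fun _ _ f g _ _ => h.comp (f := fun x => (f x, g x)) inferInstance
theorem DefF.use2 {t : Γ → Δ → Ε} (h : DefF L (fun q : Γ × Δ => t q.1 q.2)) :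
    ∀ (Δ' : Type) [Ctx Δ'] (f : Δ' → Γ) (g : Δ' → Δ) [DefF L f] [DefF L g],
      DefF L (fun x => t (f x) (g x)) :=
  fun _ _ f g _ _ => h.comp (f := fun x => (f x, g x)) inferInstance

instance DefF.fst' {f : Γ → Δ × Ε} [h : DefF L f] : DefF L (fun x => (f x).1) := DefF.fst
instance DefF.snd' {f : Γ → Δ × Ε} [h : DefF L f] : DefF L (fun x => (f x).2) := DefF.snd
instance DefF.fst0 : DefF L (fun x : Γ × Δ => x.1) := DefF.fst
instance DefF.snd0 : DefF L (fun x : Γ × Δ => x.2) := DefF.snd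
instance DefF.eval' {ι : Type} [Finite ι] {i : ι} :
    DefF L (fun x : ι → ℝ => x i) := DefF.eval
instance DefF.id' : DefF L (fun x : Γ => x) := DefF.id
instance DefF.const' {c : Δ} : DefF L (fun _ : Γ => c) := DefF.const
instance Def.eqL {a : Γ} : Def L (Eq a) := Def.eq (f := fun _ => a) (g := fun x => x)
instance Def.neL {a : Γ} : Def L (Ne a) := Def.not (P := fun x => a = x)

section
variable [OF L]
instance Def.ltL {a : ℝ} : Def L (LT.lt a) := Def.lt (f := fun _ => a) (g := fun x => x)
instance Def.leL {a : ℝ} : Def L (LE.le a) := Def.le (f := fun _ => a) (g := fun x => x)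
instance DefF.addL {a : ℝ} : DefF L (HAdd.hAdd a) := DefF.add (f := fun _ => a) (g := fun x => x)
instance DefF.mulL {a : ℝ} : DefF L (HMul.hMul a) := DefF.mul (f := fun _ => a) (g := fun x => x)
instance DefF.subL {a : ℝ} : DefF L (HSub.hSub a) := DefF.sub (f := fun _ => a) (g := fun x => x)
instance DefF.divL {a : ℝ} : DefF L (HDiv.hDiv a) := DefF.div (f := fun _ => a) (g := fun x => x)
end

theorem isDef_iff {ι : Type} [Finite ι] {M : Set (ι → ℝ)} : IsDef L M ↔ Def L (fun x => x ∈ M) :=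
  ⟨fun h => ⟨h⟩, fun h => h.out⟩

/-- reindexing context -/
theorem Def.toIsDef {P : Γ → Prop} (h : Def L P) {κ : Type} (σ : Ctx.ι Γ → κ) :
    IsDef L {z : κ → ℝ | P (Ctx.e.symm (z ∘ σ))} := h.out.preimage_comp σ

theorem isDefFunOn_iff {ι : Type} [Finite ι] {M : Set (ι → ℝ)} {f : (ι → ℝ) → ℝ} :
    IsDefFunOn L M f ↔ Def L (fun q : (ι → ℝ) × ℝ => q.1 ∈ M ∧ q.2 = f q.1) :=
  ⟨fun h => ⟨h⟩, fun h => h.out⟩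

theorem isDefMapOn_iff {ι κ : Type} [Finite ι] [Finite κ] {M : Set (ι → ℝ)}
    {f : (ι → ℝ) → (κ → ℝ)} :
    IsDefMapOn L M f ↔ Def L (fun q : (ι → ℝ) × (κ → ℝ) => q.1 ∈ M ∧ q.2 = f q.1) :=
  ⟨fun h => ⟨h⟩, fun h => h.out⟩

theorem defF_extend {M : Set Γ} {f : Γ → Δ} (c : Δ)
    (hM : Def L (fun x => x ∈ M)) (h : Def L (fun q : Γ × Δ => q.1 ∈ M ∧ q.2 = f q.1)) :
    DefF L (fun x => if x ∈ M then f x else c) := by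
  have hM' := hM.useS
  refine ⟨def_congr (P := fun q : Γ × Δ => (q.1 ∈ M ∧ q.2 = f q.1) ∨ (¬ q.1 ∈ M ∧ q.2 = c))
    inferInstance ?_⟩
  rintro ⟨x, y⟩
  by_cases hx : x ∈ M <;> simp [hx, eq_comm]

variable [hOF : OF L]

theorem defF_of_lt {f : Γ → ℝ} (h : Def L (fun q : Γ × ℝ => f q.1 < q.2)) : DefF L f := by
  have h' := h.comp (Γ := (Γ × ℝ) × ℝ) (f := fun q => (q.1.1, q.2)) inferInstance
  refine ⟨def_congr (P := fun q : Γ × ℝ => ¬ f q.1 < q.2 ∧ ∀ z, q.2 < z → f q.1 < z)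
    inferInstance ?_⟩
  rintro ⟨x, y⟩
  simp only [not_lt]
  constructor
  · rintro ⟨h1, h2⟩
    exact le_antisymm (le_of_forall_gt h2) h1
  · rintro rfl
    exact ⟨le_refl _, fun z hz => hz⟩

variable (L) in
/-- definable metric -/
class DDist (Γ : Type) [Ctx Γ] [PseudoMetricSpace Γ] : Prop where
  out : DefF L (fun q : Γ × Γ => dist q.1 q.2)

instance : DDist L ℝ := ⟨by simp only [Real.dist_eq]; infer_instance⟩
instance {ι : Type} [Fintype ι] : DDist L (ι → ℝ) := ⟨by
  apply defF_of_lt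
  refine def_congr (P := fun q : ((ι → ℝ) × (ι → ℝ)) × ℝ => 0 < q.2 ∧
    ∀ i, |q.1.1 i - q.1.2 i| < q.2) inferInstance ?_
  rintro ⟨⟨x, y⟩, r⟩
  simp only
  constructor
  · rintro ⟨h1, h2⟩
    exact (dist_pi_lt_iff h1).2 (by simpa [Real.dist_eq] using h2)
  · intro h
    have h1 := dist_nonneg.trans_lt h
    exact ⟨h1, by simpa [Real.dist_eq] using (dist_pi_lt_iff h1).1 h⟩⟩
instance DefF.dist {Δ : Type} [Ctx Δ] [PseudoMetricSpace Δ] [h : DDist L Δ] {f g : Γ → Δ}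
    [DefF L f] [DefF L g] : DefF L (fun x => Dist.dist (f x) (g x)) :=
  h.out.comp (f := fun x => (f x, g x)) inferInstance
instance {Γ Δ : Type} [Ctx Γ] [Ctx Δ] [PseudoMetricSpace Γ] [PseudoMetricSpace Δ]
    [DDist L Γ] [DDist L Δ] : DDist L (Γ × Δ) := ⟨by simp only [Prod.dist_eq]; infer_instance⟩

theorem mem_interior_fo {Γ : Type} [PseudoMetricSpace Γ] (A : Set Γ) (x : Γ) :
    x ∈ interior A ↔ ∃ δ : ℝ, 0 < δ ∧ ∀ y, Dist.dist y x < δ → y ∈ A := by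
  rw [mem_interior_iff_mem_nhds, Metric.mem_nhds_iff]; rfl
theorem mem_closure_fo {Γ : Type} [PseudoMetricSpace Γ] (A : Set Γ) (x : Γ) :
    x ∈ closure A ↔ ∀ δ : ℝ, 0 < δ → ∃ y, y ∈ A ∧ Dist.dist x y < δ := by
  rw [Metric.mem_closure_iff]

section
variable {Γ : Type} [PseudoMetricSpace Γ] [Ctx Γ] [DDist L Γ]
theorem Def.interior {A : Set Γ} (h : Def L (fun x => x ∈ A)) :
    Def L (fun x => x ∈ interior A) := by
  have := h.useS
  simp only [mem_interior_fo]; infer_instance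
theorem Def.closure {A : Set Γ} (h : Def L (fun x => x ∈ A)) :
    Def L (fun x => x ∈ closure A) := by
  have := h.useS
  simp only [mem_closure_fo]; infer_instance
theorem Def.ball (x : Γ) (r : ℝ) : Def L (fun y => y ∈ Metric.ball x r) := by
  simp only [Metric.mem_ball]; infer_instance
theorem def_Ioo (a b : ℝ) : Def L (fun y => y ∈ Ioo a b) := by
  simp only [mem_Ioo]; infer_instance
theorem Def.interiorCompl {A : Set Γ} (h : Def L (fun x => x ∈ A)) :
    Def L (fun x => x ∈ A \ _root_.interior A) := by
  have := h.interior
  simp only [Set.mem_sdiff]; infer_instance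
end

theorem hasDerivAt_fo (f : ℝ → ℝ) (f' x : ℝ) : HasDerivAt f f' x ↔
    ∀ η : ℝ, 0 < η → ∃ δ : ℝ, 0 < δ ∧ ∀ y, |y - x| < δ → |f y - f x - (y - x) * f'| ≤ η * |y - x| := by
  rw [hasDerivAt_iff_isLittleO, Asymptotics.isLittleO_iff]
  constructor
  · intro h η hη
    obtain ⟨δ, hδ, h⟩ := Metric.eventually_nhds_iff.1 (h hη)
    exact ⟨δ, hδ, fun y hy => by simpa using h (y := y) (by simpa [Real.dist_eq] using hy)⟩
  · intro h η hη
    obtain ⟨δ, hδ, h⟩ := h η hη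
    exact Metric.eventually_nhds_iff.2 ⟨δ, hδ, fun y hy => by
      simpa using h y (by simpa [Real.dist_eq] using hy)⟩

theorem Def.hasDerivAt {t : Γ → ℝ → ℝ} (h : DefF L (fun q : Γ × ℝ => t q.1 q.2)) :
    Def L (fun q : (Γ × ℝ) × ℝ => HasDerivAt (t q.1.1) q.2 q.1.2) := by
  have := h.use2
  simp only [hasDerivAt_fo]; infer_instance

theorem deriv_graph (f : ℝ → ℝ) (x y : ℝ) : deriv f x = y ↔
    HasDerivAt f y x ∨ ((∀ z, ¬ HasDerivAt f z x) ∧ y = 0) := by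
  by_cases h : DifferentiableAt ℝ f x
  · constructor
    · rintro rfl; exact Or.inl h.hasDerivAt
    · rintro (h1 | h1)
      · exact h1.deriv
      · exact absurd h.hasDerivAt (h1.1 _)
  · constructor
    · rintro rfl
      refine Or.inr ⟨fun z hz => h hz.differentiableAt, deriv_zero_of_not_differentiableAt h⟩
    · rintro (h1 | h1)
      · exact h1.deriv
      · rw [h1.2]; exact deriv_zero_of_not_differentiableAt h

theorem DefF.deriv2 {t : Γ → ℝ → ℝ} (h : DefF L (fun q : Γ × ℝ => t q.1 q.2)) :
    DefF L (fun q : Γ × ℝ => deriv (t q.1) q.2) := by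
  have h1 := Def.hasDerivAt h
  have : Def L (fun q : ((Γ × ℝ) × ℝ) × ℝ => HasDerivAt (t q.1.1.1) q.2 q.1.1.2) :=
    h1.comp (f := fun q : ((Γ × ℝ) × ℝ) × ℝ => (q.1.1, q.2)) inferInstance
  refine ⟨?_⟩
  simp only [deriv_graph]
  infer_instance

theorem DefF.deriv {t : ℝ → ℝ} (h : DefF L t) : DefF L (fun x => deriv t x) := by
  have h' := h.use
  have := DefF.deriv2 (L := L) (Γ := ℝ) (t := fun _ => t) inferInstance
  exact this.comp (f := fun x : ℝ => (x, x)) inferInstance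

theorem DefF.iteratedDeriv {t : ℝ → ℝ} (h : DefF L t) (k : ℕ) :
    DefF L (fun x => iteratedDeriv k t x) := by
  induction k with
  | zero => simpa using h
  | succ k ih => simp only [iteratedDeriv_succ]; exact ih.deriv

variable {ι : Type} [Fintype ι]
theorem DefF.lineDeriv {t : (ι → ℝ) → ℝ} (h : DefF L t) (v : ι → ℝ) :
    DefF L (fun x => lineDeriv ℝ t x v) := by
  have h' := h.use
  have : DefF L (fun q : (ι → ℝ) × ℝ => t (q.1 + q.2 • v)) := by
    have : DefF L (fun q : (ι → ℝ) × ℝ => (fun i => q.1 i + q.2 * v i)) := inferInstance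
    exact h.comp this
  have := DefF.deriv2 (t := fun (x : ι → ℝ) s => t (x + s • v)) this
  exact this.comp (f := fun x : ι → ℝ => (x, (0:ℝ))) inferInstance
theorem Def.lineDifferentiableAt {t : (ι → ℝ) → ℝ} (h : DefF L t) (v : ι → ℝ) :
    Def L (fun x => LineDifferentiableAt ℝ t x v) := by
  have : DefF L (fun q : (ι → ℝ) × ℝ => t (q.1 + q.2 • v)) := by
    have : DefF L (fun q : (ι → ℝ) × ℝ => (fun i => q.1 i + q.2 * v i)) := inferInstance
    exact h.comp this
  have := Def.hasDerivAt (t := fun (x : ι → ℝ) s => t (x + s • v)) this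
  have : Def L (fun q : (ι → ℝ) × ℝ => HasDerivAt (fun s : ℝ => t (q.1 + s • v)) q.2 0) :=
    this.comp (f := fun q : (ι → ℝ) × ℝ => ((q.1, (0:ℝ)), q.2)) inferInstance
  refine def_congr (P := fun x => ∃ z, HasDerivAt (fun s : ℝ => t (x + s • v)) z 0) inferInstance ?_
  intro x
  exact ⟨fun ⟨z, hz⟩ => hz.differentiableAt, fun hh => ⟨_, hh.hasDerivAt⟩⟩

end Toolkit2


section PartB
variable {L}

variable (L) in
/-- the d-minimality assumption as a class -/
class DM : Prop where
  out : DMinimal L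

instance OF.ofDM [h : DM L] : OF L := ⟨h.out.1⟩

theorem dmin_fiber [h : DM L] {Γ : Type} [Ctx Γ] {A : Γ → ℝ → Prop}
    (hA : Def L (fun q : Γ × ℝ => A q.1 q.2)) :
    ∃ N : ℕ, ∀ x, ∃ (U : Set ℝ) (D : Fin N → Set ℝ),
        IsOpen U ∧ (∀ i, IsDiscreteSet (D i)) ∧ {t : ℝ | A x t} = U ∪ ⋃ i, D i := by
  have : Finite (Ctx.ι Γ) := Ctx.fin
  obtain ⟨k, ⟨e⟩⟩ := Finite.exists_equiv_fin (Ctx.ι Γ)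
  have h1 := hA.toIsDef (κ := Fin k ⊕ Unit) (Sum.map e id)
  obtain ⟨N, hN⟩ := h.out.2 k _ h1
  refine ⟨N, fun x => ?_⟩
  obtain ⟨U, D, hU, hD, h2⟩ := hN (Ctx.e x ∘ e.symm)
  refine ⟨U, D, hU, hD, ?_⟩
  rw [← h2]
  ext t
  have : (Ctx.e.symm (Sum.elim (Ctx.e x ∘ e.symm) (fun _ => t) ∘ Sum.map e id) : Γ × ℝ) = (x, t) := by
    apply Ctx.e.injective
    rw [Equiv.apply_symm_apply]
    ext j
    rcases j with j | j
    · change Ctx.e x (e.symm (e j)) = Ctx.e x j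
      simp
    · rfl
  change A x t ↔ A (Ctx.e.symm (Sum.elim (Ctx.e x ∘ e.symm) (fun _ => t) ∘ Sum.map e id) : Γ × ℝ).1
    (Ctx.e.symm (Sum.elim (Ctx.e x ∘ e.symm) (fun _ => t) ∘ Sum.map e id) : Γ × ℝ).2
  rw [this]

theorem IsDiscreteSet.nowhereDense {D : Set ℝ} (h : IsDiscreteSet D) : IsNowhereDense D := by
  unfold IsNowhereDense
  by_contra hne
  obtain ⟨y, hy⟩ := nonempty_iff_ne_empty.2 hne
  obtain ⟨x, hx, hxD⟩ := mem_closure_iff.1 (interior_subset hy) _ isOpen_interior hy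
  obtain ⟨U, hU, hUD⟩ := h x hxD
  have hxU : x ∈ U := by
    have : x ∈ U ∩ D := by rw [hUD]; rfl
    exact this.1
  have : (𝓝[≠] x).NeBot := inferInstance
  have h1 : ∀ᶠ z in 𝓝[≠] x, z ∈ U ∩ interior (closure D) :=
    mem_nhdsWithin_of_mem_nhds ((hU.inter isOpen_interior).mem_nhds ⟨hxU, hx⟩)
  obtain ⟨z, ⟨hzU, hzI⟩, hzx⟩ := (h1.and self_mem_nhdsWithin).exists
  obtain ⟨w, ⟨⟨hwU, -⟩, hwx⟩, hwD⟩ := mem_closure_iff.1 (interior_subset hzI) ((U ∩ interior (closure D)) ∩ {x}ᶜ)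
    ((hU.inter isOpen_interior).inter isOpen_compl_singleton) ⟨⟨hzU, hzI⟩, hzx⟩
  have : w ∈ U ∩ D := ⟨hwU, hwD⟩
  rw [hUD] at this
  exact hwx this

theorem IsDiscreteSet.countable {D : Set ℝ} (h : IsDiscreteSet D) : D.Countable := by
  have : DiscreteTopology D := by
    rw [discreteTopology_subtype_iff']
    exact fun x hx => h x hx
  exact (HereditarilyLindelofSpace.isLindelof D).countable this

theorem nowhereDense_union {X : Type*} [TopologicalSpace X] {s t : Set X} (hs : IsNowhereDense s)
    (ht : IsNowhereDense t) : IsNowhereDense (s ∪ t) := by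
  unfold IsNowhereDense at *
  rw [closure_union, interior_union_isClosed_of_interior_empty isClosed_closure ht, hs]

theorem nowhereDense_iUnion {X : Type*} [TopologicalSpace X] {N : ℕ} {D : Fin N → Set X}
    (h : ∀ i, IsNowhereDense (D i)) : IsNowhereDense (⋃ i, D i) := by
  induction N with
  | zero => simp
  | succ N ih =>
    have : (⋃ i, D i) = (⋃ i : Fin N, D i.castSucc) ∪ D (Fin.last N) := by
      ext x; simp [Fin.exists_fin_succ']
    rw [this]
    exact nowhereDense_union (ih fun i => h _) (h _)

theorem dmin_dense [DM L] {A : Set ℝ} (hA : Def L (fun x => x ∈ A)) {I : Set ℝ} (hI : IsOpen I)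
    (hne : I.Nonempty) (hsub : I ⊆ closure A) : (interior A ∩ I).Nonempty := by
  have := hA.useS
  obtain ⟨N, hN⟩ := dmin_fiber (L := L) (Γ := ℝ) (A := fun _ t => t ∈ A) inferInstance
  obtain ⟨U, D, hU, hD, hE⟩ := hN 0
  have hE : A = U ∪ ⋃ i, D i := hE
  have hnd := nowhereDense_iUnion fun i => (hD i).nowhereDense
  have hUA : U ⊆ interior A := interior_maximal (by rw [hE]; exact subset_union_left) hU
  by_contra hcon
  have hdis : I ∩ closure U = ∅ := by
    rw [eq_empty_iff_forall_notMem]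
    rintro x ⟨hx, hxU⟩
    obtain ⟨z, hz, hzU⟩ := mem_closure_iff.1 hxU I hI hx
    exact hcon ⟨z, hUA hzU, hz⟩
  have : I ⊆ closure (⋃ i, D i) := by
    intro x hx
    have := hsub hx
    rw [hE, closure_union] at this
    rcases this with h | h
    · have : x ∈ I ∩ closure U := ⟨hx, h⟩
      rw [hdis] at this; exact this.elim
    · exact h
  have := interior_maximal this hI
  rw [hnd] at this
  exact hne.not_subset_empty this

theorem dmin_countable [DM L] {A : Set ℝ} (hA : Def L (fun x => x ∈ A))
    (hint : interior A = ∅) : A.Countable := by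
  have := hA.useS
  obtain ⟨N, hN⟩ := dmin_fiber (L := L) (Γ := ℝ) (A := fun _ t => t ∈ A) inferInstance
  obtain ⟨U, D, hU, hD, hE⟩ := hN 0
  have hE : A = U ∪ ⋃ i, D i := hE
  have hUA : U ⊆ interior A := interior_maximal (by rw [hE]; exact subset_union_left) hU
  rw [hint, subset_empty_iff] at hUA
  rw [hE, hUA, empty_union]
  exact countable_iUnion fun i => (hD i).countable

variable (L) in
/-- tameness -/
def Tame (Γ : Type) [Ctx Γ] [TopologicalSpace Γ] : Prop :=
  ∀ A : Set Γ, Def L (fun x => x ∈ A) → interior A = ∅ → IsNowhereDense A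

theorem Tame.gen [OF L] {Γ : Type} [Ctx Γ] [PseudoMetricSpace Γ] [DDist L Γ] (h : Tame L Γ)
    {A : Set Γ} (hA : Def L (fun x => x ∈ A)) :
    ∀ᶠ x in residual Γ, x ∈ A → x ∈ interior A := by
  have h1 : IsNowhereDense (A \ interior A) := by
    apply h _ hA.interiorCompl
    rw [eq_empty_iff_forall_notMem]
    intro x hx
    exact (interior_subset hx).2 (interior_mono sdiff_subset hx)
  filter_upwards [h1.isMeagre] with x hx hxA
  by_contra h2
  exact hx ⟨hxA, h2⟩

theorem Tame.of_homeo {Γ Δ : Type} [Ctx Γ] [TopologicalSpace Γ] [Ctx Δ] [TopologicalSpace Δ]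
    (h : Tame L Γ) (e : Γ ≃ₜ Δ) (he : DefF L (fun x => e x)) : Tame L Δ := by
  intro A hA hint
  have h1 := h (e ⁻¹' A) (hA.comp he) (by rw [← e.preimage_interior, hint, preimage_empty])
  unfold IsNowhereDense at *
  rw [← e.preimage_closure, ← e.preimage_interior] at h1
  have := congrArg (fun s => e '' s) h1
  simpa using this

theorem Tame.prod [DM L] {Γ : Type} [Ctx Γ] [PseudoMetricSpace Γ] [BaireSpace Γ]
    [DDist L Γ] (h : Tame L Γ) : Tame L (Γ × ℝ) := by
  intro A hA hint
  have hA' := Def.use2 (A := fun x y => (x, y) ∈ A) hA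
  unfold IsNowhereDense
  by_contra hne
  obtain ⟨⟨x0, s0⟩, hx0⟩ := nonempty_iff_ne_empty.2 hne
  obtain ⟨B, I, hB, hI, hxB, hsI, hBI⟩ := isOpen_prod_iff.1 isOpen_interior x0 s0 hx0
  have hBI : B ×ˢ I ⊆ closure A := hBI.trans interior_subset
  have hX : ∀ q : ℚ × ℚ, Def L (fun x => x ∈ {x : Γ | ∀ t : ℝ, q.1 < t ∧ t < q.2 → (x, t) ∉ A}) := by
    intro q
    simp only [mem_ofPred_eq]; infer_instance
  have hY : ∀ q : ℚ × ℚ, Def L (fun x => x ∈ {x : Γ | ∀ t : ℝ, q.1 < t ∧ t < q.2 → (x, t) ∈ A}) := by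
    intro q
    simp only [mem_ofPred_eq]; infer_instance
  have hg : ∀ᶠ x in residual Γ, (∀ q : ℚ × ℚ, x ∈ {x : Γ | ∀ t : ℝ, q.1 < t ∧ t < q.2 → (x, t) ∉ A} →
        x ∈ interior {x : Γ | ∀ t : ℝ, q.1 < t ∧ t < q.2 → (x, t) ∉ A}) ∧
      (∀ q : ℚ × ℚ, x ∈ {x : Γ | ∀ t : ℝ, q.1 < t ∧ t < q.2 → (x, t) ∈ A} →
        x ∈ interior {x : Γ | ∀ t : ℝ, q.1 < t ∧ t < q.2 → (x, t) ∈ A}) :=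
    (eventually_countable_forall.2 fun q => h.gen (hX q)).and
      (eventually_countable_forall.2 fun q => h.gen (hY q))
  obtain ⟨x, hxB, hx1, hx2⟩ := (dense_of_mem_residual hg).inter_open_nonempty B hB ⟨x0, hxB⟩
  have hfib : Def L (fun t => t ∈ {t | (x, t) ∈ A}) := by
    simp only [mem_ofPred_eq]; infer_instance
  have hdense : I ⊆ closure {t | (x, t) ∈ A} := by
    intro s hs
    rw [mem_closure_iff]
    intro V hV hsV
    by_contra hcon
    obtain ⟨ε, hε, hball⟩ := Metric.isOpen_iff.1 (hV.inter hI) s ⟨hsV, hs⟩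
    obtain ⟨q1, h1, h1'⟩ := exists_rat_btwn (show s - ε < s by linarith)
    obtain ⟨q2, h2, h2'⟩ := exists_rat_btwn (show s < s + ε by linarith)
    have hqV : ∀ t : ℝ, q1 < t ∧ t < q2 → t ∈ V ∩ I := fun t ht => hball (by
      rw [Metric.mem_ball, Real.dist_eq, abs_lt]; constructor <;> linarith)
    have hint := hx1 (q1, q2) (fun t ht htA => hcon ⟨t, (hqV t ht).1, htA⟩)
    have hopen : IsOpen ((interior {x : Γ | ∀ t : ℝ, q1 < t ∧ t < q2 → (x, t) ∉ A}) ×ˢ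
      Ioo (q1:ℝ) q2) := isOpen_interior.prod isOpen_Ioo
    obtain ⟨⟨y, t⟩, ⟨hy, ht⟩, hyA⟩ := mem_closure_iff.1 (hBI (show (x, s) ∈ B ×ˢ I from ⟨hxB, hs⟩)) _ hopen
      ⟨hint, h1', h2⟩
    exact (interior_subset hy) t ht hyA
  obtain ⟨s, hs, hsI⟩ := dmin_dense hfib hI ⟨s0, hsI⟩ hdense
  obtain ⟨ε, hε, hball⟩ := Metric.isOpen_iff.1 isOpen_interior s hs
  obtain ⟨q1, h1, h1'⟩ := exists_rat_btwn (show s - ε < s by linarith)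
  obtain ⟨q2, h2, h2'⟩ := exists_rat_btwn (show s < s + ε by linarith)
  have hi := hx2 (q1, q2) (fun t ht => by
      have h3 : t ∈ interior {t | (x, t) ∈ A} := hball (by
        rw [Metric.mem_ball, Real.dist_eq, abs_lt]
        obtain ⟨ht1, ht2⟩ := ht
        dsimp only at ht1 ht2
        constructor <;> linarith)
      exact interior_subset (s := {t | (x, t) ∈ A}) h3)
  have hopen : IsOpen ((interior {x : Γ | ∀ t : ℝ, q1 < t ∧ t < q2 → (x, t) ∈ A}) ×ˢ
      Ioo (q1:ℝ) q2) := isOpen_interior.prod isOpen_Ioo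
  have : (x, s) ∈ interior A := interior_maximal (fun ⟨y, t⟩ hyt => interior_subset hyt.1 t hyt.2) hopen
    ⟨hi, h1', h2⟩
  rw [hint] at this
  exact this

theorem tame_pi [DM L] (ι : Type) [h : Fintype ι] : Tame L (ι → ℝ) := by
  revert h
  refine Finite.induction_empty_option (P := fun ι : Type => ∀ [Fintype ι], Tame L (ι → ℝ)) ?_ ?_ ?_ ι
  · intro α β e hα _
    have : Fintype α := Fintype.ofEquiv β e.symm
    refine hα.of_homeo (Homeomorph.piCongrLeft (Y := fun _ => ℝ) e) ?_
    have : ∀ x : α → ℝ, Homeomorph.piCongrLeft (Y := fun _ => ℝ) e x = fun b => x (e.symm b) := by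
      intro x; ext b
      obtain ⟨a, rfl⟩ := e.surjective b
      simp
    simp only [this]
    exact DefF.pi (h := fun i => inferInstance)
  · intro _ A _ hint
    have : A = ∅ := by
      by_contra hne
      obtain ⟨y, hy⟩ := nonempty_iff_ne_empty.2 hne
      have : A = univ := by ext z; rw [Subsingleton.elim z y]; simp [hy]
      rw [this] at hint
      simp at hint
    rw [this]; simp
  · intro α _ hα inst
    refine (hα.prod).of_homeo
      { toFun := fun q o => Option.elim o q.2 q.1
        invFun := fun x => (fun a => x (some a), x none)
        left_inv := fun q => rfl
        right_inv := fun x => by ext o; cases o <;> rfl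
        continuous_toFun := by
          refine continuous_pi fun o => ?_
          cases o
          · exact continuous_snd
          · exact (continuous_apply _).comp continuous_fst
        continuous_invFun := by fun_prop } ?_
    have h1 : ∀ o : Option α, DefF L (fun q : (α → ℝ) × ℝ => Option.elim o q.2 q.1) := by
      intro o
      cases o
      · exact DefF.snd0
      · exact DefF.eval (f := fun q : (α → ℝ) × ℝ => q.1)
    exact DefF.pi (f := fun (q : (α → ℝ) × ℝ) o => Option.elim o q.2 q.1) (h := h1)
end PartB


section PartC
set_option linter.unusedSectionVars false
set_option linter.deprecated false
variable {L}
variable {ι : Type} [Fintype ι]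

theorem gen_interior [DM L] {A : Set (ι → ℝ)} (hA : Def L (fun x => x ∈ A))
    (h : ∀ᶠ x in residual (ι → ℝ), x ∈ A) : ∀ᶠ x in residual (ι → ℝ), x ∈ interior A := by
  filter_upwards [h, (tame_pi (L := L) ι).gen hA] with x h1 h2 using h2 h1

theorem gen_cont [DM L] {t : (ι → ℝ) → ℝ} (ht : DefF L t) :
    ∀ᶠ x in residual (ι → ℝ), ContinuousAt t x := by
  have h := ht.use
  have h1 : ∀ q : ℚ, Def L (fun x => x ∈ {x | (q:ℝ) < t x}) := fun q => by
    simp only [mem_ofPred_eq]; infer_instance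
  have h2 : ∀ q : ℚ, Def L (fun x => x ∈ {x | t x < (q:ℝ)}) := fun q => by
    simp only [mem_ofPred_eq]; infer_instance
  filter_upwards [eventually_countable_forall.2 fun q => (tame_pi (L := L) ι).gen (h1 q),
    eventually_countable_forall.2 fun q => (tame_pi (L := L) ι).gen (h2 q)] with x k1 k2
  rw [ContinuousAt, tendsto_order]
  constructor
  · intro a ha
    obtain ⟨q, hq, hq'⟩ := exists_rat_btwn ha
    filter_upwards [mem_interior_iff_mem_nhds.1 (k1 q hq')] with y hy using hq.trans hy
  · intro a ha
    obtain ⟨q, hq, hq'⟩ := exists_rat_btwn ha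
    filter_upwards [mem_interior_iff_mem_nhds.1 (k2 q hq)] with y hy using lt_trans hy hq'

theorem Def.continuousAt [OF L] {t : (ι → ℝ) → ℝ} (ht : DefF L t) :
    Def L (fun x => ContinuousAt t x) := by
  have h := ht.use
  refine def_congr (P := fun x => ∀ η : ℝ, 0 < η → ∃ δ : ℝ, 0 < δ ∧
    ∀ y, dist y x < δ → dist (t y) (t x) < η) inferInstance ?_
  intro x
  rw [Metric.continuousAt_iff]

theorem mono_aux {g : ℝ → ℝ} {b : ℝ} (hb : 0 ≤ b) (hg : ContinuousOn g (Icc 0 b))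
    (h : ∀ s ∈ Ico 0 b, ∀ δ > 0, ∃ r, 0 < r ∧ r < δ ∧ g s < g (s + r)) : g 0 ≤ g b := by
  by_contra hcon
  push Not at hcon
  obtain ⟨s, hs, hmax⟩ := isCompact_Icc.exists_isMaxOn (nonempty_Icc.2 hb) hg
  have h0 : g 0 ≤ g s := hmax (left_mem_Icc.2 hb)
  have hsb : s < b := lt_of_le_of_ne hs.2 (by rintro rfl; linarith)
  obtain ⟨r, hr, hrb, hgr⟩ := h s ⟨hs.1, hsb⟩ (b - s) (by linarith)
  have : g (s + r) ≤ g s := hmax (show s + r ∈ Icc 0 b from ⟨by linarith [hs.1], by linarith⟩)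
  linarith

/-- upper right Dini derivative along `v` is bounded -/
def dini (t : (ι → ℝ) → ℝ) (v : ι → ℝ) (c : ℝ) (x : ι → ℝ) : Prop :=
  ∃ δ : ℝ, 0 < δ ∧ ∀ h : ℝ, 0 < h → h < δ → t (x + h • v) - t x ≤ c * h

theorem def_dini [OF L] {t : (ι → ℝ) → ℝ} (ht : DefF L t) (v : ι → ℝ) :
    Def L (fun q : ℝ × (ι → ℝ) => dini t v q.1 q.2) := by
  have h := ht.use
  have : DefF L (fun q : (ι → ℝ) × ℝ => q.1 + q.2 • v) :=
    DefF.pi (f := fun (q : (ι → ℝ) × ℝ) i => q.1 i + q.2 * v i) (h := fun i => inferInstance)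
  have := DefF.use2 (t := fun (x : ι → ℝ) (s : ℝ) => x + s • v) this
  unfold dini
  infer_instance

theorem dini_ub {t : (ι → ℝ) → ℝ} {v : ι → ℝ} {c c' : ℝ} (hc : c < c') {B : Set (ι → ℝ)}
    (hcont : ∀ y ∈ B, ContinuousAt t y) (hB : ∀ y ∈ B, dini t v c y) {y : ι → ℝ} {r : ℝ} (hr : 0 ≤ r)
    (hseg : ∀ s ∈ Icc 0 r, y + s • v ∈ B) : t (y + r • v) - t y ≤ c' * r := by
  have hct : ContinuousOn (fun s : ℝ => t (y + s • v)) (Icc 0 r) := fun s hs =>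
    (ContinuousAt.comp (f := fun s : ℝ => y + s • v) (hcont _ (hseg s hs))
      (by fun_prop)).continuousWithinAt
  have := mono_aux (g := fun s => c' * s - t (y + s • v)) hr ((by fun_prop : ContinuousOn (fun s : ℝ => c' * s) _).sub hct) ?_
  · simp only [mul_zero, zero_smul, add_zero] at this; linarith
  · intro s hs δ hδ
    obtain ⟨δ', hδ', hd⟩ := hB _ (hseg s ⟨hs.1, hs.2.le⟩)
    have hm : 0 < min δ δ' := lt_min hδ hδ'
    refine ⟨min δ δ' / 2, by linarith, by linarith [min_le_left δ δ'], ?_⟩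
    have := hd (min δ δ' / 2) (by linarith) (by linarith [min_le_right δ δ'])
    rw [add_assoc, ← add_smul] at this
    have h3 : c * (min δ δ' / 2) < c' * (min δ δ' / 2) := by
      apply mul_lt_mul_of_pos_right hc; linarith
    linarith [mul_add c' s (min δ δ' / 2)]

theorem dini_lb {t : (ι → ℝ) → ℝ} {v : ι → ℝ} {c : ℝ} {B : Set (ι → ℝ)}
    (hcont : ∀ y ∈ B, ContinuousAt t y) (hB : ∀ y ∈ B, ¬ dini t v c y) {y : ι → ℝ} {r : ℝ} (hr : 0 ≤ r)
    (hseg : ∀ s ∈ Icc 0 r, y + s • v ∈ B) : c * r ≤ t (y + r • v) - t y := by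
  have hct : ContinuousOn (fun s : ℝ => t (y + s • v)) (Icc 0 r) := fun s hs =>
    (ContinuousAt.comp (f := fun s : ℝ => y + s • v) (hcont _ (hseg s hs))
      (by fun_prop)).continuousWithinAt
  have := mono_aux (g := fun s => t (y + s • v) - c * s) hr (hct.sub (by fun_prop : ContinuousOn (fun s : ℝ => c * s) _)) ?_
  · simp only [mul_zero, zero_smul, add_zero] at this; linarith
  · intro s hs δ hδ
    have hd := hB _ (hseg s ⟨hs.1, hs.2.le⟩)
    unfold dini at hd
    push Not at hd
    obtain ⟨r, hr, hrd, h⟩ := hd δ hδ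
    refine ⟨r, hr, hrd, ?_⟩
    rw [add_assoc, ← add_smul] at h
    linarith [mul_add c s r]

/-- segments stay in balls -/
theorem seg_ball (x v : ι → ℝ) {δ : ℝ} (hδ : 0 < δ) : ∃ η > 0, ∀ s : ℝ, |s| < η →
    x + s • v ∈ Metric.ball x δ := by
  have h : Tendsto (fun s : ℝ => x + s • v) (𝓝 0) (𝓝 x) := by
    have : Continuous (fun s : ℝ => x + s • v) := by fun_prop
    simpa using this.tendsto 0
  obtain ⟨η, hη, h2⟩ := Metric.eventually_nhds_iff.1 (h (Metric.ball_mem_nhds x hδ))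
  exact ⟨η, hη, fun s hs => h2 (by simpa [Real.dist_eq] using hs)⟩

theorem gen_lineDiff [DM L] {t : (ι → ℝ) → ℝ} (ht : DefF L t) (v : ι → ℝ) :
    ∀ᶠ x in residual (ι → ℝ), LineDifferentiableAt ℝ t x v := by
  have hT := tame_pi (L := L) ι
  have hd := Def.use2 (A := fun c x => dini t v c x) (def_dini ht v)
  have d1 : ∀ q : ℚ, Def L (fun x => x ∈ {x | dini t v q x}) := fun q => by
    simp only [mem_ofPred_eq]; infer_instance
  have d2 : ∀ q : ℚ, Def L (fun x => x ∈ {x | ¬ dini t v q x}) := fun q => by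
    simp only [mem_ofPred_eq]; infer_instance
  have d3 : Def L (fun x => x ∈ {x | ∀ c : ℝ, dini t v c x}) := by
    simp only [mem_ofPred_eq]; infer_instance
  have d4 : Def L (fun x => x ∈ {x | ∀ c : ℝ, ¬ dini t v c x}) := by
    simp only [mem_ofPred_eq]; infer_instance
  have dc : Def L (fun x => x ∈ {x | ContinuousAt t x}) := Def.continuousAt ht
  filter_upwards [eventually_countable_forall.2 fun q => hT.gen (d1 q),
    eventually_countable_forall.2 fun q => hT.gen (d2 q), hT.gen d3, hT.gen d4,
    gen_interior dc (gen_cont ht)] with x g1 g2 g3 g4 gc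
  have key : ∀ P : (ι → ℝ) → Prop, x ∈ interior {x | P x} → ∃ η > 0, ∃ B : Set (ι → ℝ),
      (∀ y ∈ B, ContinuousAt t y) ∧ (∀ y ∈ B, P y) ∧ ∀ s : ℝ, |s| < η → x + s • v ∈ B := by
    intro P hP
    obtain ⟨δ, hδ, hB⟩ := Metric.isOpen_iff.1 (isOpen_interior.inter isOpen_interior) x ⟨gc, hP⟩
    obtain ⟨η, hη, h⟩ := seg_ball x v hδ
    exact ⟨η, hη, _, fun y hy => interior_subset (hB hy).1,
      fun y hy => interior_subset (s := {x | P x}) (hB hy).2, h⟩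
  have hmono : ∀ c c', c ≤ c' → dini t v c x → dini t v c' x := by
    rintro c c' hc ⟨δ, hδ, h⟩
    exact ⟨δ, hδ, fun r hr hrd => (h r hr hrd).trans (mul_le_mul_of_nonneg_right hc hr.le)⟩
  -- not everything
  have n3 : ¬ ∀ c, dini t v c x := by
    intro h
    obtain ⟨η, hη, B, hB, hP, hs⟩ := key _ (g3 h)
    have h1 : ∀ c : ℝ, t (x + (η / 2) • v) - t x ≤ c * (η / 2) := fun c =>
      dini_ub (c := c - 1) (by linarith) hB (fun y hy => hP y hy _) (by linarith) (fun s hs' => hs s (by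
        rw [abs_of_nonneg hs'.1]; linarith [hs'.2]))
    have := h1 ((t (x + (η / 2) • v) - t x - 1) / (η / 2))
    rw [div_mul_cancel₀ _ (by positivity)] at this
    linarith
  have n4 : ¬ ∀ c, ¬ dini t v c x := by
    intro h
    obtain ⟨η, hη, B, hB, hP, hs⟩ := key _ (g4 h)
    have h1 : ∀ c : ℝ, c * (η / 2) ≤ t (x + (η / 2) • v) - t x := fun c =>
      dini_lb hB (fun y hy => hP y hy _) (by linarith) (fun s hs' => hs s (by
        rw [abs_of_nonneg hs'.1]; linarith [hs'.2]))
    have := h1 ((t (x + (η / 2) • v) - t x + 1) / (η / 2))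
    rw [div_mul_cancel₀ _ (by positivity)] at this
    linarith
  push Not at n3 n4
  obtain ⟨clo, hlo⟩ := n3
  obtain ⟨chi, hhi⟩ := n4
  set c0 := sInf {c | dini t v c x} with hc0
  have hbd : BddBelow {c | dini t v c x} := ⟨clo, fun c hc => by
    by_contra hh
    exact hlo (hmono _ _ (not_le.1 hh).le hc)⟩
  have u1 : ∀ c, c0 < c → dini t v c x := fun c hc => by
    obtain ⟨c', h', h''⟩ := (csInf_lt_iff hbd ⟨chi, hhi⟩).1 hc
    exact hmono _ _ h''.le h'
  have u2 : ∀ c, c < c0 → ¬ dini t v c x := fun c hc h => (csInf_le hbd h).not_gt hc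
  have ub : ∀ c, c0 < c → ∃ η > 0, ∀ s s' : ℝ, |s| < η → |s'| < η → s ≤ s' →
      t (x + s' • v) - t (x + s • v) ≤ c * (s' - s) := by
    intro c hc
    obtain ⟨q, hq, hq'⟩ := exists_rat_btwn hc
    obtain ⟨η, hη, B, hB, hP, hs⟩ := key _ (g1 q (u1 q hq))
    refine ⟨η, hη, fun s s' h1 h2 h3 => ?_⟩
    have := dini_ub (y := x + s • v) (r := s' - s) hq' hB hP (by linarith) (fun r hr => by
      rw [add_assoc, ← add_smul]
      apply hs
      rw [abs_lt] at *
      constructor <;> linarith [hr.1, hr.2])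
    rw [add_assoc, ← add_smul] at this
    simpa using this
  have lb : ∀ c, c < c0 → ∃ η > 0, ∀ s s' : ℝ, |s| < η → |s'| < η → s ≤ s' →
      c * (s' - s) ≤ t (x + s' • v) - t (x + s • v) := by
    intro c hc
    obtain ⟨q, hq, hq'⟩ := exists_rat_btwn hc
    obtain ⟨η, hη, B, hB, hP, hs⟩ := key _ (g2 q (u2 q hq'))
    refine ⟨η, hη, fun s s' h1 h2 h3 => ?_⟩
    have := dini_lb (y := x + s • v) (r := s' - s) hB hP (by linarith) (fun r hr => by
      rw [add_assoc, ← add_smul]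
      apply hs
      rw [abs_lt] at *
      constructor <;> linarith [hr.1, hr.2])
    rw [add_assoc, ← add_smul] at this
    simp only [add_sub_cancel] at this
    nlinarith
  have : HasDerivAt (fun s : ℝ => t (x + s • v)) c0 0 := by
    rw [hasDerivAt_fo]
    intro η hη
    obtain ⟨η1, hη1, k1⟩ := ub (c0 + η) (by linarith)
    obtain ⟨η2, hη2, k2⟩ := lb (c0 - η) (by linarith)
    refine ⟨min η1 η2, lt_min hη1 hη2, fun y hy => ?_⟩
    simp only [sub_zero] at hy ⊢
    have hy1 := hy.trans_le (min_le_left _ _)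
    have hy2 := hy.trans_le (min_le_right _ _)
    rcases le_total 0 y with h0 | h0
    · have a1 := k1 0 y (by simpa) hy1 h0
      have a2 := k2 0 y (by simpa) hy2 h0
      rw [abs_of_nonneg h0, abs_le]
      constructor <;> nlinarith
    · have a1 := k1 y 0 hy1 (by simpa) h0
      have a2 := k2 y 0 hy2 (by simpa) h0
      rw [abs_of_nonpos h0, abs_le]
      constructor <;> nlinarith
  exact this.differentiableAt

theorem hasFDerivAt_of_partials {t : (ι → ℝ) → ℝ} {x : ι → ℝ}
    (h1 : ∀ᶠ y in 𝓝 x, ∀ i, LineDifferentiableAt ℝ t y (Pi.single i 1))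
    (h2 : ∀ i, ContinuousAt (fun y => lineDeriv ℝ t y (Pi.single i 1)) x) :
    HasFDerivAt t (∑ i, lineDeriv ℝ t x (Pi.single i 1) • ContinuousLinearMap.proj (R := ℝ) (φ := fun _ : ι => ℝ) i) x := by
  have main : ∀ S : Finset ι, ∀ η > 0, ∃ δ > 0, ∀ h : ι → ℝ, ‖h‖ < δ →
      |t (x + fun i => if i ∈ S then h i else 0) - t x - ∑ i ∈ S, lineDeriv ℝ t x (Pi.single i 1) * h i|
        ≤ η * ‖h‖ := by
    intro S
    induction S using Finset.induction_on with
    | empty =>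
      intro η hη
      refine ⟨1, one_pos, fun h _ => ?_⟩
      have : (x + fun _ => (0:ℝ)) = x := by ext; simp
      simp [this]
      positivity
    | insert a S ha ih =>
      intro η hη
      obtain ⟨δ1, hδ1, k1⟩ := ih (η / 2) (by linarith)
      obtain ⟨δ2, hδ2, k2⟩ := Metric.eventually_nhds_iff.1 (h1.and
        (Metric.tendsto_nhds.1 (h2 a) (η / 2) (by linarith)))
      refine ⟨min δ1 δ2, lt_min hδ1 hδ2, fun h hh => ?_⟩
      have hh1 := k1 h (hh.trans_le (min_le_left _ _))
      have hh2 := hh.trans_le (min_le_right _ _)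
      set w : ι → ℝ := fun i => if i ∈ S then h i else 0 with hw
      have hw1 : (fun i => if i ∈ insert a S then h i else 0) = w + h a • Pi.single a 1 := by
        ext i
        by_cases hi : i = a
        · subst hi; simp [hw, ha]
        · simp [hw, hi]
      have hin : ∀ s ∈ uIcc 0 (h a), dist (x + w + s • Pi.single a 1) x < δ2 := by
        intro s hs
        refine lt_of_le_of_lt ?_ hh2
        rw [dist_pi_le_iff (norm_nonneg _)]
        intro i
        rw [Real.dist_eq]
        have hsa : |s| ≤ |h a| := by
          rw [mem_uIcc] at hs
          rcases hs with hs | hs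
          · rw [abs_of_nonneg hs.1, abs_of_nonneg (hs.1.trans hs.2)]; exact hs.2
          · rw [abs_of_nonpos hs.2, abs_of_nonpos (hs.1.trans hs.2)]; linarith
        by_cases hi : i = a
        · subst hi
          simp [hw, ha]
          exact hsa.trans (norm_le_pi_norm h i)
        · simp [hw, hi]
          split_ifs
          · exact norm_le_pi_norm h i
          · simp
      have mv := Convex.norm_image_sub_le_of_norm_hasDerivWithin_le (𝕜 := ℝ)
        (f := fun s : ℝ => t (x + w + s • Pi.single a 1) - s * lineDeriv ℝ t x (Pi.single a 1))
        (f' := fun s : ℝ => lineDeriv ℝ t (x + w + s • Pi.single a 1) (Pi.single a 1) - 1 * lineDeriv ℝ t x (Pi.single a 1))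
        (s := uIcc 0 (h a)) (x := 0) (y := h a) (C := η / 2) ?_ ?_ (convex_uIcc _ _) left_mem_uIcc
        right_mem_uIcc
      · simp only [Real.norm_eq_abs, zero_smul, add_zero, zero_mul, sub_zero] at mv
        have ha' : |h a| ≤ ‖h‖ := norm_le_pi_norm h a
        rw [hw1, Finset.sum_insert ha, ← add_assoc]
        have : η / 2 * |h a| ≤ η / 2 * ‖h‖ := by gcongr
        rw [abs_le] at mv hh1 ⊢
        constructor <;> linarith [mv.1, mv.2, hh1.1, hh1.2]
      · intro s hs
        apply HasDerivAt.hasDerivWithinAt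
        refine HasDerivAt.sub ?_ ((hasDerivAt_id s).mul_const _)
        have h3 : LineDifferentiableAt ℝ t (x + w + s • Pi.single a 1) (Pi.single a 1) := (k2 (hin s hs)).1 a
        have h4 : HasDerivAt (fun r : ℝ => t ((x + w + s • Pi.single a 1) + r • Pi.single a 1))
            (lineDeriv ℝ t (x + w + s • Pi.single a 1) (Pi.single a 1)) (s - s) := by
          rw [sub_self]; exact h3.hasDerivAt
        have h5 := h4.comp_sub_const s s
        refine h5.congr_of_eventuallyEq (Eventually.of_forall fun r => ?_)
        simp only
        congr 1
        module
      · intro s hs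
        have := (k2 (hin s hs)).2
        rw [Real.dist_eq] at this
        rw [Real.norm_eq_abs, one_mul]
        exact this.le
  rw [hasFDerivAt_iff_isLittleO_nhds_zero, Asymptotics.isLittleO_iff]
  intro η hη
  obtain ⟨δ, hδ, k⟩ := main Finset.univ η hη
  refine Metric.eventually_nhds_iff.2 ⟨δ, hδ, fun h hh => ?_⟩
  have := k h (by simpa using hh)
  simpa [ContinuousLinearMap.sum_apply] using this

theorem contDiffAt_succ_iff_partials {t : (ι → ℝ) → ℝ} {x : ι → ℝ} {p : ℕ} :
    ContDiffAt ℝ (p + 1 : ℕ) t x ↔ (∀ᶠ y in 𝓝 x, ∀ i, LineDifferentiableAt ℝ t y (Pi.single i 1)) ∧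
      ∀ i, ContDiffAt ℝ p (fun y => lineDeriv ℝ t y (Pi.single i 1)) x := by
  constructor
  · intro h
    push_cast at h
    obtain ⟨f', ⟨u, hu, hf⟩, hf'⟩ := contDiffAt_succ_iff_hasFDerivAt.1 h
    constructor
    · filter_upwards [hu] with y hy i using (hf y hy).differentiableAt.lineDifferentiableAt
    · intro i
      have : ContDiffAt ℝ p (fun y => f' y (Pi.single i 1)) x := hf'.clm_apply contDiffAt_const
      refine this.congr_of_eventuallyEq ?_
      filter_upwards [hu] with y hy
      rw [(hf y hy).differentiableAt.lineDeriv_eq_fderiv, (hf y hy).fderiv]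
  · rintro ⟨h1, h2⟩
    push_cast
    refine contDiffAt_succ_iff_hasFDerivAt.2 ⟨fun y => ∑ i, lineDeriv ℝ t y (Pi.single i 1) •
      ContinuousLinearMap.proj (R := ℝ) (φ := fun _ : ι => ℝ) i, ?_, ?_⟩
    · have h3 : ∀ᶠ y in 𝓝 x, ∀ i, ContinuousAt (fun y => lineDeriv ℝ t y (Pi.single i 1)) y :=
        eventually_all.2 fun i => ((h2 i).eventually (by simp)).mono fun y hy => hy.continuousAt
      have h4 := h1.eventually_nhds.and h3
      exact ⟨_, h4, fun y hy => hasFDerivAt_of_partials hy.1 hy.2⟩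
    · exact ContDiffAt.sum fun i _ => (h2 i).smul contDiffAt_const

theorem Def.contDiffAt [OF L] (p : ℕ) {t : (ι → ℝ) → ℝ} (ht : DefF L t) :
    Def L (fun x => ContDiffAt ℝ p t x) := by
  induction p generalizing t with
  | zero =>
    have : Def L (fun x => x ∈ {x | ContinuousAt t x}) := Def.continuousAt ht
    refine def_congr this.interior fun x => ?_
    rw [mem_interior_iff_mem_nhds]
    rw [Nat.cast_zero, contDiffAt_zero]
    constructor
    · intro h
      exact ⟨_, h, fun y hy => ContinuousAt.continuousWithinAt hy⟩
    · rintro ⟨u, hu, hc⟩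
      filter_upwards [eventually_eventually_nhds.2 hu] with y hy
      exact hc.continuousAt hy
  | succ p ih =>
    have h1 : Def L (fun x => x ∈ {x | ∀ i, LineDifferentiableAt ℝ t x (Pi.single i 1)}) := by
      have := fun i => Def.lineDifferentiableAt ht (Pi.single i 1)
      simp only [mem_ofPred_eq]
      infer_instance
    have h2 : ∀ i, Def L (fun x => ContDiffAt ℝ p (fun y => lineDeriv ℝ t y (Pi.single i 1)) x) :=
      fun i => ih (ht.lineDeriv _)
    have h3 := h1.interior
    refine def_congr (P := fun x => x ∈ _root_.interior {x | ∀ i, LineDifferentiableAt ℝ t x (Pi.single i 1)} ∧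
      ∀ i, ContDiffAt ℝ p (fun y => lineDeriv ℝ t y (Pi.single i 1)) x) inferInstance fun x => ?_
    rw [contDiffAt_succ_iff_partials, mem_interior_iff_mem_nhds]
    rfl

theorem gen_contDiff [DM L] (p : ℕ) {t : (ι → ℝ) → ℝ} (ht : DefF L t) :
    ∀ᶠ x in residual (ι → ℝ), ContDiffAt ℝ p t x := by
  induction p generalizing t with
  | zero =>
    have : Def L (fun x => x ∈ {x | ContinuousAt t x}) := Def.continuousAt ht
    filter_upwards [gen_interior this (gen_cont ht)] with x hx
    rw [Nat.cast_zero, contDiffAt_zero]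
    exact ⟨_, mem_interior_iff_mem_nhds.1 hx, fun y hy => ContinuousAt.continuousWithinAt hy⟩
  | succ p ih =>
    have h1 : Def L (fun x => x ∈ {x | ∀ i, LineDifferentiableAt ℝ t x (Pi.single i 1)}) := by
      have := fun i => Def.lineDifferentiableAt ht (Pi.single i 1)
      simp only [mem_ofPred_eq]
      infer_instance
    filter_upwards [gen_interior h1 (eventually_all.2 fun i => gen_lineDiff ht _),
      eventually_all.2 fun i => ih (ht.lineDeriv (Pi.single i 1))] with x hx1 hx2
    rw [contDiffAt_succ_iff_partials]
    exact ⟨mem_interior_iff_mem_nhds.1 hx1, hx2⟩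

end PartC


section PartD
set_option linter.unusedSectionVars false
variable {L}

/-- derivative tower with bound -/
def Tower (L : FirstOrder.Language) [L.Structure ℝ] (p : ℕ) (M : ℝ → ℝ) (b : ℝ) : Prop :=
  ∃ G : ℕ → ℝ → ℝ, DefF L (G 0) ∧ (∀ s ∈ Ioo 0 b, 0 < G 0 s) ∧
    ∀ i ≤ p, ∀ s ∈ Ioo 0 b, HasDerivAt (G i) (G (i + 1) s) s ∧ |G i s| ≤ M s

theorem Tower.scale [OF L] {p : ℕ} {M : ℝ → ℝ} (hM : MonotoneOn M (Ioi 0)) {b : ℝ} (hb : 0 < b) (hb1 : b ≤ 1)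
    (h : Tower L p M b) : Tower L p M 2 := by
  obtain ⟨G, hG, hpos, hder⟩ := h
  have hG' := hG.use
  set κ := b / 2 with hκ
  have k0 : 0 < κ := by positivity
  have k1 : κ ≤ 1 := by rw [hκ]; linarith
  have hin : ∀ s ∈ Ioo (0:ℝ) 2, κ * s ∈ Ioo 0 b := fun s hs =>
    ⟨mul_pos k0 hs.1, by rw [hκ]; nlinarith [hs.2]⟩
  refine ⟨fun i s => κ ^ i * G i (κ * s), ?_, ?_, ?_⟩
  · simp only [pow_zero]; infer_instance
  · intro s hs; simpa using hpos _ (hin s hs)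
  · intro i hi s hs
    obtain ⟨h1, h2⟩ := hder i hi _ (hin s hs)
    constructor
    · have := (h1.comp s ((hasDerivAt_id s).const_mul κ)).const_mul (κ ^ i)
      refine this.congr_deriv ?_
      ring
    · rw [abs_mul, abs_of_nonneg (by positivity)]
      have h3 : M (κ * s) ≤ M s := hM (hin s hs).1 hs.1 (by nlinarith [hs.1])
      calc κ ^ i * |G i (κ * s)| ≤ 1 * |G i (κ * s)| :=
            mul_le_mul_of_nonneg_right (pow_le_one₀ k0.le k1) (abs_nonneg _)
        _ ≤ M s := by linarith

theorem bump_bound (i : ℕ) : ∀ m j : ℕ, ∃ C : ℝ, 0 ≤ C ∧ ∀ a c s : ℝ, a ∈ Icc 0 1 → c ∈ Icc 0 1 →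
    s ∈ Icc 0 1 → |iteratedDeriv i (fun r : ℝ => ((r - a) * (c - r)) ^ (m + i) * (a + c - 2 * r) ^ j) s|
      ≤ C * |(s - a) * (c - s)| ^ m := by
  induction i with
  | zero =>
    intro m j
    refine ⟨2 ^ j, by positivity, fun a c s ha hc hs => ?_⟩
    simp only [iteratedDeriv_zero, add_zero, abs_mul, abs_pow]
    rw [mul_comm]
    gcongr
    rw [abs_le]; constructor <;> linarith [ha.1, ha.2, hc.1, hc.2, hs.1, hs.2]
  | succ i ih =>
    intro m j
    obtain ⟨C1, hC1, h1⟩ := ih m (j + 1)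
    obtain ⟨C2, hC2, h2⟩ := ih (m + 1) (j - 1)
    refine ⟨(m + (i + 1)) * C1 + 2 * j * C2, by positivity, fun a c s ha hc hs => ?_⟩
    rw [iteratedDeriv_succ']
    have hd : deriv (fun r : ℝ => ((r - a) * (c - r)) ^ (m + (i + 1)) * (a + c - 2 * r) ^ j) =
        fun r => ((m + (i + 1) : ℕ) : ℝ) * (((r - a) * (c - r)) ^ (m + i) * (a + c - 2 * r) ^ (j + 1)) +
          (- 2 * j) * (((r - a) * (c - r)) ^ (m + 1 + i) * (a + c - 2 * r) ^ (j - 1)) := by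
      ext r
      have e1 : HasDerivAt (fun r : ℝ => (r - a) * (c - r)) (1 * (c - r) + (r - a) * (-1)) r :=
        ((hasDerivAt_id r).sub_const a).mul ((hasDerivAt_id r).const_sub c)
      have e2 : HasDerivAt (fun r : ℝ => a + c - 2 * r) (-(2 * 1)) r :=
        ((hasDerivAt_id r).const_mul 2).const_sub (a + c)
      have := ((e1.pow (m + (i + 1))).mul (e2.pow j)).deriv
      refine Eq.trans this ?_
      have e3 : m + (i + 1) - 1 = m + i := by omega
      have e4 : m + 1 + i = m + (i + 1) := by omega
      simp only [Pi.pow_apply]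
      rw [e3, e4]
      push_cast
      ring
    rw [hd, iteratedDeriv_fun_add (by fun_prop) (by fun_prop), iteratedDeriv_const_mul_field,
      iteratedDeriv_const_mul_field]
    have k1 := h1 a c s ha hc hs
    have k2 := h2 a c s ha hc hs
    have hw : |(s - a) * (c - s)| ≤ 1 := by
      rw [abs_mul]
      refine mul_le_one₀ ?_ (abs_nonneg _) ?_ <;> rw [abs_le] <;> constructor <;>
        linarith [ha.1, ha.2, hc.1, hc.2, hs.1, hs.2]
    have hw2 : |(s - a) * (c - s)| ^ (m + 1) ≤ |(s - a) * (c - s)| ^ m :=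
      pow_le_pow_of_le_one (abs_nonneg _) hw (by omega)
    refine (abs_add_le _ _).trans ?_
    rw [abs_mul, abs_mul, add_mul]
    apply add_le_add
    · rw [abs_of_nonneg (by positivity), mul_assoc]
      push_cast
      gcongr
    · rw [abs_mul, abs_neg, abs_of_nonneg (by positivity : (0:ℝ) ≤ 2), abs_of_nonneg (by positivity : (0:ℝ) ≤ j), mul_assoc (2 * (j:ℝ))]
      exact mul_le_mul_of_nonneg_left (k2.trans (mul_le_mul_of_nonneg_left hw2 hC2)) (by positivity)

theorem tower_case1 [DM L] (p : ℕ) {M : ℝ → ℝ} (hMd : DefF L M) (hM : MonotoneOn M (Ioi 0))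
    (hpos : ∀ s > 0, 0 < M s) {D : Set ℝ} (hD : Def L (fun x => x ∈ D)) (hcl : IsClosed D)
    (hct : D.Countable) (hacc : ∀ δ > 0, ∃ d ∈ D, 0 < d ∧ d < δ) : ∃ b, 0 < b ∧ b ≤ 1 ∧ Tower L p M b := by
  obtain ⟨b, hbD, hb, hb1⟩ := hacc 1 one_pos
  have hMu := hMd.use
  have hDu := hD.useS
  have bb : ∀ i, ∃ C : ℝ, 0 ≤ C ∧ ∀ a c s : ℝ, a ∈ Icc 0 1 → c ∈ Icc 0 1 →
    s ∈ Icc 0 1 → i ≤ p + 1 → |iteratedDeriv i (fun r : ℝ => ((r - a) * (c - r)) ^ (p + 3)) s|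
      ≤ C * |(s - a) * (c - s)| ^ (p + 3 - i) := by
    intro i
    obtain ⟨C, hC, h⟩ := bump_bound i (p + 3 - i) 0
    refine ⟨C, hC, fun a c s ha hc hs hi => ?_⟩
    have := h a c s ha hc hs
    rw [Nat.sub_add_cancel (by omega)] at this
    simpa using this
  choose C hC hbb using bb
  set K := 1 + ∑ i ∈ Finset.range (p + 2), C i with hK
  have hKpos : 0 < K := by
    have : 0 ≤ ∑ i ∈ Finset.range (p + 2), C i := Finset.sum_nonneg fun i _ => hC i
    linarith
  have hCK : ∀ i ≤ p + 1, C i ≤ K := fun i hi => by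
    have := Finset.single_le_sum (f := C) (fun i _ => hC i) (Finset.mem_range.2 (by omega : i < p + 2))
    linarith
  set a : ℝ → ℝ := fun s => sSup {d | d ∈ D ∧ 0 < d ∧ d ≤ s} with ha
  set c : ℝ → ℝ := fun s => sInf {d | d ∈ D ∧ s ≤ d} with hc
  have had : DefF L a := DefF.sSup (A := fun s d => d ∈ D ∧ 0 < d ∧ d ≤ s) inferInstance
  have hcd : DefF L c := DefF.sInf (A := fun s d => d ∈ D ∧ s ≤ d) inferInstance
  have A1 : ∀ s > 0, a s ∈ D ∧ 0 < a s ∧ a s ≤ s ∧ ∀ d ∈ D, 0 < d → d ≤ s → d ≤ a s := by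
    intro s hs
    obtain ⟨d0, h1, h2, h3⟩ := hacc s hs
    have hne : {d | d ∈ D ∧ 0 < d ∧ d ≤ s}.Nonempty := ⟨d0, h1, h2, h3.le⟩
    have hbd : BddAbove {d | d ∈ D ∧ 0 < d ∧ d ≤ s} := ⟨s, fun d hd => hd.2.2⟩
    refine ⟨hcl.closure_subset_iff.2 (fun d hd => hd.1) (csSup_mem_closure hne hbd),
      h2.trans_le (le_csSup hbd ⟨h1, h2, h3.le⟩), csSup_le hne fun d hd => hd.2.2,
      fun d h4 h5 h6 => le_csSup hbd ⟨h4, h5, h6⟩⟩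
  have C1 : ∀ s ≤ b, c s ∈ D ∧ s ≤ c s ∧ c s ≤ b ∧ ∀ d ∈ D, s ≤ d → c s ≤ d := by
    intro s hs
    have hne : {d | d ∈ D ∧ s ≤ d}.Nonempty := ⟨b, hbD, hs⟩
    have hbd : BddBelow {d | d ∈ D ∧ s ≤ d} := ⟨s, fun d hd => hd.2⟩
    refine ⟨hcl.closure_subset_iff.2 (fun d hd => hd.1) (csInf_mem_closure hne hbd),
      le_csInf hne fun d hd => hd.2, csInf_le hbd ⟨hbD, hs⟩,
      fun d h4 h5 => csInf_le hbd ⟨h4, h5⟩⟩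
  have AI : ∀ s ∈ Ioo 0 b, a s ∈ Icc (0:ℝ) 1 ∧ c s ∈ Icc (0:ℝ) 1 ∧ s ∈ Icc (0:ℝ) 1 := by
    intro s hs
    have h1 := A1 s hs.1
    have h2 := C1 s hs.2.le
    refine ⟨⟨h1.2.1.le, ?_⟩, ⟨?_, ?_⟩, ⟨hs.1.le, ?_⟩⟩ <;> linarith [hs.1, hs.2]
  set B : ℕ → ℝ → ℝ → ℝ → ℝ := fun i a c s => iteratedDeriv i (fun r : ℝ => ((r - a) * (c - r)) ^ (p + 3)) s with hB
  have hBd : ∀ i a c s, HasDerivAt (B i a c) (B (i + 1) a c s) s := by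
    intro i a c s
    simp only [hB, iteratedDeriv_succ]
    apply DifferentiableAt.hasDerivAt
    exact (ContDiff.differentiable_iteratedDeriv (n := (⊤ : ℕ∞)) i (by fun_prop) (by exact_mod_cast WithTop.coe_lt_top i)).differentiableAt
  -- the tower
  set G : ℕ → ℝ → ℝ := fun i s => (2 * K)⁻¹ * M (a s) * B i (a s) (c s) s with hG
  have G0 : DefF L (G 0) := by
    have := had.use
    have := hcd.use
    simp only [hG, hB, iteratedDeriv_zero]; infer_instance
  have Gb : ∀ i ≤ p + 1, ∀ s ∈ Ioo 0 b, |G i s| ≤ M s / 2 * |(s - a s) * (c s - s)| ^ (p + 3 - i) := by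
    intro i hi s hs
    obtain ⟨i1, i2, i3⟩ := AI s hs
    have h1 := hbb i _ _ s i1 i2 i3 hi
    have h2 : M (a s) ≤ M s := hM (A1 s hs.1).2.1 hs.1 (A1 s hs.1).2.2.1
    have h3 := hpos _ (A1 s hs.1).2.1
    have h4 := hCK i hi
    simp only [hG, abs_mul, abs_of_pos h3, abs_of_pos (inv_pos.2 (by positivity : 0 < 2 * K))]
    calc (2 * K)⁻¹ * M (a s) * |B i (a s) (c s) s| ≤ (2 * K)⁻¹ * M s * (K * |(s - a s) * (c s - s)| ^ (p + 3 - i)) := by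
          have : 0 ≤ M s := h3.le.trans h2
          apply mul_le_mul (by gcongr) _ (abs_nonneg _) (by positivity)
          exact h1.trans (mul_le_mul_of_nonneg_right h4 (by positivity))
      _ = _ := by rw [abs_mul]; field_simp
  have Gw : ∀ s ∈ Ioo 0 b, |(s - a s) * (c s - s)| ≤ 1 := by
    intro s hs
    obtain ⟨i1, i2, i3⟩ := AI s hs
    rw [abs_mul]
    refine mul_le_one₀ ?_ (abs_nonneg _) ?_ <;> rw [abs_le] <;> constructor <;>
      linarith [i1.1, i1.2, i2.1, i2.2, i3.1, i3.2]
  have Gb1 : ∀ i ≤ p + 1, ∀ s ∈ Ioo 0 b, |G i s| ≤ M s / 2 := by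
    intro i hi s hs
    refine (Gb i hi s hs).trans ?_
    have h3 := hpos _ hs.1
    exact mul_le_of_le_one_right (by positivity) (pow_le_one₀ (abs_nonneg _) (Gw s hs))
  have Gpos : ∀ s ∈ Ioo 0 b, 0 ≤ G 0 s ∧ (s ∉ D → 0 < G 0 s) := by
    intro s hs
    have h1 := A1 s hs.1
    have h2 := C1 s hs.2.le
    have h3 := hpos _ h1.2.1
    simp only [hG, hB, iteratedDeriv_zero]
    constructor
    · have : 0 ≤ (s - a s) * (c s - s) := mul_nonneg (by linarith) (by linarith)
      positivity
    · intro hsD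
      have e1 : a s < s := lt_of_le_of_ne h1.2.2.1 (fun h => hsD (h ▸ h1.1))
      have e2 : s < c s := lt_of_le_of_ne h2.2.1 (fun h => hsD (h ▸ h2.1))
      have : 0 < (s - a s) * (c s - s) := mul_pos (by linarith) (by linarith)
      positivity
  have Gder : ∀ i ≤ p, ∀ s ∈ Ioo 0 b, HasDerivAt (G i) (G (i + 1) s) s := by
    intro i hi s hs
    by_cases hsD : s ∈ D
    · have hz : ∀ i ≤ p + 1, G i s = 0 := by
        intro i hi
        have := Gb i hi s hs
        have e1 : a s = s := le_antisymm (A1 s hs.1).2.2.1 ((A1 s hs.1).2.2.2 s hsD hs.1 le_rfl)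
        rw [e1, sub_self, zero_mul, abs_zero, zero_pow (by omega), mul_zero] at this
        exact abs_eq_zero.1 (le_antisymm this (abs_nonneg _))
      rw [hz (i + 1) (by omega), hasDerivAt_fo]
      intro η hη
      have hMb := hpos b hb
      refine ⟨min (η / M b) (min s (b - s)), ?_, fun y hy => ?_⟩
      · refine lt_min (by positivity) (lt_min hs.1 (by linarith [hs.2]))
      · rw [hz i (by omega), mul_zero, sub_zero, sub_zero]
        have y1 := hy.trans_le (min_le_left _ _)
        have y2 := hy.trans_le ((min_le_right _ _).trans (min_le_left _ _))
        have y3 := hy.trans_le ((min_le_right _ _).trans (min_le_right _ _))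
        have hyI : y ∈ Ioo 0 b := by
          rw [abs_lt] at y2 y3; constructor <;> linarith
        have hw : |(y - a y) * (c y - y)| ≤ |y - s| := by
          obtain ⟨i1, i2, i3⟩ := AI y hyI
          have f1 := A1 y hyI.1
          have f2 := C1 y hyI.2.le
          rw [abs_mul, abs_of_nonneg (by linarith : 0 ≤ y - a y), abs_of_nonneg (by linarith : 0 ≤ c y - y)]
          rcases le_total s y with h | h
          · have := f1.2.2.2 s hsD hs.1 h
            rw [abs_of_nonneg (by linarith)]
            nlinarith [i1.1, i1.2, i2.1, i2.2, i3.1, i3.2]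
          · have := f2.2.2.2 s hsD h
            rw [abs_of_nonpos (by linarith)]
            nlinarith [i1.1, i1.2, i2.1, i2.2, i3.1, i3.2]
        have hMy : M y ≤ M b := hM hyI.1 hb hyI.2.le
        have hMy0 := hpos y hyI.1
        calc |G i y| ≤ M y / 2 * |(y - a y) * (c y - y)| ^ (p + 3 - i) := Gb i (by omega) y hyI
          _ ≤ M b * |(y - a y) * (c y - y)| ^ 2 := by
              apply mul_le_mul _ (pow_le_pow_of_le_one (abs_nonneg _) (Gw y hyI) (by omega)) (by positivity) hMb.le
              linarith
          _ ≤ M b * |y - s| ^ 2 := by gcongr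
          _ ≤ η * |y - s| := by
              rw [lt_div_iff₀ hMb] at y1
              nlinarith [abs_nonneg (y - s)]
    · have h1 := A1 s hs.1
      have h2 := C1 s hs.2.le
      have e1 : a s < s := lt_of_le_of_ne h1.2.2.1 (fun h => hsD (h ▸ h1.1))
      have e2 : s < c s := lt_of_le_of_ne h2.2.1 (fun h => hsD (h ▸ h2.1))
      have hev : ∀ᶠ y in 𝓝 s, a y = a s ∧ c y = c s := by
        filter_upwards [Ioo_mem_nhds e1 e2] with y hy
        have y0 : 0 < y := h1.2.1.trans hy.1
        have yb : y ≤ b := hy.2.le.trans h2.2.2.1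
        have f1 := A1 y y0
        have f2 := C1 y yb
        have t1 : a s ≤ a y := f1.2.2.2 _ h1.1 h1.2.1 hy.1.le
        have t2 : c y ≤ c s := f2.2.2.2 _ h2.1 hy.2.le
        have no : ∀ d ∈ D, a s < d → d < c s → False := by
          intro d hd q1 q2
          rcases le_total d s with h | h
          · exact absurd (h1.2.2.2 d hd (h1.2.1.trans q1) h) (not_le.2 q1)
          · exact absurd (h2.2.2.2 d hd h) (not_le.2 q2)
        constructor
        · refine le_antisymm ?_ t1
          by_contra hh
          exact no _ f1.1 (not_le.1 hh) (f1.2.2.1.trans_lt hy.2)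
        · refine le_antisymm t2 ?_
          by_contra hh
          exact no _ f2.1 (hy.1.trans_le f2.2.1) (not_le.1 hh)
      have := (hBd i (a s) (c s) s).const_mul ((2 * K)⁻¹ * M (a s))
      refine this.congr_of_eventuallyEq ?_
      filter_upwards [hev] with y hy
      simp only [hG, hy.1, hy.2]
  -- shift
  obtain ⟨l, hl, hlD⟩ : ∃ l ∈ Ioo (1:ℝ) 2, l ∉ image2 (fun x y => x / y) D D := by
    have h1 : (image2 (fun x y : ℝ => x / y) D D).Countable := hct.image2 hct _
    by_contra hcon
    push Not at hcon
    have : (Ioo (1:ℝ) 2).Countable := h1.mono hcon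
    rw [← Cardinal.le_aleph0_iff_set_countable, Cardinal.mk_Ioo_real (by norm_num)] at this
    exact absurd this (not_le.2 Cardinal.aleph0_lt_continuum)
  have l0 : 0 < l := by linarith [hl.1]
  have hsl : ∀ s ∈ Ioo 0 b, s / l ∈ Ioo 0 b ∧ s / l ≤ s := fun s hs => by
    have : s / l ≤ s := div_le_self hs.1.le hl.1.le
    exact ⟨⟨div_pos hs.1 l0, this.trans_lt hs.2⟩, this⟩
  refine ⟨b, hb, hb1.le, fun i s => G i s + (l⁻¹) ^ i * G i (s / l), ?_, ?_, ?_⟩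
  · have := G0.use
    simp only [pow_zero]
    infer_instance
  · intro s hs
    have p1 := Gpos s hs
    have p2 := Gpos _ (hsl s hs).1
    simp only [pow_zero, one_mul]
    by_cases h : s ∈ D
    · have : s / l ∉ D := fun h' => hlD ⟨s, h, s / l, h', by
        show s / (s / l) = l
        have := hs.1
        field_simp⟩
      linarith [p2.2 this]
    · linarith [p1.2 h]
  · intro i hi s hs
    obtain ⟨q1, q2⟩ := hsl s hs
    constructor
    · have h1 := Gder i hi s hs
      have h2 := Gder i hi _ q1
      have h3 := (h2.comp s ((hasDerivAt_id s).div_const l)).const_mul ((l⁻¹) ^ i)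
      refine (h1.add h3).congr_deriv ?_
      show _ = G (i + 1) s + (l⁻¹) ^ (i + 1) * G (i + 1) (s / l)
      rw [pow_succ]
      ring
    · have h1 := Gb1 i (by omega) s hs
      have h2 := Gb1 i (by omega) _ q1
      have h3 : M (s / l) ≤ M s := hM q1.1 hs.1 q2
      have h4 : |(l⁻¹) ^ i * G i (s / l)| ≤ |G i (s / l)| := by
        rw [abs_mul]
        apply mul_le_of_le_one_left (abs_nonneg _)
        rw [abs_of_nonneg (by positivity)]
        exact pow_le_one₀ (by positivity) (inv_le_one_of_one_le₀ hl.1.le)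
      exact (abs_add_le _ _).trans (by linarith)


/-- germs at zero decide every definable set -/
def Decides (L : FirstOrder.Language) [L.Structure ℝ] : Prop :=
  ∀ A : Set ℝ, Def L (fun x => x ∈ A) → ∃ δ > 0, (∀ s ∈ Ioo 0 δ, s ∈ A) ∨ (∀ s ∈ Ioo 0 δ, s ∉ A)

theorem gen_diff [DM L] {f : ℝ → ℝ} (hf : DefF L f) {δ : ℝ} (hδ : 0 < δ) :
    ∃ s ∈ Ioo 0 δ, DifferentiableAt ℝ f s := by
  have hf' := hf.use
  have h := gen_lineDiff (L := L) (t := fun x : Unit → ℝ => f (x ())) inferInstance (fun _ => 1)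
  have hd : Dense {x : Unit → ℝ | LineDifferentiableAt ℝ (fun x : Unit → ℝ => f (x ())) x (fun _ => 1)} :=
    dense_of_mem_residual h
  have ho : IsOpen {x : Unit → ℝ | x () ∈ Ioo 0 δ} := isOpen_Ioo.preimage (continuous_apply ())
  obtain ⟨x, hx1, hx2⟩ := hd.inter_open_nonempty _ ho ⟨fun _ => δ / 2, by
    show δ / 2 ∈ Ioo 0 δ
    constructor <;> linarith⟩
  refine ⟨x (), hx1, ?_⟩
  have h3 : DifferentiableAt ℝ (fun s : ℝ => f (x () + s)) 0 := by
    have h4 : DifferentiableAt ℝ (fun s : ℝ => f ((x + s • (fun _ => (1:ℝ) : Unit → ℝ)) ())) 0 := hx2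
    simpa using h4
  have h5 : DifferentiableAt ℝ (fun s : ℝ => f (x () + (s - x ()))) (x ()) := by
    apply DifferentiableAt.comp (g := fun s : ℝ => f (x () + s)) (f := fun s : ℝ => s - x ())
    · simpa using h3
    · fun_prop
  simpa using h5

theorem Decides.diff [DM L] (hdec : Decides L) {f : ℝ → ℝ} (hf : DefF L f) :
    ∃ δ > 0, ∀ s ∈ Ioo 0 δ, DifferentiableAt ℝ f s := by
  have hf' := hf.use
  have h1 : Def L (fun s => s ∈ {s | DifferentiableAt ℝ f s}) := by
    have h2 := Def.hasDerivAt (Γ := ℝ) (t := fun _ => f) (L := L) inferInstance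
    have : Def L (fun q : ℝ × ℝ => HasDerivAt f q.2 q.1) :=
      h2.comp (f := fun q : ℝ × ℝ => ((0, q.1), q.2)) inferInstance
    refine def_congr (P := fun s => ∃ z, HasDerivAt f z s) inferInstance fun s => ?_
    exact ⟨fun ⟨z, hz⟩ => hz.differentiableAt, fun hh => ⟨_, DifferentiableAt.hasDerivAt hh⟩⟩
  obtain ⟨δ, hδ, h | h⟩ := hdec _ h1
  · exact ⟨δ, hδ, h⟩
  · obtain ⟨s, hs, hs'⟩ := gen_diff hf hδ
    exact absurd hs' (h s hs)

theorem forall_le_delta {P : ℕ → ℝ → Prop} (h : ∀ i, ∃ δ > 0, ∀ s ∈ Ioo (0:ℝ) δ, P i s) (N : ℕ) :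
    ∃ δ > 0, ∀ i ≤ N, ∀ s ∈ Ioo (0:ℝ) δ, P i s := by
  induction N with
  | zero =>
    obtain ⟨δ, hδ, h⟩ := h 0
    exact ⟨δ, hδ, fun i hi => by obtain rfl : i = 0 := by omega
                                 exact h⟩
  | succ N ih =>
    obtain ⟨δ1, hδ1, h1⟩ := h (N + 1)
    obtain ⟨δ2, hδ2, h2⟩ := ih
    refine ⟨min δ1 δ2, lt_min hδ1 hδ2, fun i hi s hs => ?_⟩
    rcases Nat.lt_or_ge i (N + 1) with h3 | h3
    · exact h2 i (by omega) s ⟨hs.1, hs.2.trans_le (min_le_right _ _)⟩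
    · obtain rfl : i = N + 1 := by omega
      exact h1 s ⟨hs.1, hs.2.trans_le (min_le_left _ _)⟩

/-- derivative estimate with monotone derivative -/
theorem deriv_bound {f f' : ℝ → ℝ} {u v s B : ℝ} (hus : u < s) (hsv : s < v)
    (hd : ∀ r ∈ Icc u v, HasDerivAt f (f' r) r) (hB : ∀ r ∈ Icc u v, |f r| ≤ B)
    (hm : MonotoneOn f' (Icc u v)) (hsg : (∀ r ∈ Icc u v, 0 ≤ f' r) ∨ (∀ r ∈ Icc u v, f' r ≤ 0)) :
    |f' s| ≤ 2 * B / min (s - u) (v - s) := by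
  have hr : 0 < min (s - u) (v - s) := lt_min (by linarith) (by linarith)
  have hBs := abs_le.1 (hB s ⟨hus.le, hsv.le⟩)
  rw [le_div_iff₀ hr]
  rcases hsg with hsg | hsg
  · obtain ⟨ξ, hξ, e⟩ := exists_hasDerivAt_eq_slope f f' hsv
      (fun r hr => (hd r ⟨hus.le.trans hr.1, hr.2⟩).continuousAt.continuousWithinAt)
      (fun r hr => hd r ⟨hus.le.trans hr.1.le, hr.2.le⟩)
    have h1 : f' s ≤ f' ξ := hm ⟨hus.le, hsv.le⟩ ⟨hus.le.trans hξ.1.le, hξ.2.le⟩ hξ.1.le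
    have h0 := hsg s ⟨hus.le, hsv.le⟩
    rw [eq_div_iff (by linarith)] at e
    have hBv := abs_le.1 (hB v ⟨by linarith, le_rfl⟩)
    rw [abs_of_nonneg h0]
    calc f' s * min (s - u) (v - s) ≤ f' ξ * (v - s) :=
          mul_le_mul h1 (min_le_right _ _) hr.le (h0.trans h1)
      _ ≤ 2 * B := by rw [e]; linarith
  · obtain ⟨ξ, hξ, e⟩ := exists_hasDerivAt_eq_slope f f' hus
      (fun r hr => (hd r ⟨hr.1, hr.2.trans hsv.le⟩).continuousAt.continuousWithinAt)
      (fun r hr => hd r ⟨hr.1.le, hr.2.le.trans hsv.le⟩)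
    have h1 : f' ξ ≤ f' s := hm ⟨hξ.1.le, hξ.2.le.trans hsv.le⟩ ⟨hus.le, hsv.le⟩ hξ.2.le
    have h0 := hsg s ⟨hus.le, hsv.le⟩
    rw [eq_div_iff (by linarith)] at e
    have hBv := abs_le.1 (hB u ⟨le_rfl, by linarith⟩)
    rw [abs_of_nonpos h0]
    calc - f' s * min (s - u) (v - s) ≤ - f' ξ * (s - u) :=
          mul_le_mul (by linarith) (min_le_left _ _) hr.le (by linarith)
      _ ≤ 2 * B := by linarith

theorem deriv_bound' {f f' : ℝ → ℝ} {u v s B : ℝ} (hus : u < s) (hsv : s < v)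
    (hd : ∀ r ∈ Icc u v, HasDerivAt f (f' r) r) (hB : ∀ r ∈ Icc u v, |f r| ≤ B)
    (hm : MonotoneOn f' (Icc u v) ∨ AntitoneOn f' (Icc u v))
    (hsg : (∀ r ∈ Icc u v, 0 ≤ f' r) ∨ (∀ r ∈ Icc u v, f' r ≤ 0)) :
    |f' s| ≤ 2 * B / min (s - u) (v - s) := by
  rcases hm with hm | hm
  · exact deriv_bound hus hsv hd hB hm hsg
  · have := deriv_bound (f := fun r => - f r) (f' := fun r => - f' r) hus hsv
      (fun r hr => (hd r hr).neg) (by simpa using hB) hm.neg (hsg.symm.imp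
        (fun h r hr => by linarith [h r hr]) (fun h r hr => by linarith [h r hr]))
    simpa using this

theorem tower_case2 [DM L] (hdec : Decides L) (p : ℕ) {M : ℝ → ℝ} (hMd : DefF L M) (hM : MonotoneOn M (Ioi 0))
    (hpos : ∀ s > 0, 0 < M s) : ∃ b, 0 < b ∧ b ≤ 1 ∧ Tower L p M b := by
  have hMu := hMd.use
  set h : ℝ → ℝ := fun s => (s / 2 ^ p) ^ p * M (s / 2 ^ p) with hh
  have hd : DefF L h := by simp only [hh]; infer_instance
  obtain ⟨δ1, hδ1, k1⟩ := forall_le_delta (P := fun i s => DifferentiableAt ℝ (iteratedDeriv i h) s)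
    (fun i => hdec.diff (hd.iteratedDeriv i)) (p + 2)
  have hsgn : ∀ i, ∃ δ > 0, (∀ s ∈ Ioo 0 δ, 0 ≤ iteratedDeriv i h s) ∨ (∀ s ∈ Ioo 0 δ, iteratedDeriv i h s ≤ 0) := by
    intro i
    have := (hd.iteratedDeriv i).use
    obtain ⟨δ, hδ, k⟩ := hdec {s | 0 ≤ iteratedDeriv i h s} (by simp only [mem_ofPred_eq]; infer_instance)
    refine ⟨δ, hδ, k.imp (fun k => k) (fun k s hs => ?_)⟩
    have := k s hs
    simp only [mem_ofPred_eq, not_le] at this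
    exact this.le
  obtain ⟨δ2, hδ2, k2⟩ := forall_le_delta (P := fun i s => ∀ r ∈ Ioc 0 s, ∀ r' ∈ Ioc 0 s,
    0 ≤ iteratedDeriv i h r * iteratedDeriv i h r') (fun i => by
      obtain ⟨δ, hδ, k⟩ := hsgn i
      refine ⟨δ, hδ, fun s hs r hr r' hr' => ?_⟩
      have e1 : r ∈ Ioo 0 δ := ⟨hr.1, hr.2.trans_lt hs.2⟩
      have e2 : r' ∈ Ioo 0 δ := ⟨hr'.1, hr'.2.trans_lt hs.2⟩
      rcases k with k | k
      · exact mul_nonneg (k r e1) (k r' e2)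
      · exact mul_nonneg_of_nonpos_of_nonpos (k r e1) (k r' e2)) (p + 2)
  set δ := min (min δ1 δ2) 1 with hδ
  have hδ0 : 0 < δ := lt_min (lt_min hδ1 hδ2) one_pos
  have hδa : δ ≤ δ1 := (min_le_left _ _).trans (min_le_left _ _)
  have hδb : δ ≤ δ2 := (min_le_left _ _).trans (min_le_right _ _)
  have hδc : δ ≤ 1 := min_le_right _ _
  have hder : ∀ i ≤ p + 2, ∀ s ∈ Ioo 0 δ, HasDerivAt (iteratedDeriv i h) (iteratedDeriv (i + 1) h s) s := by
    intro i hi s hs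
    rw [iteratedDeriv_succ]
    exact (k1 i hi s ⟨hs.1, hs.2.trans_le hδa⟩).hasDerivAt
  have hsg : ∀ i ≤ p + 2, ∀ u v, 0 < u → v < δ → (∀ r ∈ Icc u v, 0 ≤ iteratedDeriv i h r) ∨
      (∀ r ∈ Icc u v, iteratedDeriv i h r ≤ 0) := by
    intro i hi u v hu hv
    by_contra hcon
    push Not at hcon
    obtain ⟨⟨r, hr, e⟩, r', hr', e'⟩ := hcon
    have := k2 i hi v ⟨by linarith [hr.1, hr.2], by linarith⟩ r ⟨hu.trans_le hr.1, hr.2⟩ r' ⟨hu.trans_le hr'.1, hr'.2⟩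
    nlinarith
  have hmono : ∀ s s', 0 < s → s ≤ s' → h s ≤ h s' := by
    intro s s' hs hss
    simp only [hh]
    have e1 : 0 < s / 2 ^ p := by positivity
    have e2 : s / 2 ^ p ≤ s' / 2 ^ p := by gcongr
    have e3 : M (s / 2 ^ p) ≤ M (s' / 2 ^ p) := hM e1 (e1.trans_le e2) e2
    have := hpos _ e1
    have : 0 < s' / 2 ^ p := e1.trans_le e2
    gcongr
  have hhpos : ∀ s > 0, 0 < h s := fun s hs => by
    have := hpos (s / 2 ^ p) (by positivity)
    simp only [hh]; positivity
  have main : ∀ i ≤ p, ∃ C > 0, ∀ s ∈ Ioo 0 (δ / 2 ^ i), |iteratedDeriv i h s| * s ^ i ≤ C * h (2 ^ i * s) := by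
    intro i
    induction i with
    | zero =>
      intro _
      refine ⟨1, one_pos, fun s hs => ?_⟩
      simp [abs_of_pos (hhpos s hs.1)]
    | succ i ih =>
      intro hi
      obtain ⟨C, hC, k⟩ := ih (by omega)
      refine ⟨4 * 2 ^ i * C, by positivity, fun s hs => ?_⟩
      have s0 := hs.1
      have s1 : 2 ^ i * (2 * s) < δ := by
        have := hs.2
        rw [lt_div_iff₀ (by positivity), pow_succ] at this
        linarith
      have s2 : 2 * s < δ / 2 ^ i := by
        rw [lt_div_iff₀ (by positivity)]; linarith
      have s3 : 2 * s < δ := s2.trans_le (div_le_self hδ0.le (one_le_pow₀ (by norm_num)))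
      have hI : ∀ r ∈ Icc (s / 2) (2 * s), r ∈ Ioo 0 δ := fun r hr =>
        ⟨by linarith [hr.1], by linarith [hr.2]⟩
      have hB : ∀ r ∈ Icc (s / 2) (2 * s), |iteratedDeriv i h r| ≤ C * h (2 ^ i * (2 * s)) / (s / 2) ^ i := by
        intro r hr
        have r0 : 0 < r := by linarith [hr.1]
        rw [le_div_iff₀ (by positivity)]
        calc |iteratedDeriv i h r| * (s / 2) ^ i ≤ |iteratedDeriv i h r| * r ^ i := by
              gcongr; exact hr.1
          _ ≤ C * h (2 ^ i * r) := k r ⟨r0, hr.2.trans_lt s2⟩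
          _ ≤ C * h (2 ^ i * (2 * s)) := by
              apply mul_le_mul_of_nonneg_left _ hC.le
              apply hmono _ _ (by positivity)
              gcongr; exact hr.2
      have hmon : MonotoneOn (iteratedDeriv (i + 1) h) (Icc (s / 2) (2 * s)) ∨
          AntitoneOn (iteratedDeriv (i + 1) h) (Icc (s / 2) (2 * s)) := by
        have hcont : ContinuousOn (iteratedDeriv (i + 1) h) (Icc (s / 2) (2 * s)) := fun r hr =>
          (hder (i + 1) (by omega) r (hI r hr)).continuousAt.continuousWithinAt
        have e : ∀ r ∈ Icc (s / 2) (2 * s), deriv (iteratedDeriv (i + 1) h) r = iteratedDeriv (i + 2) h r :=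
          fun r hr => (hder (i + 1) (by omega) r (hI r hr)).deriv
        have df : DifferentiableOn ℝ (iteratedDeriv (i + 1) h) (interior (Icc (s / 2) (2 * s))) := fun r hr =>
          (hder (i + 1) (by omega) r (hI r (interior_subset hr))).differentiableAt.differentiableWithinAt
        rcases hsg (i + 2) (by omega) (s / 2) (2 * s) (by positivity) s3 with h1 | h1
        · exact Or.inl (monotoneOn_of_deriv_nonneg (convex_Icc _ _) hcont df fun r hr => by
            rw [e r (interior_subset hr)]; exact h1 r (interior_subset hr))
        · exact Or.inr (antitoneOn_of_deriv_nonpos (convex_Icc _ _) hcont df fun r hr => by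
            rw [e r (interior_subset hr)]; exact h1 r (interior_subset hr))
      have := deriv_bound' (s := s) (by linarith : s / 2 < s) (by linarith : s < 2 * s)
        (fun r hr => hder i (by omega) r (hI r hr)) hB hmon (hsg (i + 1) (by omega) _ _ (by positivity) s3)
      have hmin : min (s - s / 2) (2 * s - s) = s / 2 := by
        rw [min_eq_left] <;> linarith
      rw [hmin] at this
      have e2 : (2:ℝ) ^ (i + 1) * s = 2 ^ i * (2 * s) := by ring
      rw [e2]
      calc |iteratedDeriv (i + 1) h s| * s ^ (i + 1) ≤
          2 * (C * h (2 ^ i * (2 * s)) / (s / 2) ^ i) / (s / 2) * s ^ (i + 1) := by gcongr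
        _ = 4 * 2 ^ i * C * h (2 ^ i * (2 * s)) := by
          rw [div_pow]; field_simp; ring
  choose! C hC hCb using main
  set K := 1 + ∑ i ∈ Finset.range (p + 1), C i with hK
  have hsn : ∀ i ∈ Finset.range (p + 1), 0 ≤ C i := fun i hi => (hC i (by simp at hi; omega)).le
  have hKpos : 0 < K := by
    have := Finset.sum_nonneg hsn
    linarith
  have hCK : ∀ i ≤ p, C i ≤ K := fun i hi => by
    have := Finset.single_le_sum (f := C) hsn (Finset.mem_range.2 (by omega : i < p + 1))
    linarith
  have hbd : δ / 2 ^ p ≤ δ := div_le_self hδ0.le (one_le_pow₀ (by norm_num))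
  refine ⟨δ / 2 ^ p, by positivity, hbd.trans hδc, fun i s => K⁻¹ * iteratedDeriv i h s, ?_, ?_, ?_⟩
  · have := hd.use
    simp only [iteratedDeriv_zero]; infer_instance
  · intro s hs
    have := hhpos s hs.1
    simp only [iteratedDeriv_zero]; positivity
  · intro i hi s hs
    have s0 := hs.1
    have s1 : s < δ := hs.2.trans_le hbd
    refine ⟨(hder i (by omega) s ⟨hs.1, s1⟩).const_mul _, ?_⟩
    have hle : (2:ℝ) ^ i ≤ 2 ^ p := pow_le_pow_right₀ (by norm_num) hi
    have h1 := hCb i hi s ⟨hs.1, hs.2.trans_le (by gcongr)⟩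
    have h2 : h (2 ^ i * s) ≤ s ^ p * M s := by
      have := hmono (2 ^ i * s) (2 ^ p * s) (by positivity) (by gcongr)
      refine this.trans (le_of_eq ?_)
      simp only [hh]
      rw [mul_div_cancel_left₀ _ (by positivity)]
    have h3 : s ^ p ≤ s ^ i := pow_le_pow_of_le_one s0.le (by linarith) hi
    have hMs := hpos s s0
    have h4 : |iteratedDeriv i h s| * s ^ i ≤ (K * M s) * s ^ i := by
      calc _ ≤ C i * h (2 ^ i * s) := h1
        _ ≤ K * (s ^ p * M s) := by
          apply mul_le_mul (hCK i hi) h2 (hhpos _ (by positivity)).le hKpos.le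
        _ ≤ K * (s ^ i * M s) := by gcongr
        _ = _ := by ring
    have h5 := le_of_mul_le_mul_right h4 (by positivity)
    rw [abs_mul, abs_of_pos (inv_pos.2 hKpos), inv_mul_le_iff₀ hKpos]
    exact h5

theorem tameR [DM L] : Tame L ℝ := by
  intro A hA hint
  unfold IsNowhereDense
  by_contra hne
  obtain ⟨x, hx, _⟩ := dmin_dense hA isOpen_interior (nonempty_iff_ne_empty.2 hne) interior_subset
  rw [hint] at hx
  exact hx

theorem frontier_nd [DM L] {A : Set ℝ} (hA : Def L (fun x => x ∈ A)) : IsNowhereDense (frontier A) := by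
  have hc : Def L (fun x => x ∈ Aᶜ) := by
    have := hA.useS
    simp only [mem_compl_iff]; infer_instance
  have key : ∀ B : Set ℝ, Def L (fun x => x ∈ B) → IsNowhereDense (B \ interior B) := by
    intro B hB
    apply tameR _ hB.interiorCompl
    rw [eq_empty_iff_forall_notMem]
    intro x hx
    have h1 : interior (B \ interior B) ⊆ interior B := interior_mono sdiff_subset
    exact (interior_subset hx).2 (h1 hx)
  refine (nowhereDense_union (key A hA) (key Aᶜ hc)).mono ?_
  intro x hx
  by_cases h : x ∈ A
  · exact Or.inl ⟨h, hx.2⟩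
  · right
    refine ⟨h, ?_⟩
    rw [interior_compl]
    exact fun h' => h' hx.1

theorem str [DM L] (p : ℕ) {M : ℝ → ℝ} (hMd : DefF L M) (hM : MonotoneOn M (Ioi 0))
    (hpos : ∀ s > 0, 0 < M s) : Tower L p M 2 := by
  obtain ⟨b, hb, hb1, h⟩ : ∃ b, 0 < b ∧ b ≤ 1 ∧ Tower L p M b := by
    by_cases hdec : Decides L
    · exact tower_case2 hdec p hMd hM hpos
    · unfold Decides at hdec
      push Not at hdec
      obtain ⟨A, hA, h⟩ := hdec
      have hfd : Def L (fun x => x ∈ frontier A) := by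
        have h1 := hA.closure
        have h2 := hA.interior
        refine def_congr (P := fun x => x ∈ closure A ∧ ¬ x ∈ interior A) inferInstance fun x => Iff.rfl
      have hnd := frontier_nd hA
      have hint : interior (frontier A) = ∅ := by
        rw [IsNowhereDense, isClosed_frontier.closure_eq] at hnd
        exact hnd
      refine tower_case1 p hMd hM hpos hfd isClosed_frontier (dmin_countable hfd hint) fun δ hδ => ?_
      by_contra hcon
      push Not at hcon
      obtain ⟨⟨x, hx, hxA⟩, y, hy, hyA⟩ := h δ hδ
      have nof : ∀ z ∈ Ioo 0 δ, z ∉ frontier A := fun z hz hzf => absurd hz.2 (not_lt.2 (hcon z hzf hz.1))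
      have cov : ∀ z ∈ Ioo 0 δ, z ∈ interior A ∨ z ∈ (closure A)ᶜ := fun z hz => by
        by_contra hh
        push Not at hh
        exact nof z hz ⟨not_not.1 hh.2, hh.1⟩
      obtain ⟨z, hz, hz1, hz2⟩ := isPreconnected_Ioo (a := (0:ℝ)) (b := δ) (interior A) (closure A)ᶜ
        isOpen_interior isClosed_closure.isOpen_compl cov
        ⟨y, hy, (cov y hy).resolve_right fun h => h (subset_closure hyA)⟩
        ⟨x, hx, (cov x hx).resolve_left fun h => hxA (interior_subset h)⟩
      exact hz2 (subset_closure (interior_subset hz1))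
  exact h.scale hM hb hb1

end PartD


section PartE
set_option linter.unusedSectionVars false
variable {L}
variable {ι : Type} [Fintype ι]

theorem hasDerivAt_maxpow (m : ℕ) (r : ℝ) :
    HasDerivAt (fun r : ℝ => (max r 0) ^ (m + 2)) ((m + 2) * (max r 0) ^ (m + 1)) r := by
  rcases lt_trichotomy r 0 with h | h | h
  · have h1 : (fun r : ℝ => (max r 0) ^ (m + 2)) =ᶠ[𝓝 r] fun _ => 0 := by
      filter_upwards [gt_mem_nhds h] with y hy
      rw [max_eq_right hy.le, zero_pow (by omega)]
    rw [max_eq_right h.le, zero_pow (by omega), mul_zero]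
    exact (hasDerivAt_const r (0:ℝ)).congr_of_eventuallyEq h1
  · subst h
    rw [max_self, zero_pow (by omega), mul_zero, hasDerivAt_fo]
    intro η hη
    refine ⟨min η 1, lt_min hη one_pos, fun y hy => ?_⟩
    simp only [sub_zero, mul_zero, max_self, ne_eq] at hy ⊢
    rw [zero_pow (by omega), sub_zero, abs_pow]
    have h1 : |max y 0| ≤ |y| := by
      rcases le_total y 0 with h | h
      · simp [max_eq_right h]
      · simp [max_eq_left h]
    have y1 := hy.trans_le (min_le_left _ _)
    have y2 := hy.trans_le (min_le_right _ _)
    calc |max y 0| ^ (m + 2) ≤ |y| ^ (m + 2) := by gcongr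
      _ ≤ |y| ^ 2 := pow_le_pow_of_le_one (abs_nonneg _) y2.le (by omega)
      _ ≤ η * |y| := by nlinarith [abs_nonneg y]
  · have h1 : (fun r : ℝ => (max r 0) ^ (m + 2)) =ᶠ[𝓝 r] fun r => r ^ (m + 2) := by
      filter_upwards [lt_mem_nhds h] with y hy
      rw [max_eq_left hy.le]
    have h2 := hasDerivAt_pow (m + 2) r
    rw [max_eq_left h.le]
    refine (h2.congr_of_eventuallyEq h1).congr_deriv ?_
    push_cast
    rfl

theorem contDiff_maxpow (m : ℕ) : ContDiff ℝ m (fun r : ℝ => (max r 0) ^ (m + 1)) := by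
  induction m with
  | zero =>
    rw [Nat.cast_zero, contDiff_zero]; fun_prop
  | succ m ih =>
    push_cast
    rw [contDiff_succ_iff_deriv]
    refine ⟨fun r => (hasDerivAt_maxpow m r).differentiableAt, by simp, ?_⟩
    have : deriv (fun r : ℝ => (max r 0) ^ (m + 1 + 1)) = fun r : ℝ => ((m:ℝ) + 2) * (max r 0) ^ (m + 1) :=
      funext fun r => (hasDerivAt_maxpow m r).deriv
    rw [this]
    exact contDiff_const.mul ih

theorem tower_contDiff {G : ℕ → ℝ → ℝ} {p : ℕ} {U : Set ℝ} (hU : IsOpen U)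
    (h : ∀ i ≤ p, ∀ s ∈ U, HasDerivAt (G i) (G (i + 1) s) s) (m : ℕ) :
    ∀ i, i + m ≤ p → ContDiffOn ℝ m (G i) U := by
  induction m with
  | zero =>
    intro i hi
    rw [Nat.cast_zero, contDiffOn_zero]
    exact fun s hs => (h i (by omega) s hs).continuousAt.continuousWithinAt
  | succ m ih =>
    intro i hi
    push_cast
    rw [contDiffOn_succ_iff_deriv_of_isOpen hU]
    refine ⟨fun s hs => (h i (by omega) s hs).differentiableAt.differentiableWithinAt, by simp, ?_⟩
    exact (ih (i + 1) (by omega)).congr fun s hs => (h i (by omega) s hs).deriv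

def PZ (L : FirstOrder.Language) [L.Structure ℝ] (p : ℕ) (Z : Set (ι → ℝ)) : Prop :=
  ∃ g : (ι → ℝ) → ℝ, DefF L g ∧ (∀ x, x ∉ Z → ContDiffAt ℝ p g x) ∧
    (∀ x, x ∉ Z → 0 < g x ∧ g x ≤ 1) ∧ ∀ s > 0, IsCompact {x | x ∉ Z ∧ s ≤ g x}

theorem isOpen_contDiffAt (p : ℕ) (t : (ι → ℝ) → ℝ) : IsOpen {x | ContDiffAt ℝ p t x} := by
  rw [isOpen_iff_mem_nhds]
  intro x hx
  exact ContDiffAt.eventually hx (by simp)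

theorem PZ_empty [DM L] (p : ℕ) : PZ L p (∅ : Set (ι → ℝ)) := by
  have hpos : ∀ x : ι → ℝ, 0 < 1 + ∑ i, x i ^ 2 := fun x => by
    have : 0 ≤ ∑ i, x i ^ 2 := Finset.sum_nonneg fun i _ => sq_nonneg _
    linarith
  have hcd : ContDiff ℝ p (fun x : ι → ℝ => (1 + ∑ i, x i ^ 2)⁻¹) :=
    ContDiff.inv (by fun_prop) fun x => (hpos x).ne'
  refine ⟨fun x => (1 + ∑ i, x i ^ 2)⁻¹, inferInstance, fun x _ => hcd.contDiffAt,
    fun x _ => ⟨inv_pos.2 (hpos x), inv_le_one_of_one_le₀ ?_⟩, fun s hs => ?_⟩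
  · have : 0 ≤ ∑ i, x i ^ 2 := Finset.sum_nonneg fun i _ => sq_nonneg _
    linarith
  · apply Metric.isCompact_of_isClosed_isBounded
    · have : {x : ι → ℝ | x ∉ (∅ : Set (ι → ℝ)) ∧ s ≤ (1 + ∑ i, x i ^ 2)⁻¹} = {x | s ≤ (1 + ∑ i, x i ^ 2)⁻¹} := by
        ext x; simp
      rw [this]
      exact isClosed_le continuous_const hcd.continuous
    · rw [isBounded_iff_forall_norm_le]
      refine ⟨s⁻¹, fun x hx => ?_⟩
      have h1 : 1 + ∑ i, x i ^ 2 ≤ s⁻¹ := by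
        rw [le_inv_comm₀ (hpos x) hs]; exact hx.2
      rw [pi_norm_le_iff_of_nonneg (by positivity)]
      intro i
      have h2 : x i ^ 2 ≤ ∑ i, x i ^ 2 := Finset.single_le_sum (f := fun i => x i ^ 2) (fun i _ => sq_nonneg _) (Finset.mem_univ i)
      rw [Real.norm_eq_abs, abs_le]
      constructor <;> nlinarith [sq_nonneg (x i - 1), sq_nonneg (x i + 1)]

theorem PZ_step [DM L] (p : ℕ) {Z Z' : Set (ι → ℝ)} {t : (ι → ℝ) → ℝ} (ht : DefF L t)
    (hZ' : Def L (fun x => x ∈ Z'))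
    (hsub : Z' ⊆ Z) (hZ0 : ∀ x ∈ Z, t x = 0) (ht0 : ∀ x, 0 ≤ t x)
    (hH : ∀ x, x ∉ Z → ∃ δ > 0, ∃ c > 0, ∀ y, dist y x < δ → c ≤ t y)
    (hgood : ∀ x ∈ Z, x ∉ Z' → ContDiffAt ℝ p t x) (h : PZ L p Z') : PZ L p Z := by
  obtain ⟨g, hg, hgc, hgb, hgK⟩ := h
  have htu := ht.use
  have hgu := hg.use
  have hZu := hZ'.useS
  have hOd := (Def.contDiffAt p ht).use
  set O := {x | ContDiffAt ℝ p t x} with hO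
  have hOo : IsOpen O := isOpen_contDiffAt p t
  let Q : ℝ → ℝ → Prop := fun s v => (0 ≤ v ∧ v ≤ 1) ∧ ∀ x, x ∉ Z' → ¬ ContDiffAt ℝ p t x → s ≤ g x →
    ∃ δ : ℝ, 0 < δ ∧ ∀ y, dist y x < δ → v ≤ t y
  have hQ : Def L (fun q : ℝ × ℝ => Q q.1 q.2) := by
    simp only [Q]; infer_instance
  set M : ℝ → ℝ := fun s => sSup {v | Q s v} with hMdef
  have hMd : DefF L M := DefF.sSup hQ
  have hbdd : ∀ s, BddAbove {v | Q s v} := fun s => ⟨1, fun v hv => hv.1.2⟩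
  have hne : ∀ s, {v | Q s v}.Nonempty := fun s => ⟨0, ⟨le_rfl, zero_le_one⟩, fun x _ _ _ =>
    ⟨1, one_pos, fun y _ => ht0 y⟩⟩
  have hMpos : ∀ s > 0, 0 < M s := by
    intro s hs
    have hK : IsCompact ({x | x ∉ Z' ∧ s ≤ g x} ∩ Oᶜ) := (hgK s hs).inter_right hOo.isClosed_compl
    have : ∃ v, 0 < v ∧ v ≤ 1 ∧ ∀ x ∈ {x | x ∉ Z' ∧ s ≤ g x} ∩ Oᶜ, ∃ δ > 0, ∀ y, dist y x < δ → v ≤ t y := by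
      refine hK.induction_on (p := fun A => ∃ v : ℝ, 0 < v ∧ v ≤ 1 ∧ ∀ x ∈ A, ∃ δ > 0, ∀ y, dist y x < δ → v ≤ t y)
        ⟨1, one_pos, le_rfl, by simp⟩ ?_ ?_ ?_
      · rintro A B hAB ⟨v, h1, h2, h3⟩
        exact ⟨v, h1, h2, fun x hx => h3 x (hAB hx)⟩
      · rintro A B ⟨v, h1, h2, h3⟩ ⟨w, k1, k2, k3⟩
        refine ⟨min v w, lt_min h1 k1, (min_le_left _ _).trans h2, ?_⟩
        rintro x (hx | hx)
        · obtain ⟨δ, hδ, h⟩ := h3 x hx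
          exact ⟨δ, hδ, fun y hy => (min_le_left _ _).trans (h y hy)⟩
        · obtain ⟨δ, hδ, h⟩ := k3 x hx
          exact ⟨δ, hδ, fun y hy => (min_le_right _ _).trans (h y hy)⟩
      · rintro x ⟨⟨hx1, hx2⟩, hx3⟩
        have hxZ : x ∉ Z := fun hxZ => hx3 (hgood x hxZ hx1)
        obtain ⟨δ, hδ, c, hc, h⟩ := hH x hxZ
        refine ⟨Metric.ball x (δ / 2), mem_nhdsWithin_of_mem_nhds (Metric.ball_mem_nhds x (by linarith)),
          min c 1, lt_min hc one_pos, min_le_right _ _, fun z hz => ⟨δ / 2, by linarith, fun y hy => ?_⟩⟩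
        refine (min_le_left _ _).trans (h y ?_)
        rw [Metric.mem_ball] at hz
        linarith [dist_triangle y z x]
    obtain ⟨v, hv, hv1, h⟩ := this
    refine hv.trans_le (le_csSup (hbdd s) ⟨⟨hv.le, hv1⟩, fun x h1 h2 h3 => ?_⟩)
    obtain ⟨δ, hδ, k⟩ := h x ⟨⟨h1, h3⟩, h2⟩
    exact ⟨δ, hδ, k⟩
  have hMm : MonotoneOn M (Ioi 0) := by
    intro s _ s' _ hss
    refine csSup_le_csSup (hbdd s') (hne s) ?_
    rintro v ⟨h1, h2⟩
    exact ⟨h1, fun x k1 k2 k3 => h2 x k1 k2 (hss.trans k3)⟩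
  obtain ⟨G, hGd, hGpos, hG⟩ := str p hMd hMm hMpos
  set ρ : ℝ → ℝ := fun s => G 0 s / 2 with hρ
  have hρcd : ∀ s ∈ Ioo (0:ℝ) 2, ContDiffAt ℝ p ρ s := fun s hs =>
    (((tower_contDiff isOpen_Ioo (fun i hi s hs => (hG i hi s hs).1) p 0 (by omega)).contDiffAt
      (isOpen_Ioo.mem_nhds hs))).div_const _
  have hρM : ∀ s ∈ Ioo (0:ℝ) 2, 0 < ρ s ∧ ρ s ≤ M s / 2 := fun s hs => by
    have h1 := hGpos s hs
    have h2 := (abs_le.1 (hG 0 (by omega) s hs).2).2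
    simp only [hρ]
    constructor <;> linarith
  have hgI : ∀ x, x ∉ Z' → g x ∈ Ioo (0:ℝ) 2 := fun x hx =>
    ⟨(hgb x hx).1, by linarith [(hgb x hx).2]⟩
  have hρg : ∀ x, x ∉ Z' → ContDiffAt ℝ p (fun y => ρ (g y)) x := fun x hx =>
    (hρcd _ (hgI x hx)).comp x (hgc x hx)
  set f1 : (ι → ℝ) → ℝ := fun x => 1 - (max (1 - t x / ρ (g x)) 0) ^ (p + 1) with hf1
  have hf1c : ∀ x, x ∉ Z' → ContDiffAt ℝ p f1 x := by
    intro x hx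
    by_cases hxO : x ∈ O
    · have h1 : ContDiffAt ℝ p (fun y => 1 - t y / ρ (g y)) x :=
        contDiffAt_const.sub (ContDiffAt.div hxO (hρg x hx) (hρM _ (hgI x hx)).1.ne')
      exact contDiffAt_const.sub ((contDiff_maxpow p).contDiffAt.comp x h1)
    · have hMx := hMpos _ (hgI x hx).1
      have hlt : 2 / 3 * M (g x) < M (g x) := by linarith
      obtain ⟨v, hv, hv'⟩ := exists_lt_of_lt_csSup (hne (g x)) hlt
      obtain ⟨δ, hδ, k⟩ := hv.2 x hx hxO le_rfl
      have hev : ∀ᶠ y in 𝓝 x, ρ (g y) < 2 / 3 * M (g x) :=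
        (hρg x hx).continuousAt.eventually (gt_mem_nhds (by
          have := (hρM _ (hgI x hx)).2; linarith))
      have hev2 : ∀ᶠ y in 𝓝 x, 0 < ρ (g y) :=
        (hρg x hx).continuousAt.eventually (lt_mem_nhds (hρM _ (hgI x hx)).1)
      refine (contDiffAt_const (c := (1:ℝ))).congr_of_eventuallyEq ?_
      filter_upwards [hev, hev2, Metric.ball_mem_nhds x hδ] with y h1 h2 h3
      have h4 := k y h3
      have h5 : 1 ≤ t y / ρ (g y) := by rw [le_div_iff₀ h2]; linarith
      simp only [hf1]
      rw [max_eq_right (by linarith), zero_pow (by omega), sub_zero]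
  have hmaxle : ∀ x, x ∉ Z' → max (1 - t x / ρ (g x)) 0 ≤ 1 := fun x hx => by
    have := div_nonneg (ht0 x) (hρM _ (hgI x hx)).1.le
    exact max_le (by linarith) zero_le_one
  have hf1b : ∀ x, x ∉ Z' → 0 ≤ f1 x ∧ f1 x ≤ 1 := fun x hx => by
    have h1 := hmaxle x hx
    have h2 : 0 ≤ max (1 - t x / ρ (g x)) 0 := le_max_right _ _
    have h3 := pow_le_one₀ (n := p + 1) h2 h1
    have h4 := pow_nonneg h2 (p + 1)
    simp only [hf1]
    constructor <;> linarith
  have hf1p : ∀ x, x ∉ Z → 0 < f1 x := fun x hx => by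
    have hx' : x ∉ Z' := fun h => hx (hsub h)
    obtain ⟨δ, hδ, c, hc, k⟩ := hH x hx
    have h0 : 0 < t x := hc.trans_le (k x (by simpa using hδ))
    have h1 := div_pos h0 (hρM _ (hgI x hx')).1
    have h2 : 0 ≤ max (1 - t x / ρ (g x)) 0 := le_max_right _ _
    have h3 : max (1 - t x / ρ (g x)) 0 < 1 := max_lt (by linarith) zero_lt_one
    have h4 := pow_lt_one₀ h2 h3 (by omega : p + 1 ≠ 0)
    simp only [hf1]; linarith
  have hf10 : ∀ x ∈ Z, f1 x = 0 := fun x hx => by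
    simp [hf1, hZ0 x hx]
  refine ⟨fun x => g x * f1 x, ?_, ?_, ?_, ?_⟩
  · have := hGd.use
    simp only [hf1, hρ]
    infer_instance
  · intro x hx
    have hx' : x ∉ Z' := fun h => hx (hsub h)
    exact (hgc x hx').mul (hf1c x hx')
  · intro x hx
    have hx' : x ∉ Z' := fun h => hx (hsub h)
    exact ⟨mul_pos (hgb x hx').1 (hf1p x hx), mul_le_one₀ (hgb x hx').2 (hf1b x hx').1 (hf1b x hx').2⟩
  · intro s hs
    have heq : {x | x ∉ Z ∧ s ≤ g x * f1 x} = {x | x ∉ Z' ∧ s ≤ g x} ∩ {x | s ≤ g x * f1 x} := by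
      ext x
      constructor
      · rintro ⟨h1, h2⟩
        have hx' : x ∉ Z' := fun h => h1 (hsub h)
        refine ⟨⟨hx', h2.trans (mul_le_of_le_one_right (hgb x hx').1.le (hf1b x hx').2)⟩, h2⟩
      · rintro ⟨⟨h1, h2⟩, h3⟩
        refine ⟨fun hx => ?_, h3⟩
        simp only [mem_ofPred_eq, hf10 x hx, mul_zero] at h3
        linarith
    rw [heq]
    have hK := hgK s hs
    have hcont : ContinuousOn (fun x => g x * f1 x) {x | x ∉ Z' ∧ s ≤ g x} := fun x hx =>
      ((hgc x hx.1).continuousAt.mul (hf1c x hx.1).continuousAt).continuousWithinAt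
    exact hK.of_isClosed_subset (hcont.preimage_isClosed_of_isClosed hK.isClosed isClosed_Ici) inter_subset_left

end PartE


section PartE2
set_option linter.unusedSectionVars false
variable {L}
variable {ι : Type} [Fintype ι]

def rS (S : Finset ι) (z : ι → ℝ) : S → ℝ := fun i => z i

def tS (S : Finset ι) (Z : Set (ι → ℝ)) (y : ι → ℝ) : ℝ :=
  sInf {v | v = 1 ∨ ∃ z, z ∈ Z ∧ rS S z = rS S y ∧ v = ∑ i, (y i - z i) ^ 2}

theorem defF_rS [OF L] (S : Finset ι) : DefF L (rS S) :=
  DefF.pi (f := fun (z : ι → ℝ) (i : S) => z i) (h := fun i => inferInstance)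

theorem defF_tS [OF L] (S : Finset ι) {Z : Set (ι → ℝ)} (hZ : Def L (fun x => x ∈ Z)) :
    DefF L (tS S Z) := by
  have := hZ.useS
  have hru := (defF_rS (L := L) S).use
  have h1 : Def L (fun q : ((ι → ℝ) × ℝ) × (ι → ℝ) => q.1.2 = ∑ i, (q.1.1 i - q.2 i) ^ 2) := inferInstance
  have h2 : Def L (fun q : ((ι → ℝ) × ℝ) × (ι → ℝ) => rS S q.2 = rS S q.1.1) := inferInstance
  apply DefF.sInf (A := fun (y : ι → ℝ) v => v = 1 ∨ ∃ z, z ∈ Z ∧ rS S z = rS S y ∧ v = ∑ i, (y i - z i) ^ 2)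
  infer_instance

theorem continuous_rS (S : Finset ι) : Continuous (rS S) := by
  unfold rS; fun_prop

theorem sumsq_nonneg (y z : ι → ℝ) : 0 ≤ ∑ i, (y i - z i) ^ 2 :=
  Finset.sum_nonneg fun i _ => sq_nonneg _

theorem sumsq_ge (y z : ι → ℝ) {r : ℝ} (hr : 0 < r) (h : r ≤ dist y z) : r ^ 2 ≤ ∑ i, (y i - z i) ^ 2 := by
  by_contra hcon
  push Not at hcon
  have : dist y z < r := by
    rw [dist_pi_lt_iff hr]
    intro i
    have h2 : (y i - z i) ^ 2 ≤ ∑ i, (y i - z i) ^ 2 :=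
      Finset.single_le_sum (f := fun i => (y i - z i) ^ 2) (fun i _ => sq_nonneg _) (Finset.mem_univ i)
    rw [Real.dist_eq]
    exact abs_lt_of_sq_lt_sq (by linarith) hr.le
  linarith

theorem tS_set_nonneg (S : Finset ι) (Z : Set (ι → ℝ)) (y : ι → ℝ) :
    ∀ v ∈ {v | v = 1 ∨ ∃ z, z ∈ Z ∧ rS S z = rS S y ∧ v = ∑ i, (y i - z i) ^ 2}, 0 ≤ v := by
  rintro v (rfl | ⟨z, -, -, rfl⟩)
  · exact zero_le_one
  · exact sumsq_nonneg _ _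

theorem tS_nonneg (S : Finset ι) (Z : Set (ι → ℝ)) (y : ι → ℝ) : 0 ≤ tS S Z y :=
  Real.sInf_nonneg (tS_set_nonneg S Z y)

theorem tS_le (S : Finset ι) {Z : Set (ι → ℝ)} {y z : ι → ℝ} (hz : z ∈ Z) (h : rS S z = rS S y) :
    tS S Z y ≤ ∑ i, (y i - z i) ^ 2 :=
  csInf_le ⟨0, tS_set_nonneg S Z y⟩ (Or.inr ⟨z, hz, h, rfl⟩)

theorem le_tS (S : Finset ι) {Z : Set (ι → ℝ)} {y : ι → ℝ} {c : ℝ} (hc : c ≤ 1)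
    (h : ∀ z ∈ Z, rS S z = rS S y → c ≤ ∑ i, (y i - z i) ^ 2) : c ≤ tS S Z y := by
  refine le_csInf ⟨1, Or.inl rfl⟩ ?_
  rintro v (rfl | ⟨z, hz, h1, rfl⟩)
  · exact hc
  · exact h z hz h1

theorem tS_zero (S : Finset ι) {Z : Set (ι → ℝ)} {x : ι → ℝ} (hx : x ∈ Z) : tS S Z x = 0 := by
  refine le_antisymm ((tS_le S hx rfl).trans ?_) (tS_nonneg S Z x)
  simp

theorem tS_H (S : Finset ι) {Z : Set (ι → ℝ)} (hZ : IsClosed Z) {x : ι → ℝ} (hx : x ∉ Z) :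
    ∃ δ > 0, ∃ c > 0, ∀ y, dist y x < δ → c ≤ tS S Z y := by
  obtain ⟨ε, hε, hb⟩ := Metric.isOpen_iff.1 hZ.isOpen_compl x hx
  refine ⟨ε / 2, by positivity, min 1 ((ε / 2) ^ 2), by positivity, fun y hy => ?_⟩
  refine le_tS S (min_le_left _ _) fun z hz _ => (min_le_right _ _).trans ?_
  refine sumsq_ge y z (by positivity) ?_
  by_contra hcon
  push Not at hcon
  refine hb (?_ : z ∈ Metric.ball x ε) hz
  rw [Metric.mem_ball]
  have := dist_triangle z y x
  rw [dist_comm z y] at this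
  linarith

def stepS (p : ℕ) (S : Finset ι) (Z : Set (ι → ℝ)) : Set (ι → ℝ) := {x | x ∈ Z ∧ ¬ ContDiffAt ℝ p (tS S Z) x}

theorem stepS_sub (p : ℕ) (S : Finset ι) (Z : Set (ι → ℝ)) : stepS p S Z ⊆ Z := fun _ h => h.1

theorem stepS_closed (p : ℕ) (S : Finset ι) {Z : Set (ι → ℝ)} (hZ : IsClosed Z) : IsClosed (stepS p S Z) :=
  hZ.inter (isOpen_contDiffAt p (tS S Z)).isClosed_compl

theorem stepS_def [OF L] (p : ℕ) (S : Finset ι) {Z : Set (ι → ℝ)} (hZ : Def L (fun x => x ∈ Z)) :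
    Def L (fun x => x ∈ stepS p S Z) := by
  have h1 := hZ.useS
  have h2 := (Def.contDiffAt p (defF_tS S hZ)).use
  simp only [stepS, mem_ofPred_eq]
  infer_instance

theorem PZ_stepS [DM L] (p : ℕ) (S : Finset ι) {Z : Set (ι → ℝ)} (hc : IsClosed Z)
    (hZ : Def L (fun x => x ∈ Z)) (h : PZ L p (stepS p S Z)) : PZ L p Z := by
  refine PZ_step p (defF_tS S hZ) (stepS_def p S hZ) (stepS_sub p S Z) (fun x hx => tS_zero S hx)
    (tS_nonneg S Z) (fun x hx => tS_H S hc hx) (fun x hx hx' => ?_) h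
  by_contra hcon
  exact hx' ⟨hx, hcon⟩

theorem gen_iso [DM L] (p : ℕ) (S : Finset ι) {Z : Set (ι → ℝ)} (hZ : Def L (fun x => x ∈ Z)) :
    ∀ᶠ x in residual (S → ℝ), ∀ z ∈ Z, rS S z = x →
      (∃ r > 0, ∀ z' ∈ Z, rS S z' = x → dist z' z < r → z' = z) → ContDiffAt ℝ p (tS S Z) z := by
  have hZu := hZ.useS
  have hru := (defF_rS (L := L) S).use
  have hcu := (Def.contDiffAt p (defF_tS S hZ)).use
  let X : (ι → ℝ) → ℝ → Set (S → ℝ) := fun a e => {x | ∃ z, z ∈ Z ∧ dist z a < e ∧ rS S z = x ∧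
    ¬ ContDiffAt ℝ p (tS S Z) z ∧ ∀ z', z' ∈ Z → dist z' a < e → rS S z' = x → z' = z}
  have hXd : ∀ a e, Def L (fun x => x ∈ X a e) := by
    intro a e
    simp only [X, mem_ofPred_eq]
    infer_instance
  have hXi : ∀ a e, interior (X a e) = ∅ := by
    intro a e
    by_contra hne
    set γ : ι → (S → ℝ) → ℝ := fun i x => sSup {s | ∃ z, z ∈ Z ∧ dist z a < e ∧ rS S z = x ∧ s = z i} with hγ
    have hγd : ∀ i, DefF L (γ i) := by
      intro i
      apply DefF.sSup (A := fun (x : S → ℝ) s => ∃ z, z ∈ Z ∧ dist z a < e ∧ rS S z = x ∧ s = z i)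
      infer_instance
    have hγe : ∀ x z, z ∈ Z → dist z a < e → rS S z = x → (∀ z', z' ∈ Z → dist z' a < e → rS S z' = x → z' = z) →
        (fun i => γ i x) = z := by
      intro x z h1 h2 h3 h4
      funext i
      have : {s | ∃ z, z ∈ Z ∧ dist z a < e ∧ rS S z = x ∧ s = z i} = {z i} := by
        ext s
        constructor
        · rintro ⟨z', k1, k2, k3, rfl⟩
          rw [h4 z' k1 k2 k3]; rfl
        · rintro rfl
          exact ⟨z, h1, h2, h3, rfl⟩
      simp only [hγ]
      rw [this, csSup_singleton]
    have hgen : ∀ᶠ x in residual (S → ℝ), ∀ i, ContDiffAt ℝ p (γ i) x :=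
      eventually_countable_forall.2 fun i => gen_contDiff p (hγd i)
    obtain ⟨x0, hx0, hx0c⟩ := (dense_of_mem_residual hgen).inter_open_nonempty _ isOpen_interior
      (nonempty_iff_ne_empty.2 hne)
    obtain ⟨z0, h1, h2, h3, h4, h5⟩ := interior_subset hx0
    apply h4
    set v0 : (ι → ℝ) → ℝ := fun y => ∑ i, (y i - γ i (rS S y)) ^ 2 with hv0
    have hrc : ContDiff ℝ p (rS S : (ι → ℝ) → S → ℝ) := by
      unfold rS
      exact contDiff_pi.2 fun i => contDiff_apply ℝ ℝ (i : ι)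
    have hv0c : ContDiffAt ℝ p v0 z0 := by
      refine ContDiffAt.sum fun i _ => ContDiffAt.pow (ContDiffAt.sub (contDiff_apply ℝ ℝ i).contDiffAt ?_) 2
      refine ContDiffAt.comp (g := γ i) z0 ?_ hrc.contDiffAt
      rw [h3]; exact hx0c i
    have hv00 : v0 z0 = 0 := by
      have := hγe x0 z0 h1 h2 h3 h5
      simp only [hv0, h3]
      refine Finset.sum_eq_zero fun i _ => ?_
      have h6 := congrFun this i
      rw [h6]; simp
    obtain ⟨r, hr, hrb⟩ := Metric.isOpen_iff.1 (Metric.isOpen_ball (x := a) (ε := e)) z0 h2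
    refine hv0c.congr_of_eventuallyEq ?_
    have e1 : ∀ᶠ y in 𝓝 z0, rS S y ∈ interior (X a e) :=
      (continuous_rS S).continuousAt.eventually (isOpen_interior.mem_nhds (by rw [h3]; exact hx0))
    have e2 : ∀ᶠ y in 𝓝 z0, v0 y < min 1 ((r / 2) ^ 2) :=
      hv0c.continuousAt.eventually (gt_mem_nhds (by rw [hv00]; positivity))
    filter_upwards [e1, e2, Metric.ball_mem_nhds z0 (half_pos hr)] with y k1 k2 k3
    obtain ⟨z1, m1, m2, m3, m4, m5⟩ := interior_subset k1
    have hz1 := hγe _ z1 m1 m2 m3 m5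
    have hv0y : v0 y = ∑ i, (y i - z1 i) ^ 2 := by
      simp only [hv0]
      exact Finset.sum_congr rfl fun i _ => by rw [← congrFun hz1 i]
    refine le_antisymm ?_ ?_
    · rw [hv0y]; exact tS_le S m1 m3
    · refine le_tS S (k2.le.trans (min_le_left _ _)) fun z hz hzr => ?_
      by_cases hQ : dist z a < e
      · rw [m5 z hz hQ hzr, hv0y]
      · refine (k2.le.trans (min_le_right _ _)).trans (sumsq_ge y z (by positivity) ?_)
        by_contra hcon
        push Not at hcon
        refine hQ (hrb (?_ : z ∈ Metric.ball z0 r))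
        rw [Metric.mem_ball] at k3 ⊢
        have := dist_triangle z y z0
        rw [dist_comm z y] at this
        linarith
  have hgen : ∀ᶠ x in residual (S → ℝ), ∀ q : ℕ × ℕ,
      x ∈ X (TopologicalSpace.denseSeq (ι → ℝ) q.1) (1 / (q.2 + 1)) →
        x ∈ interior (X (TopologicalSpace.denseSeq (ι → ℝ) q.1) (1 / (q.2 + 1))) :=
    eventually_countable_forall.2 fun q => (tame_pi (L := L) S).gen (hXd _ _)
  filter_upwards [hgen] with x hx z hz hzx ⟨r, hr, hiso⟩
  by_contra hcon
  obtain ⟨k, hk⟩ := exists_nat_one_div_lt (half_pos hr)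
  obtain ⟨m, hm⟩ := (TopologicalSpace.denseRange_denseSeq (ι → ℝ)).exists_dist_lt z
    (show (0:ℝ) < 1 / (k + 1) by positivity)
  have := hx (m, k) ⟨z, hz, hm, hzx, hcon, fun z' k1 k2 k3 => hiso z' k1 k3 ?_⟩
  · rw [hXi] at this; exact this
  · have h1 := dist_triangle z' (TopologicalSpace.denseSeq (ι → ℝ) m) z
    rw [dist_comm (TopologicalSpace.denseSeq (ι → ℝ) m) z] at h1
    dsimp only at k2
    linarith

theorem gen_fiber [DM L] {κ : Type} [Fintype κ] {A : Set ((κ → ℝ) × ℝ)} (hA : Def L (fun q => q ∈ A))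
    (hint : interior A = ∅) : ∀ᶠ x in residual (κ → ℝ), interior {s | (x, s) ∈ A} = ∅ := by
  have hA' := Def.use2 (A := fun x y => (x, y) ∈ A) hA
  have hY : ∀ q : ℚ × ℚ, Def L (fun x => x ∈ {x : κ → ℝ | ∀ t : ℝ, q.1 < t ∧ t < q.2 → (x, t) ∈ A}) := by
    intro q
    simp only [mem_ofPred_eq]; infer_instance
  have hg : ∀ᶠ x in residual (κ → ℝ), ∀ q : ℚ × ℚ, x ∈ {x : κ → ℝ | ∀ t : ℝ, q.1 < t ∧ t < q.2 → (x, t) ∈ A} →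
        x ∈ interior {x : κ → ℝ | ∀ t : ℝ, q.1 < t ∧ t < q.2 → (x, t) ∈ A} :=
    eventually_countable_forall.2 fun q => (tame_pi (L := L) κ).gen (hY q)
  filter_upwards [hg] with x hx2
  by_contra hne
  obtain ⟨s, hs⟩ := nonempty_iff_ne_empty.2 hne
  obtain ⟨ε, hε, hball⟩ := Metric.isOpen_iff.1 isOpen_interior s hs
  obtain ⟨q1, h1, h1'⟩ := exists_rat_btwn (show s - ε < s by linarith)
  obtain ⟨q2, h2, h2'⟩ := exists_rat_btwn (show s < s + ε by linarith)
  have hi := hx2 (q1, q2) (fun t ht => by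
      have h3 : t ∈ interior {t | (x, t) ∈ A} := hball (by
        rw [Metric.mem_ball, Real.dist_eq, abs_lt]
        obtain ⟨ht1, ht2⟩ := ht
        dsimp only at ht1 ht2
        constructor <;> linarith)
      exact interior_subset (s := {t | (x, t) ∈ A}) h3)
  have hopen : IsOpen ((interior {x : κ → ℝ | ∀ t : ℝ, q1 < t ∧ t < q2 → (x, t) ∈ A}) ×ˢ
      Ioo (q1:ℝ) q2) := isOpen_interior.prod isOpen_Ioo
  have : (x, s) ∈ interior A := interior_maximal (fun ⟨y, t⟩ hyt => interior_subset hyt.1 t hyt.2) hopen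
    ⟨hi, h1', h2⟩
  rw [hint] at this
  exact this

theorem chain_lemma {X κ : Type} [MetricSpace X] (W : ℕ → Set X)
    (hW : ∀ m, ∀ z ∈ W (m + 1), z ∈ W m ∧ ∀ r > 0, ∃ z' ∈ W m, z' ≠ z ∧ dist z' z < r)
    (D : κ → Set X) (hD : ∀ c, ∀ z ∈ D c, ∃ r > 0, ∀ z' ∈ D c, dist z' z < r → z' = z) (k : ℕ) :
    ∀ (C : Finset κ), C.card = k → ∀ O : Set X, IsOpen O → (∀ z ∈ W 0, z ∈ O → ∃ c ∈ C, z ∈ D c) →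
      ∀ z ∈ W k, z ∉ O := by
  have hmono : ∀ m, W m ⊆ W 0 := by
    intro m
    induction m with
    | zero => exact subset_rfl
    | succ m ih => exact fun z hz => ih (hW m z hz).1
  induction k with
  | zero =>
    intro C hC O _ h z hz hzO
    obtain ⟨c, hc, -⟩ := h z hz hzO
    rw [Finset.card_eq_zero.1 hC] at hc
    simp at hc
  | succ k ih =>
    intro C hC O hO h z hz hzO
    obtain ⟨c, hc, hzc⟩ := h z (hmono _ hz) hzO
    obtain ⟨r, hr, hiso⟩ := hD c z hzc
    obtain ⟨r', hr', hb⟩ := Metric.isOpen_iff.1 hO z hzO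
    obtain ⟨z', hz', hne, hdist⟩ := (hW k z hz).2 (min r r') (lt_min hr hr')
    refine ih (C.erase c) (by rw [Finset.card_erase_of_mem hc, hC]; rfl) (O ∩ Metric.ball z r ∩ {z}ᶜ)
      ((hO.inter Metric.isOpen_ball).inter isOpen_compl_singleton) ?_ z' hz'
      ⟨⟨hb (hdist.trans_le (min_le_right _ _)), hdist.trans_le (min_le_left _ _)⟩, hne⟩
    rintro w hw ⟨⟨w1, w2⟩, w3⟩
    obtain ⟨c', hc', hwc⟩ := h w hw w1
    refine ⟨c', Finset.mem_erase.2 ⟨?_, hc'⟩, hwc⟩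
    rintro rfl
    exact w3 (hiso w hwc w2)

theorem step_term [DM L] (p : ℕ) (S : Finset ι) {Z : Set (ι → ℝ)} (hc : IsClosed Z)
    (hZ : Def L (fun x => x ∈ Z))
    (hA : ∀ j, interior {q : (S → ℝ) × ℝ | ∃ z, z ∈ Z ∧ rS S z = q.1 ∧ z j = q.2} = ∅) :
    ∃ k, interior (rS S '' ((stepS p S)^[k] Z)) = ∅ := by
  have hZu := hZ.useS
  have hru := (defF_rS (L := L) S).use
  have hAd : ∀ j, Def L (fun q => q ∈ {q : (S → ℝ) × ℝ | ∃ z, z ∈ Z ∧ rS S z = q.1 ∧ z j = q.2}) := by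
    intro j
    simp only [mem_ofPred_eq]
    infer_instance
  choose N hN using fun j => dmin_fiber (L := L) (A := fun (x : S → ℝ) s => ∃ z, z ∈ Z ∧ rS S z = x ∧ z j = s) (hAd j)
  have hZm : ∀ m, Def L (fun x => x ∈ (stepS p S)^[m] Z) := by
    intro m
    induction m with
    | zero => exact hZ
    | succ m ih => rw [Function.iterate_succ_apply']; exact stepS_def p S ih
  have g1 : ∀ᶠ x in residual (S → ℝ), ∀ j, interior {s | (x, s) ∈ {q : (S → ℝ) × ℝ | ∃ z, z ∈ Z ∧ rS S z = q.1 ∧ z j = q.2}} = ∅ :=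
    eventually_countable_forall.2 fun j => gen_fiber (hAd j) (hA j)
  have g2 := eventually_countable_forall.2 fun m => gen_iso p S (hZm m)
  let k := (Finset.univ : Finset (∀ j, Fin (N j))).card
  refine ⟨k, ?_⟩
  by_contra hne
  obtain ⟨x, hx, hx1, hx2⟩ := (dense_of_mem_residual (g1.and g2)).inter_open_nonempty _ isOpen_interior
      (nonempty_iff_ne_empty.2 hne)
  obtain ⟨z, hz, hzx⟩ := interior_subset hx
  choose U D hU hD hUD using fun j => hN j x
  have hsub : ∀ j, ∀ z ∈ Z, rS S z = x → ∃ i, z j ∈ D j i := by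
    intro j z hz hzx
    have hU0 : U j = ∅ := by
      have : U j ⊆ interior {t | ∃ z, z ∈ Z ∧ rS S z = x ∧ z j = t} :=
        interior_maximal (by rw [hUD j]; exact subset_union_left) (hU j)
      rw [← subset_empty_iff, ← hx1 j]
      exact this
    have h1 : z j ∈ {t | ∃ z, z ∈ Z ∧ rS S z = x ∧ z j = t} := ⟨z, hz, hzx, rfl⟩
    rw [hUD j, hU0, empty_union] at h1
    exact mem_iUnion.1 h1
  refine chain_lemma (X := ι → ℝ) (fun m => {z | z ∈ (stepS p S)^[m] Z ∧ rS S z = x}) ?_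
    (fun c : (∀ j, Fin (N j)) => {z | ∀ j, z j ∈ D j (c j)}) ?_ k Finset.univ rfl univ isOpen_univ ?_ z
    ⟨hz, hzx⟩ (mem_univ z)
  · rintro m w ⟨hw, hwx⟩
    rw [Function.iterate_succ_apply'] at hw
    refine ⟨⟨hw.1, hwx⟩, fun r hr => ?_⟩
    by_contra hcon
    push Not at hcon
    refine hw.2 (hx2 m w hw.1 hwx ⟨r, hr, fun w' h1 h2 h3 => ?_⟩)
    by_contra h4
    exact absurd h3 (not_lt.2 (hcon w' ⟨h1, h2⟩ h4))
  · intro c w hw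
    choose V hV hVD using fun j => hD j (c j) (w j) (hw j)
    have ho : IsOpen (Set.univ.pi V) := isOpen_set_pi finite_univ fun j _ => hV j
    have hwV : w ∈ Set.univ.pi V := fun j _ => by
      have : w j ∈ V j ∩ D j (c j) := by rw [hVD j]; rfl
      exact this.1
    obtain ⟨r, hr, hb⟩ := Metric.isOpen_iff.1 ho w hwV
    refine ⟨r, hr, fun w' h1 h2 => funext fun j => ?_⟩
    have : w' j ∈ V j ∩ D j (c j) := ⟨hb h2 j (mem_univ j), h1 j⟩
    rw [hVD j] at this
    exact this
  · rintro w ⟨hw, hwx⟩ -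
    choose c hc using fun j => hsub j w hw hwx
    exact ⟨c, Finset.mem_univ _, hc⟩

def Bad (Z : Set (ι → ℝ)) : Finset (Finset ι) :=
  Finset.univ.filter fun S => (interior (rS S '' Z)).Nonempty

theorem PZ_all [DM L] (p : ℕ) (n : ℕ) : ∀ Z : Set (ι → ℝ), (Bad Z).card = n → IsClosed Z →
    Def L (fun x => x ∈ Z) → PZ L p Z := by
  induction n using Nat.strong_induction_on with
  | _ n ih =>
  intro Z hn hc hZ
  by_cases hB : (Bad Z).Nonempty
  · obtain ⟨S, hS, hmax⟩ := Finset.exists_max_image (Bad Z) Finset.card hB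
    have hA : ∀ j, interior {q : (S → ℝ) × ℝ | ∃ z, z ∈ Z ∧ rS S z = q.1 ∧ z j = q.2} = ∅ := by
      intro j
      by_contra hne
      obtain ⟨⟨x, s⟩, hxs⟩ := nonempty_iff_ne_empty.2 hne
      by_cases hj : j ∈ S
      · have h1 : ∀ᶠ s' in 𝓝 s, (x, s') ∈ interior {q : (S → ℝ) × ℝ | ∃ z, z ∈ Z ∧ rS S z = q.1 ∧ z j = q.2} :=
          (Continuous.prodMk_right x).continuousAt.eventually (isOpen_interior.mem_nhds hxs)
        have h2 : ∀ᶠ s' in 𝓝[≠] s, (x, s') ∈ interior {q : (S → ℝ) × ℝ | ∃ z, z ∈ Z ∧ rS S z = q.1 ∧ z j = q.2} :=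
          mem_nhdsWithin_of_mem_nhds h1
        obtain ⟨s', h3, h4⟩ := (h2.and self_mem_nhdsWithin).exists
        obtain ⟨z, -, k1, k2⟩ := interior_subset hxs
        obtain ⟨z', -, k3, k4⟩ := interior_subset h3
        apply h4
        dsimp only at k1 k2 k3 k4
        change s' = s
        rw [← k2, ← k4]
        have := congrFun (k3.trans k1.symm) ⟨j, hj⟩
        exact this
      · have : insert j S ∈ Bad Z := by
          rw [Bad, Finset.mem_filter]
          refine ⟨Finset.mem_univ _, ?_⟩
          let Ψ : (↥(insert j S) → ℝ) → (S → ℝ) × ℝ := fun w =>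
            (fun i => w ⟨i, Finset.mem_insert_of_mem i.2⟩, w ⟨j, Finset.mem_insert_self j S⟩)
          have hΨ : Continuous Ψ := by
            simp only [Ψ]; fun_prop
          let w0 : ↥(insert j S) → ℝ := fun i => if h : (i : ι) ∈ S then x ⟨i, h⟩ else s
          have hw0 : Ψ w0 = (x, s) := by
            simp only [Ψ, w0, hj]
            ext i <;> simp
          refine ⟨w0, interior_maximal ?_ (isOpen_interior.preimage hΨ) (show Ψ w0 ∈ _ by rw [hw0]; exact hxs)⟩
          intro w hw
          obtain ⟨z, hz, h1, h2⟩ := interior_subset hw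
          refine ⟨z, hz, ?_⟩
          funext i
          rcases Finset.mem_insert.1 i.2 with h | h
          · have : i = ⟨j, Finset.mem_insert_self j S⟩ := Subtype.ext h
            rw [this]; exact h2
          · have h5 := congrFun h1 ⟨i, h⟩
            exact h5
        have h2 := hmax _ this
        rw [Finset.card_insert_of_notMem hj] at h2
        omega
    obtain ⟨k, hk⟩ := step_term p S hc hZ hA
    have hprop : ∀ m, IsClosed ((stepS p S)^[m] Z) ∧ Def L (fun x => x ∈ (stepS p S)^[m] Z) ∧
        (stepS p S)^[m] Z ⊆ Z ∧ (PZ L p ((stepS p S)^[m] Z) → PZ L p Z) := by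
      intro m
      induction m with
      | zero => exact ⟨hc, hZ, subset_rfl, id⟩
      | succ m ihm =>
        obtain ⟨h1, h2, h3, h4⟩ := ihm
        rw [Function.iterate_succ_apply']
        exact ⟨stepS_closed p S h1, stepS_def p S h2, (stepS_sub p S _).trans h3,
          fun h => h4 (PZ_stepS p S h1 h2 h)⟩
    obtain ⟨h1, h2, h3, h4⟩ := hprop k
    refine h4 (ih _ ?_ _ rfl h1 h2)
    rw [← hn]
    apply Finset.card_lt_card
    rw [Finset.ssubset_iff_of_subset]
    · refine ⟨S, hS, ?_⟩
      rw [Bad, Finset.mem_filter, hk]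
      simp
    · intro T hT
      rw [Bad, Finset.mem_filter] at hT ⊢
      exact ⟨hT.1, hT.2.mono (interior_mono (image_mono h3))⟩
  · have : Z = ∅ := by
      by_contra hne
      obtain ⟨z, hz⟩ := nonempty_iff_ne_empty.2 hne
      apply hB
      refine ⟨∅, ?_⟩
      rw [Bad, Finset.mem_filter]
      refine ⟨Finset.mem_univ _, ?_⟩
      have : rS (∅ : Finset ι) '' Z = univ := by
        ext w
        simp only [mem_univ, iff_true]
        exact ⟨z, hz, funext fun i => absurd i.2 (Finset.notMem_empty _)⟩
      rw [this, interior_univ]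
      exact ⟨rS ∅ z, mem_univ _⟩
    rw [this]
    exact PZ_empty p

theorem PZ_closed [DM L] (p : ℕ) {Z : Set (ι → ℝ)} (hc : IsClosed Z)
    (hZ : Def L (fun x => x ∈ Z)) : PZ L p Z := PZ_all p _ Z rfl hc hZ

end PartE2


section PartF1
set_option linter.unusedSectionVars false
set_option linter.unusedVariables false
variable {L}

def HasVD (M : Set E) (v : E) (f : E → ℝ) (x : E) (w : ℝ) : Prop :=
  ∃ (U : Set E) (h : E → ℝ), IsOpen U ∧ x ∈ U ∧ ContDiffOn ℝ 1 h U ∧ EqOn f h (M ∩ U) ∧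
    fderiv ℝ h x v = w

theorem hasFDerivAt_of_cd {U : Set E} {h : E → ℝ} {x : E} (hU : IsOpen U) (hx : x ∈ U)
    (hh : ContDiffOn ℝ 1 h U) : HasFDerivAt h (fderiv ℝ h x) x :=
  ((hh.contDiffAt (hU.mem_nhds hx)).differentiableAt (by simp)).hasFDerivAt

theorem HasVD.curve {M : Set E} {v : E} {f : E → ℝ} {x : E} {w : ℝ} (h : HasVD M v f x w)
    {γ : ℝ → E} (h0 : γ 0 = x) (hγ : ∀ᶠ t in 𝓝 (0:ℝ), γ t ∈ M) (hd : HasDerivAt γ v 0) :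
    HasDerivAt (fun t => f (γ t)) w 0 := by
  obtain ⟨U, h, hU, hx, hh, he, rfl⟩ := h
  have h1 : HasFDerivAt h (fderiv ℝ h x) (γ 0) := by rw [h0]; exact hasFDerivAt_of_cd hU hx hh
  refine (h1.comp_hasDerivAt 0 hd).congr_of_eventuallyEq ?_
  filter_upwards [hγ, hd.continuousAt.eventually (hU.mem_nhds (by rw [h0]; exact hx))] with t h1 h2
  exact he ⟨h1, h2⟩

theorem HasVD.unique {M : Set E} {v : E} {f : E → ℝ} {x : E} {w w' : ℝ} (hv : v ∈ TangentVecs M x)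
    (h : HasVD M v f x w) (h' : HasVD M v f x w') : w = w' := by
  obtain ⟨γ, h0, hγ, hd⟩ := hv
  exact (h.curve h0 hγ hd).unique (h'.curve h0 hγ hd)

theorem HasVD.vderiv_eq {M : Set E} {D : E → E} {f : E → ℝ} {x : E} {w : ℝ}
    (hv : D x ∈ TangentVecs M x) (h : HasVD M (D x) f x w) : vderiv M D f x = w := by
  have hex : ∃ w : ℝ, ∀ (U : Set E) (g : E → ℝ), IsOpen U → x ∈ U → ContDiffOn ℝ 1 g U →
      Set.EqOn f g (M ∩ U) → fderiv ℝ g x (D x) = w :=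
    ⟨w, fun U g h1 h2 h3 h4 => HasVD.unique hv ⟨U, g, h1, h2, h3, h4, rfl⟩ h⟩
  unfold vderiv
  rw [dif_pos hex]
  obtain ⟨U, g, h1, h2, h3, h4, h5⟩ := h
  rw [← h5]
  exact (hex.choose_spec U g h1 h2 h3 h4).symm

theorem CpOn.hasVD {M : Set E} {D : E → E} {f : E → ℝ} {x : E} (hx : x ∈ M)
    (hv : D x ∈ TangentVecs M x) (h : CpOn 1 f M) : HasVD M (D x) f x (vderiv M D f x) := by
  obtain ⟨U, g, h1, h2, h3, h4⟩ := h x hx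
  have h5 : HasVD M (D x) f x (fderiv ℝ g x (D x)) :=
    ⟨U, g, h1, h2, by simpa using h3, h4, rfl⟩
  rwa [h5.vderiv_eq hv]

theorem HasVD.congr {M : Set E} {v : E} {f f' : E → ℝ} {x : E} {w : ℝ} (h : HasVD M v f x w)
    (he : EqOn f' f M) : HasVD M v f' x w := by
  obtain ⟨U, h, hU, hx, hh, h1, h2⟩ := h
  exact ⟨U, h, hU, hx, hh, fun y hy => (he hy.1).trans (h1 hy), h2⟩

theorem HasVD.zero {M : Set E} {v : E} {x : E} : HasVD M v (fun _ => 0) x 0 :=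
  ⟨univ, fun _ => 0, isOpen_univ, mem_univ x, contDiffOn_const, fun _ _ => rfl, by simp⟩

theorem HasVD.add {M : Set E} {v : E} {f f' : E → ℝ} {x : E} {w w' : ℝ} (h : HasVD M v f x w)
    (h' : HasVD M v f' x w') : HasVD M v (fun y => f y + f' y) x (w + w') := by
  obtain ⟨U, h, hU, hx, hh, h1, h2⟩ := h
  obtain ⟨U', h', hU', hx', hh', h1', h2'⟩ := h'
  refine ⟨U ∩ U', fun y => h y + h' y, hU.inter hU', ⟨hx, hx'⟩,
    (hh.mono inter_subset_left).add (hh'.mono inter_subset_right), fun y hy => ?_, ?_⟩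
  · simp only [h1 ⟨hy.1, hy.2.1⟩, h1' ⟨hy.1, hy.2.2⟩]
  · change fderiv ℝ (h + h') x v = _
    rw [((hasFDerivAt_of_cd hU hx hh).add (hasFDerivAt_of_cd hU' hx' hh')).fderiv]
    simp [h2, h2']

theorem HasVD.mul {M : Set E} {v : E} {f f' : E → ℝ} {x : E} {w w' : ℝ} (hxM : x ∈ M) (h : HasVD M v f x w)
    (h' : HasVD M v f' x w') : HasVD M v (fun y => f y * f' y) x (f x * w' + f' x * w) := by
  obtain ⟨U, h, hU, hx, hh, h1, h2⟩ := h
  obtain ⟨U', h', hU', hx', hh', h1', h2'⟩ := h'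
  refine ⟨U ∩ U', fun y => h y * h' y, hU.inter hU', ⟨hx, hx'⟩,
    (hh.mono inter_subset_left).mul (hh'.mono inter_subset_right), fun y hy => ?_, ?_⟩
  · simp only [h1 ⟨hy.1, hy.2.1⟩, h1' ⟨hy.1, hy.2.2⟩]
  · change fderiv ℝ (h * h') x v = _
    rw [((hasFDerivAt_of_cd hU hx hh).mul (hasFDerivAt_of_cd hU' hx' hh')).fderiv]
    simp [h2, h2', h1 ⟨hxM, hx⟩, h1' ⟨hxM, hx'⟩]

theorem HasVD.sum {M : Set E} {v : E} {f : ℕ → E → ℝ} {x : E} {w : ℕ → ℝ} (s : Finset ℕ)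
    (h : ∀ j ∈ s, HasVD M v (f j) x (w j)) : HasVD M v (fun y => ∑ j ∈ s, f j y) x (∑ j ∈ s, w j) := by
  induction s using Finset.induction_on with
  | empty => simpa using HasVD.zero
  | insert a s ha ih =>
    simp only [Finset.sum_insert ha]
    exact (h a (Finset.mem_insert_self _ _)).add (ih fun j hj => h j (Finset.mem_insert_of_mem hj))

theorem CpOn.mono {M : Set E} {f : E → F} {p q : ℕ} (h : CpOn p f M) (hq : q ≤ p) : CpOn q f M := by
  intro x hx
  obtain ⟨U, g, h1, h2, h3, h4⟩ := h x hx
  exact ⟨U, g, h1, h2, h3.of_le (by exact_mod_cast hq), h4⟩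

theorem CpOn.continuousOn {M : Set E} {f : E → F} {p : ℕ} (h : CpOn p f M) : ContinuousOn f M := by
  intro x hx
  obtain ⟨U, g, h1, h2, h3, h4⟩ := h x hx
  have h5 : ContinuousWithinAt g M x := (h3.continuousOn.continuousAt (h1.mem_nhds h2)).continuousWithinAt
  refine h5.congr_of_eventuallyEq ?_ (h4 ⟨hx, h2⟩)
  filter_upwards [self_mem_nhdsWithin, mem_nhdsWithin_of_mem_nhds (h1.mem_nhds h2)] with y k1 k2
  exact h4 ⟨k1, k2⟩

theorem CpOn.congr {M : Set E} {f f' : E → F} {p : ℕ} (h : CpOn p f M) (he : EqOn f' f M) : CpOn p f' M := by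
  intro x hx
  obtain ⟨U, g, h1, h2, h3, h4⟩ := h x hx
  exact ⟨U, g, h1, h2, h3, fun y hy => (he hy.1).trans (h4 hy)⟩

theorem CpOn.add {M : Set E} {f f' : E → ℝ} {p : ℕ} (h : CpOn p f M) (h' : CpOn p f' M) :
    CpOn p (fun x => f x + f' x) M := by
  intro x hx
  obtain ⟨U, g, h1, h2, h3, h4⟩ := h x hx
  obtain ⟨U', g', h1', h2', h3', h4'⟩ := h' x hx
  refine ⟨U ∩ U', fun y => g y + g' y, h1.inter h1', ⟨h2, h2'⟩,
    (h3.mono inter_subset_left).add (h3'.mono inter_subset_right), fun y hy => ?_⟩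
  simp only [h4 ⟨hy.1, hy.2.1⟩, h4' ⟨hy.1, hy.2.2⟩]

theorem CpOn.mul {M : Set E} {f f' : E → ℝ} {p : ℕ} (h : CpOn p f M) (h' : CpOn p f' M) :
    CpOn p (fun x => f x * f' x) M := by
  intro x hx
  obtain ⟨U, g, h1, h2, h3, h4⟩ := h x hx
  obtain ⟨U', g', h1', h2', h3', h4'⟩ := h' x hx
  refine ⟨U ∩ U', fun y => g y * g' y, h1.inter h1', ⟨h2, h2'⟩,
    (h3.mono inter_subset_left).mul (h3'.mono inter_subset_right), fun y hy => ?_⟩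
  simp only [h4 ⟨hy.1, hy.2.1⟩, h4' ⟨hy.1, hy.2.2⟩]

theorem cpOn_const {M : Set E} {p : ℕ} (c : F) : CpOn p (fun _ : E => c) M := fun x _ =>
  ⟨univ, fun _ => c, isOpen_univ, mem_univ x, contDiffOn_const, fun _ _ => rfl⟩

theorem CpOn.vderiv {M : Set E} {D : E → E} {f : E → ℝ} {m : ℕ} (h : CpOn (m + 1) f M) (hD : CpOn m D M)
    (hT : ∀ x ∈ M, D x ∈ TangentVecs M x) : CpOn m (vderiv M D f) M := by
  intro x hx
  obtain ⟨U, g, h1, h2, h3, h4⟩ := h x hx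
  obtain ⟨U', D', h1', h2', h3', h4'⟩ := hD x hx
  refine ⟨U ∩ U', fun y => fderiv ℝ g y (D' y), h1.inter h1', ⟨h2, h2'⟩, ?_, ?_⟩
  · have h5 : ContDiffOn ℝ m (fderiv ℝ g) U := h3.fderiv_of_isOpen h1 (by push_cast; rfl)
    exact (h5.mono inter_subset_left).clm_apply (h3'.mono inter_subset_right)
  · intro y hy
    have h6 : HasVD M (D y) f y (fderiv ℝ g y (D y)) :=
      ⟨U, g, h1, hy.2.1, h3.of_le (by norm_cast; omega), h4, rfl⟩
    rw [h6.vderiv_eq (hT y hy.1)]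
    dsimp only
    rw [h4' ⟨hy.1, hy.2.2⟩]

def FOv (M : Set E) (f : E → ℝ) (x v : E) (w : ℝ) : Prop :=
  ∀ η : ℝ, 0 < η → ∃ δ : ℝ, 0 < δ ∧ ∀ y, y ∈ M → ∀ t : ℝ, 0 < t → t < δ → dist y (x + t • v) ≤ δ * t →
    |f y - f x - t * w| ≤ η * t

theorem HasVD.fov {M : Set E} {v : E} {f : E → ℝ} {x : E} {w : ℝ} (hxM : x ∈ M) (h : HasVD M v f x w) :
    FOv M f x v w := by
  obtain ⟨U, h, hU, hx, hh, he, rfl⟩ := h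
  intro η hη
  have hd := hasFDerivAt_of_cd hU hx hh
  set h' := fderiv ℝ h x
  set A := ‖h'‖ with hA
  set B := ‖v‖ with hB
  have hA0 : 0 ≤ A := norm_nonneg _
  have hB0 : 0 ≤ B := norm_nonneg _
  have hc : 0 < η / (2 * (B + 1)) := by positivity
  have h1 := hd.isLittleO.def hc
  obtain ⟨δ', hδ', hb⟩ := Metric.mem_nhds_iff.1 (h1.and (hU.mem_nhds hx))
  refine ⟨min 1 (min (δ' / (B + 2)) (η / (2 * (A + 1)))), by positivity, fun y hy t ht0 ht hdist => ?_⟩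
  set δ := min 1 (min (δ' / (B + 2)) (η / (2 * (A + 1)))) with hδ
  have d1 : δ ≤ 1 := min_le_left _ _
  have d2 : δ * (B + 2) ≤ δ' := by
    rw [← le_div_iff₀ (by positivity)]; exact (min_le_right _ _).trans (min_le_left _ _)
  have d3 : δ * (2 * (A + 1)) ≤ η := by
    rw [← le_div_iff₀ (by positivity)]; exact (min_le_right _ _).trans (min_le_right _ _)
  have d0 : 0 < δ := by positivity
  rw [dist_eq_norm] at hdist
  have hyx : ‖y - x‖ ≤ t * (B + 1) := by
    calc ‖y - x‖ = ‖(y - (x + t • v)) + t • v‖ := by congr 1; abel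
      _ ≤ ‖y - (x + t • v)‖ + ‖t • v‖ := norm_add_le _ _
      _ ≤ δ * t + t * B := by rw [norm_smul, Real.norm_eq_abs, abs_of_pos ht0]; gcongr
      _ ≤ t * (B + 1) := by nlinarith
  have hyb : y ∈ Metric.ball x δ' := by
    rw [Metric.mem_ball, dist_eq_norm]; nlinarith
  obtain ⟨k1, k2⟩ := hb hyb
  have hh1 : f y = h y := he ⟨hy, k2⟩
  have hh2 : f x = h x := he ⟨hxM, hx⟩
  rw [hh1, hh2]
  have e1 : h y - h x - t * h' v = (h y - h x - h' (y - x)) + h' (y - (x + t • v)) := by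
    simp only [map_sub, map_add, map_smul, smul_eq_mul]; ring
  rw [e1]
  have e2 : |h y - h x - h' (y - x)| ≤ η / (2 * (B + 1)) * ‖y - x‖ := k1
  have e3 : |h' (y - (x + t • v))| ≤ A * (δ * t) := (h'.le_opNorm _).trans (by gcongr)
  have e4 : η / (2 * (B + 1)) * ‖y - x‖ ≤ η / 2 * t := by
    calc η / (2 * (B + 1)) * ‖y - x‖ ≤ η / (2 * (B + 1)) * (t * (B + 1)) := by gcongr
      _ = η / 2 * t := by field_simp
  have e5 : A * (δ * t) ≤ η / 2 * t := by
    have : A * δ ≤ η / 2 := by nlinarith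
    nlinarith
  have := abs_add_le (h y - h x - h' (y - x)) (h' (y - (x + t • v)))
  linarith

theorem FOv.unique {M : Set E} {v : E} {f : E → ℝ} {x : E} {w w' : ℝ} (hv : v ∈ TangentVecs M x)
    (h : FOv M f x v w) (h' : FOv M f x v w') : w = w' := by
  by_contra hne
  have hpos : 0 < |w - w'| := abs_pos.2 (sub_ne_zero.2 hne)
  obtain ⟨γ, h0, hγ, hd⟩ := hv
  obtain ⟨δ, hδ, k⟩ := h (|w - w'| / 4) (by positivity)
  obtain ⟨δ', hδ', k'⟩ := h' (|w - w'| / 4) (by positivity)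
  have h1 := (hasDerivAt_iff_isLittleO.1 hd).def (lt_min hδ hδ')
  have h2 : ∀ᶠ t in 𝓝[>] (0:ℝ), γ t ∈ M ∧ ‖γ t - γ 0 - (t - 0) • v‖ ≤ min δ δ' * ‖t - 0‖ ∧ t < min δ δ' :=
    mem_nhdsWithin_of_mem_nhds (hγ.and (h1.and (gt_mem_nhds (lt_min hδ hδ'))))
  obtain ⟨t, ⟨t1, t2, t3⟩, t4⟩ := (h2.and self_mem_nhdsWithin).exists
  have t4 : 0 < t := t4
  rw [sub_zero, h0, Real.norm_eq_abs, abs_of_pos t4] at t2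
  have hdist : dist (γ t) (x + t • v) ≤ min δ δ' * t := by
    rw [dist_eq_norm, ← sub_sub]; exact t2
  have a1 := k _ t1 t t4 (t3.trans_le (min_le_left _ _)) (hdist.trans (by gcongr; exact min_le_left _ _))
  have a2 := k' _ t1 t t4 (t3.trans_le (min_le_right _ _)) (hdist.trans (by gcongr; exact min_le_right _ _))
  have a3 : |t * (w - w')| ≤ |w - w'| / 4 * t + |w - w'| / 4 * t := by
    have : t * (w - w') = (f (γ t) - f x - t * w') - (f (γ t) - f x - t * w) := by ring
    rw [this]
    exact (abs_sub _ _).trans (by linarith)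
  rw [abs_mul, abs_of_pos t4] at a3
  nlinarith [mul_pos t4 hpos]

theorem def_fov [OF L] {ι : Type} [Fintype ι] {M : Set (ι → ℝ)} (hM : Def L (fun x => x ∈ M))
    {f : (ι → ℝ) → ℝ} (hf : DefF L f) {D : (ι → ℝ) → (ι → ℝ)} (hD : DefF L D) :
    Def L (fun q : (ι → ℝ) × ℝ => FOv M f q.1 (D q.1) q.2) := by
  have h1 := hM.useS
  have h2 := hf.use
  have h3 := hD.use
  have h4 : DefF L (fun q : (((((ι → ℝ) × ℝ) × ℝ) × ℝ) × (ι → ℝ)) × ℝ => q.1.1.1.1.1 + q.2 • D q.1.1.1.1.1) :=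
    DefF.pi (f := fun (q : (((((ι → ℝ) × ℝ) × ℝ) × ℝ) × (ι → ℝ)) × ℝ) i => q.1.1.1.1.1 i + q.2 * D q.1.1.1.1.1 i)
      (h := fun i => inferInstance)
  have h5 : Def L (fun q : (((((ι → ℝ) × ℝ) × ℝ) × ℝ) × (ι → ℝ)) × ℝ =>
      dist q.1.2 (q.1.1.1.1.1 + q.2 • D q.1.1.1.1.1) ≤ q.1.1.2 * q.2) := inferInstance
  have h6 : Def L (fun q : (((((ι → ℝ) × ℝ) × ℝ) × ℝ) × (ι → ℝ)) × ℝ =>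
      |f q.1.2 - f q.1.1.1.1.1 - q.2 * q.1.1.1.1.2| ≤ q.1.1.1.2 * q.2) := inferInstance
  unfold FOv
  infer_instance

theorem defF_vderiv [OF L] {ι : Type} [Fintype ι] {M : Set (ι → ℝ)} (hM : Def L (fun x => x ∈ M))
    {f : (ι → ℝ) → ℝ} (hf : DefF L f) {D D' : (ι → ℝ) → (ι → ℝ)} (hD' : DefF L D') (hDD : ∀ x ∈ M, D' x = D x)
    (hT : ∀ x ∈ M, D x ∈ TangentVecs M x) (hfc : CpOn 1 f M) :
    DefF L (fun x => if x ∈ M then vderiv M D f x else 0) := by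
  have h1 := hM.useS
  have h2 := Def.use2 (A := fun x w => FOv M f x (D' x) w) (def_fov hM hf hD')
  refine DefF.ofGraph (def_congr (P := fun q : (ι → ℝ) × ℝ =>
    (q.1 ∈ M ∧ FOv M f q.1 (D' q.1) q.2) ∨ (q.1 ∉ M ∧ q.2 = 0)) inferInstance ?_)
  rintro ⟨x, w⟩
  dsimp only
  by_cases hx : x ∈ M
  · rw [if_pos hx]
    simp only [hx, true_and, not_true, false_and, or_false, hDD x hx]
    have h3 := (hfc.hasVD hx (hT x hx)).fov hx
    constructor
    · intro h; exact FOv.unique (hT x hx) h3 h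
    · rintro rfl; exact h3
  · rw [if_neg hx]
    simp [hx, eq_comm]

end PartF1


section PartF2
set_option linter.unusedSectionVars false
set_option linter.unusedVariables false
variable {L}

theorem closed_front {p n d : ℕ} {M : Set (Fin n → ℝ)} (hM : IsDpSubmanifold L p d M) :
    IsClosed (closure M \ M) := by
  rw [← isOpen_compl_iff, isOpen_iff_mem_nhds]
  intro x hx
  by_cases hxM : x ∈ M
  · obtain ⟨U, V, φ, ψ, hU, hxU, -, -, -, -, -, -, hφ, -, hm, -, hψφ, -, -, him⟩ := hM.2.2 x hxM
    filter_upwards [hU.mem_nhds hxU] with y hy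
    rintro ⟨hyc, hyM⟩
    apply hyM
    have hyc' : y ∈ closure (M ∩ U) := by
      rw [inter_comm]
      exact hU.inter_closure ⟨hy, hyc⟩
    have hfl : ∀ i : Fin n, d ≤ (i : ℕ) → φ y i = 0 := by
      intro i hi
      have hc : ContinuousOn (fun y => φ y i) U := (continuous_apply i).comp_continuousOn hφ.continuousOn
      have h1 : φ y i ∈ closure ((fun y => φ y i) '' (M ∩ U)) :=
        (hc.continuousAt (hU.mem_nhds hy)).continuousWithinAt.mem_closure_image hyc'
      have h2 : (fun y => φ y i) '' (M ∩ U) ⊆ {0} := by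
        rintro _ ⟨z, hz, rfl⟩
        have : φ z ∈ φ '' (M ∩ U) := ⟨z, hz, rfl⟩
        rw [him] at this
        exact this.2 i hi
      have h3 := closure_mono h2 h1
      rwa [closure_singleton] at h3
    have h4 : φ y ∈ φ '' (M ∩ U) := by rw [him]; exact ⟨hm hy, hfl⟩
    obtain ⟨z, hz, hzy⟩ := h4
    have : z = y := by rw [← hψφ z hz.2, hzy, hψφ y hy]
    rw [← this]; exact hz.1
  · have : x ∉ closure M := fun h => hx ⟨h, hxM⟩
    filter_upwards [isClosed_closure.isOpen_compl.mem_nhds this] with y hy h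
    exact hy h.1

theorem hasVD_self {n p : ℕ} (hp : 1 ≤ p) {M : Set (Fin n → ℝ)} {g : (Fin n → ℝ) → ℝ} {x : Fin n → ℝ}
    (hg : ContDiffAt ℝ p g x) (v : Fin n → ℝ) : HasVD M v g x (fderiv ℝ g x v) :=
  ⟨{y | ContDiffAt ℝ p g y}, g, isOpen_contDiffAt p g, hg, fun y hy =>
    (ContDiffAt.of_le (show ContDiffAt ℝ p g y from hy) (by exact_mod_cast hp)).contDiffWithinAt, fun _ _ => rfl, rfl⟩

theorem hasVD_comp {n p : ℕ} (hp : 1 ≤ p) {M : Set (Fin n → ℝ)} {g : (Fin n → ℝ) → ℝ} {x : Fin n → ℝ}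
    (hg : ContDiffAt ℝ p g x) (hx : g x ∈ Ioo (0:ℝ) 2) (v : Fin n → ℝ) {G : ℕ → ℝ → ℝ}
    (hG : ∀ i ≤ p, ∀ s ∈ Ioo (0:ℝ) 2, HasDerivAt (G i) (G (i + 1) s) s) {j : ℕ} (hj : j + 1 ≤ p) :
    HasVD M v (fun y => G j (g y)) x (G (j + 1) (g x) * fderiv ℝ g x v) := by
  have ho := isOpen_contDiffAt p g
  have hc : ContDiffOn ℝ 1 g {y | ContDiffAt ℝ p g y} := fun y hy =>
    (ContDiffAt.of_le (show ContDiffAt ℝ p g y from hy) (by exact_mod_cast hp)).contDiffWithinAt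
  have hG1 : ContDiffOn ℝ 1 (G j) (Ioo 0 2) := by
    have := tower_contDiff isOpen_Ioo hG 1 j hj
    simpa using this
  refine ⟨{y | ContDiffAt ℝ p g y} ∩ g ⁻¹' Ioo 0 2, fun y => G j (g y),
    hc.continuousOn.isOpen_inter_preimage ho isOpen_Ioo, ⟨hg, hx⟩, ?_, fun _ _ => rfl, ?_⟩
  · exact hG1.comp (hc.mono inter_subset_left) fun y hy => hy.2
  · have h1 := (hG j (by omega) _ hx).comp_hasFDerivAt x (hasFDerivAt_of_cd ho hg hc)
    have h2 : fderiv ℝ (fun y => G j (g y)) x = G (j + 1) (g x) • fderiv ℝ g x := h1.fderiv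
    rw [h2]
    simp

theorem expand [DM L] {n k p : ℕ} (hp : 1 ≤ p) {M : Set (Fin n → ℝ)} (hM : Def L (fun x => x ∈ M))
    {D : Fin k → (Fin n → ℝ) → (Fin n → ℝ)}
    (hDd : ∀ i, IsDefMapOn L M (D i)) (hDc : ∀ i, CpOn (p - 1) (D i) M)
    (hT : ∀ i, ∀ x ∈ M, D i x ∈ TangentVecs M x) {g : (Fin n → ℝ) → ℝ} (hgd : DefF L g)
    (hgc : ∀ x ∈ M, ContDiffAt ℝ p g x) (hgI : ∀ x ∈ M, g x ∈ Ioo (0:ℝ) 2) (α : List (Fin k)) :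
    α.length ≤ p → ∃ P : ℕ → (Fin n → ℝ) → ℝ, (∀ j, DefF L (P j)) ∧
      (∀ j, CpOn (p - α.length) (P j) M) ∧
      ∀ G : ℕ → ℝ → ℝ, (∀ i ≤ p, ∀ s ∈ Ioo (0:ℝ) 2, HasDerivAt (G i) (G (i + 1) s) s) →
        ∀ x ∈ M, vderivIter M D α (fun y => G 0 (g y)) x =
          ∑ j ∈ Finset.range (α.length + 1), G j (g x) * P j x := by
  have hMu := hM.useS
  have hgC : CpOn p g M := fun x hx =>
    ⟨{y | ContDiffAt ℝ p g y}, g, isOpen_contDiffAt p g, hgc x hx, fun y hy =>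
      ContDiffAt.contDiffWithinAt hy, fun _ _ => rfl⟩
  induction α with
  | nil =>
    intro _
    refine ⟨fun _ _ => 1, fun _ => inferInstance, fun _ => cpOn_const 1, fun G hG x hx => ?_⟩
    simp [vderivIter]
  | cons i l ih =>
    intro hlen
    rw [List.length_cons] at hlen
    obtain ⟨P, hPd, hPc, hP⟩ := ih (by omega)
    set m := l.length with hm
    have hD' := defF_extend (0 : Fin n → ℝ) hM (isDefMapOn_iff.1 (hDd i))
    have hDD : ∀ x ∈ M, (fun x => if x ∈ M then D i x else 0) x = D i x := fun x hx => if_pos hx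
    let Q : ℕ → (Fin n → ℝ) → ℝ := fun j x => if x ∈ M then vderiv M (D i) (P j) x else 0
    let R : (Fin n → ℝ) → ℝ := fun x => if x ∈ M then vderiv M (D i) g x else 0
    have hQd : ∀ j, DefF L (Q j) := fun j =>
      defF_vderiv hM (hPd j) hD' hDD (hT i) ((hPc j).mono (by omega))
    have hRd : DefF L R := defF_vderiv hM hgd hD' hDD (hT i) (hgC.mono hp)
    have hQc : ∀ j, CpOn (p - (m + 1)) (Q j) M := fun j => by
      have h1 : CpOn (p - (m + 1)) (vderiv M (D i) (P j)) M :=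
        CpOn.vderiv ((hPc j).mono (by omega)) ((hDc i).mono (by omega)) (hT i)
      exact h1.congr fun x hx => if_pos hx
    have hRc : CpOn (p - (m + 1)) R M := by
      have h1 : CpOn (p - (m + 1)) (vderiv M (D i) g) M :=
        CpOn.vderiv (hgC.mono (by omega)) ((hDc i).mono (by omega)) (hT i)
      exact h1.congr fun x hx => if_pos hx
    refine ⟨fun j x => (if j = 0 then 0 else P (j - 1) x * R x) + (if j < m + 1 then Q j x else 0), ?_, ?_, ?_⟩
    · intro j
      have h1 := (hPd (j - 1)).use
      have h2 := (hQd j).use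
      have h3 := hRd.use
      by_cases hj0 : j = 0 <;> by_cases hj1 : j < m + 1 <;> simp only [hj0, hj1, if_true, if_false] <;> infer_instance
    · intro j
      rw [List.length_cons, ← hm]
      refine CpOn.add (f := fun x => if j = 0 then 0 else P (j - 1) x * R x)
        (f' := fun x => if j < m + 1 then Q j x else 0) ?_ ?_
      · split_ifs
        · exact cpOn_const 0
        · exact ((hPc _).mono (by omega)).mul hRc
      · split_ifs
        · exact hQc j
        · exact cpOn_const 0
    · intro G hG x hx
      have hIH := hP G hG
      rw [List.length_cons, ← hm]
      have hRx : R x = fderiv ℝ g x (D i x) := by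
        simp only [R, if_pos hx]
        exact (hasVD_self hp (hgc x hx) _).vderiv_eq (hT i x hx)
      have h1 : HasVD M (D i x) (vderivIter M D l (fun y => G 0 (g y))) x
          (∑ j ∈ Finset.range (m + 1), (G j (g x) * Q j x + P j x * (G (j + 1) (g x) * R x))) := by
        refine (HasVD.sum (f := fun j y => G j (g y) * P j y) (Finset.range (m + 1)) fun j hj => ?_).congr hIH
        rw [Finset.mem_range] at hj
        have h2 : HasVD M (D i x) (P j) x (Q j x) := by
          have := CpOn.hasVD (D := D i) hx (hT i x hx) ((hPc j).mono (by omega : 1 ≤ p - m))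
          simpa only [Q, if_pos hx] using this
        have h3 := hasVD_comp (M := M) hp (hgc x hx) (hgI x hx) (D i x) hG (show j + 1 ≤ p by omega)
        rw [← hRx] at h3
        exact HasVD.mul hx h3 h2
      change vderiv M (D i) (vderivIter M D l (fun y => G 0 (g y))) x = _
      rw [h1.vderiv_eq (hT i x hx)]
      simp only [mul_add, Finset.sum_add_distrib]
      rw [add_comm]
      congr 1
      · rw [Finset.sum_range_succ' _ (m + 1)]
        simp only [Nat.add_sub_cancel, if_true, mul_zero, add_zero, Nat.succ_ne_zero, if_false]
        exact Finset.sum_congr rfl fun j _ => by ring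
      · rw [Finset.sum_range_succ _ (m + 1)]
        simp only [lt_irrefl, if_false, mul_zero, add_zero]
        exact Finset.sum_congr rfl fun j hj => by rw [if_pos (Finset.mem_range.1 hj)]

theorem final [DM L]
    (p n d k : ℕ) (hp : 1 ≤ p)
    (M : Set (Fin n → ℝ)) (hM : IsDpSubmanifold L p d M)
    (D : Fin k → (Fin n → ℝ) → (Fin n → ℝ))
    (hD : ∀ i, IsDefMapOn L M (D i) ∧ CpOn (p - 1) (D i) M ∧
      ∀ x ∈ M, D i x ∈ TangentVecs M x)
    (ε : (Fin n → ℝ) → ℝ) (hεdef : IsDefFunOn L M ε) (hεc : ContinuousOn ε M)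
    (hεpos : ∀ x ∈ M, 0 < ε x) :
    ∃ f : (Fin n → ℝ) → ℝ, IsDefFunOn L M f ∧ CpOn p f M ∧ (∀ x ∈ M, 0 < f x) ∧
      ∀ α : List (Fin k), α.length ≤ p → ∀ x ∈ M, |vderivIter M D α f x| < ε x := by
  have hMd : Def L (fun x => x ∈ M) := isDef_iff.1 hM.1
  have hMu := hMd.useS
  have hclu := hMd.closure.useS
  have hZc := closed_front hM
  have hZd : Def L (fun x => x ∈ closure M \ M) := by
    simp only [Set.mem_sdiff]; infer_instance
  obtain ⟨g, hgd, hgc, hgb, hgK⟩ := PZ_closed p hZc hZd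
  have hMZ : ∀ x ∈ M, x ∉ closure M \ M := fun x hx h => h.2 hx
  have hgI : ∀ x ∈ M, g x ∈ Ioo (0:ℝ) 2 := fun x hx =>
    ⟨(hgb x (hMZ x hx)).1, by linarith [(hgb x (hMZ x hx)).2]⟩
  have hgcM : ∀ x ∈ M, ContDiffAt ℝ p g x := fun x hx => hgc x (hMZ x hx)
  have hex := fun α : List (Fin k) => expand hp hMd (fun i => (hD i).1) (fun i => (hD i).2.1)
    (fun i => (hD i).2.2) hgd hgcM hgI α
  have hex' : ∀ α : List (Fin k), ∃ P : ℕ → (Fin n → ℝ) → ℝ, α.length ≤ p → (∀ j, DefF L (P j)) ∧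
      (∀ j, CpOn (p - α.length) (P j) M) ∧
      ∀ G : ℕ → ℝ → ℝ, (∀ i ≤ p, ∀ s ∈ Ioo (0:ℝ) 2, HasDerivAt (G i) (G (i + 1) s) s) →
        ∀ x ∈ M, vderivIter M D α (fun y => G 0 (g y)) x =
          ∑ j ∈ Finset.range (α.length + 1), G j (g x) * P j x := by
    intro α
    by_cases h : α.length ≤ p
    · obtain ⟨P, hP⟩ := hex α h
      exact ⟨P, fun _ => hP⟩
    · exact ⟨fun _ _ => 0, fun h' => absurd h' h⟩
  choose P hP using hex'
  set S : (Fin n → ℝ) → ℝ := fun x => ∑ m : Fin (p + 1), ∑ a : Fin m → Fin k, ∑ j : Fin (m + 1),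
    |P (List.ofFn a) j x| with hS
  have hlen : ∀ (m : Fin (p + 1)) (a : Fin m → Fin k), (List.ofFn a).length ≤ p := fun m a => by
    rw [List.length_ofFn]; omega
  have hSd : DefF L S := by
    have h1 : ∀ (m : Fin (p + 1)) (a : Fin m → Fin k) (j : Fin (m + 1)), DefF L (fun x => |P (List.ofFn a) j x|) := by
      intro m a j
      have := ((hP _ (hlen m a)).1 j).use
      infer_instance
    refine DefF.sum (h := fun m => DefF.sum (h := fun a => DefF.sum (h := fun j => h1 m a j)))
  have hSc : ContinuousOn S M := by
    refine continuousOn_finsetSum _ fun m _ => continuousOn_finsetSum _ fun a _ => continuousOn_finsetSum _ fun j _ => ?_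
    exact ((hP _ (hlen m a)).2.1 j).continuousOn.abs
  have hS0 : ∀ x, 0 ≤ S x := fun x => by positivity
  have hSα : ∀ α : List (Fin k), α.length ≤ p → ∀ x, ∑ j ∈ Finset.range (α.length + 1), |P α j x| ≤ S x := by
    intro α hα x
    have h1 : ∑ j : Fin (α.length + 1), |P (List.ofFn α.get) j x| ≤
        ∑ a : Fin α.length → Fin k, ∑ j : Fin (α.length + 1), |P (List.ofFn a) j x| :=
      Finset.single_le_sum (f := fun a : Fin α.length → Fin k => ∑ j : Fin (α.length + 1), |P (List.ofFn a) j x|)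
        (fun a _ => by positivity) (Finset.mem_univ α.get)
    have h2 := Finset.single_le_sum (f := fun m : Fin (p + 1) => ∑ a : Fin m → Fin k, ∑ j : Fin (m + 1),
      |P (List.ofFn a) j x|) (fun a _ => by positivity) (Finset.mem_univ (⟨α.length, by omega⟩ : Fin (p + 1)))
    rw [List.ofFn_get, Fin.sum_univ_eq_sum_range (fun j => |P α j x|)] at h1
    exact h1.trans h2
  have hεd := defF_extend (0 : ℝ) hMd (isDefFunOn_iff.1 hεdef)
  set ε' : (Fin n → ℝ) → ℝ := fun x => if x ∈ M then ε x else 0 with hε'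
  have hεe : ∀ x ∈ M, ε' x = ε x := fun x hx => if_pos hx
  have hSu := hSd.use
  have hεu := hεd.use
  have hgu := hgd.use
  let A : ℝ → ℝ → Prop := fun s v => (0 ≤ v ∧ v ≤ 1) ∧ ∀ x, x ∈ M → s ≤ g x → v * (1 + S x) ≤ ε' x
  have hAd : Def L (fun q : ℝ × ℝ => A q.1 q.2) := by
    simp only [A]; infer_instance
  set B : ℝ → ℝ := fun s => sSup {v | A s v} with hB
  have hBd : DefF L B := DefF.sSup hAd
  have hbdd : ∀ s, BddAbove {v | A s v} := fun s => ⟨1, fun v hv => hv.1.2⟩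
  have hne : ∀ s, {v | A s v}.Nonempty := fun s => ⟨0, ⟨le_rfl, zero_le_one⟩, fun x hx _ => by
    rw [hεe x hx, zero_mul]; exact (hεpos x hx).le⟩
  have hBm : MonotoneOn B (Ioi 0) := by
    intro s _ s' _ hss
    refine csSup_le_csSup (hbdd s') (hne s) ?_
    rintro v ⟨h1, h2⟩
    exact ⟨h1, fun x k1 k2 => h2 x k1 (hss.trans k2)⟩
  have hBpos : ∀ s > 0, 0 < B s := by
    intro s hs
    have hK : IsCompact ({x | x ∉ closure M \ M ∧ s ≤ g x} ∩ closure M) := (hgK s hs).inter_right isClosed_closure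
    have hKM : {x | x ∉ closure M \ M ∧ s ≤ g x} ∩ closure M ⊆ M := by
      rintro x ⟨⟨h1, -⟩, h2⟩
      by_contra h3
      exact h1 ⟨h2, h3⟩
    have hcont : ContinuousOn (fun x => ε x / (1 + S x)) M :=
      hεc.div (continuousOn_const.add hSc) fun x _ => by have := hS0 x; positivity
    have : ∃ v, 0 < v ∧ ∀ x ∈ {x | x ∉ closure M \ M ∧ s ≤ g x} ∩ closure M, v ≤ ε x / (1 + S x) := by
      rcases Set.eq_empty_or_nonempty ({x | x ∉ closure M \ M ∧ s ≤ g x} ∩ closure M) with h | h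
      · rw [h]; exact ⟨1, one_pos, by simp⟩
      · obtain ⟨x0, hx0, hmin⟩ := hK.exists_isMinOn h (hcont.mono hKM)
        exact ⟨_, div_pos (hεpos x0 (hKM hx0)) (by have := hS0 x0; positivity), fun x hx => hmin hx⟩
    obtain ⟨v, hv, hvK⟩ := this
    refine (lt_min hv one_pos).trans_le (le_csSup (hbdd s) ⟨⟨(lt_min hv one_pos).le, min_le_right _ _⟩, fun x hx hsx => ?_⟩)
    rw [hεe x hx, ← le_div_iff₀ (by have := hS0 x; positivity)]
    exact (min_le_left _ _).trans (hvK x ⟨⟨hMZ x hx, hsx⟩, subset_closure hx⟩)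
  have hBle : ∀ x ∈ M, B (g x) * (1 + S x) ≤ ε x := by
    intro x hx
    have h0 := hS0 x
    rw [← le_div_iff₀ (by positivity)]
    refine csSup_le (hne _) fun v hv => ?_
    rw [le_div_iff₀ (by positivity), ← hεe x hx]
    exact hv.2 x hx le_rfl
  obtain ⟨G, hGd, hGpos, hG⟩ := str p hBd hBm hBpos
  have hG1 : ∀ i ≤ p, ∀ s ∈ Ioo (0:ℝ) 2, HasDerivAt (G i) (G (i + 1) s) s := fun i hi s hs => (hG i hi s hs).1
  have hGu := hGd.use
  refine ⟨fun x => G 0 (g x), ?_, ?_, fun x hx => hGpos _ (hgI x hx), ?_⟩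
  · rw [isDefFunOn_iff]
    infer_instance
  · intro x hx
    refine ⟨(closure M \ M)ᶜ, fun x => G 0 (g x), hZc.isOpen_compl, hMZ x hx, fun y hy => ?_, fun _ _ => rfl⟩
    have hy' : y ∉ closure M \ M := hy
    have h1 := (tower_contDiff isOpen_Ioo hG1 p 0 (by omega)).contDiffAt
      (isOpen_Ioo.mem_nhds (show g y ∈ Ioo (0:ℝ) 2 from ⟨(hgb y hy').1, by linarith [(hgb y hy').2]⟩))
    exact (ContDiffAt.comp y h1 (hgc y hy')).contDiffWithinAt
  · intro α hα x hx
    rw [(hP α hα).2.2 G hG1 x hx]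
    have hb := hBpos _ (hgI x hx).1
    calc |∑ j ∈ Finset.range (α.length + 1), G j (g x) * P α j x|
        ≤ ∑ j ∈ Finset.range (α.length + 1), |G j (g x) * P α j x| := Finset.abs_sum_le_sum_abs _ _
      _ ≤ ∑ j ∈ Finset.range (α.length + 1), B (g x) * |P α j x| := by
        refine Finset.sum_le_sum fun j hj => ?_
        rw [Finset.mem_range] at hj
        rw [abs_mul]
        gcongr
        exact (hG j (by omega) _ (hgI x hx)).2
      _ = B (g x) * ∑ j ∈ Finset.range (α.length + 1), |P α j x| := by rw [Finset.mul_sum]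
      _ ≤ B (g x) * S x := by gcongr; exact hSα α hα x
      _ < B (g x) * (1 + S x) := by gcongr; linarith
      _ ≤ ε x := hBle x hx

end PartF2


/-- existence of a positive definable `C^p` function with small iterated
derivatives along vector fields. -/
theorem stmt12 (L : FirstOrder.Language) [L.Structure ℝ] (hL : DMinimal L)
    (p n d k : ℕ) (hp : 1 ≤ p)
    (M : Set (Fin n → ℝ)) (hM : IsDpSubmanifold L p d M)
    (D : Fin k → (Fin n → ℝ) → (Fin n → ℝ))
    (hD : ∀ i, IsDefMapOn L M (D i) ∧ CpOn (p - 1) (D i) M ∧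
      ∀ x ∈ M, D i x ∈ TangentVecs M x)
    (ε : (Fin n → ℝ) → ℝ) (hεdef : IsDefFunOn L M ε) (hεc : ContinuousOn ε M)
    (hεpos : ∀ x ∈ M, 0 < ε x) :
    ∃ f : (Fin n → ℝ) → ℝ, IsDefFunOn L M f ∧ CpOn p f M ∧ (∀ x ∈ M, 0 < f x) ∧
      ∀ α : List (Fin k), α.length ≤ p → ∀ x ∈ M, |vderivIter M D α f x| < ε x := by
  
  haveI : DM L := ⟨hL⟩
  exact final p n d k hp M hM D hD ε hεdef hεc hεpos

end DMinPaper
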